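/- arXiv:1409.4258 — 2 statements merged into one kernel-verified Lean document; each statement's English description precedes it below -/
import Mathlib

section
/- Let s ≥ 11 be an integer, let μ₁, …, μ_s be real numbers with μ₁ irrational, and let η > 0. Then N(τ) ∼ 2η Γ(4/3)^s Γ(s/3)⁻¹ τ^{s/3 − 1} as τ → ∞; that is, the ratio N(τ) / (2η Γ(4/3)^s Γ(s/3)⁻¹ τ^{s/3 − 1}) tends to 1 as τ → ∞. -/
namespace ShiftedCubes

open Filter MeasureTheory
open scoped ContDiff FourierTransform Topology

/-- The additive character `x ↦ exp (2πix)` as a complex-valued function. -/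
noncomputable def ee (x : ℝ) : ℂ := Complex.exp (((2 * Real.pi * x : ℝ) : ℂ) * Complex.I)

/-- The distance to the nearest integer. -/
noncomputable def nn (x : ℝ) : ℝ := |x - round x|

lemma norm_ee (x : ℝ) : ‖ee x‖ = 1 := Complex.norm_exp_ofReal_mul_I _

lemma ee_add (x y : ℝ) : ee (x + y) = ee x * ee y := by
  rw [ee, ee, ee, ← Complex.exp_add]; congr 1; push_cast; ring

lemma conj_ee (x : ℝ) : (starRingEnd ℂ) (ee x) = ee (-x) := by
  rw [ee, ee, ← Complex.exp_conj, map_mul, Complex.conj_I, Complex.conj_ofReal]; congr 1; push_cast; ring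

lemma ee_int (n : ℤ) : ee n = 1 := by
  rw [ee, Complex.exp_eq_one_iff]; exact ⟨n, by push_cast; ring⟩

lemma ee_zero : ee 0 = 1 := by simpa using ee_int 0

lemma ee_nsmul (x : ℝ) (k : ℕ) : ee (k * x) = ee x ^ k := by
  rw [ee, ee, ← Complex.exp_nat_mul]; congr 1; push_cast; ring

lemma continuous_ee : Continuous ee := by unfold ee; fun_prop

lemma nn_nonneg (x : ℝ) : 0 ≤ nn x := abs_nonneg _

lemma nn_add_int (x : ℝ) (n : ℤ) : nn (x + n) = nn x := by
  simp [nn, round_add_intCast]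

lemma nn_le (x : ℝ) (n : ℤ) : nn x ≤ |x - n| := round_le x n

lemma nn_le_nn_add (x y : ℝ) : nn x ≤ nn y + |x - y| := by
  calc nn x ≤ |x - round y| := nn_le _ _
    _ = |(y - round y) + (x - y)| := by congr 1; ring
    _ ≤ nn y + |x - y| := abs_add_le _ _

lemma nn_of_abs_le {x : ℝ} (h : |x| ≤ 1 / 2) : nn x = |x| := by
  refine le_antisymm (by simpa using nn_le x 0) ?_
  by_cases h0 : round x = 0
  · simp [nn, h0]
  · have h1 : (1 : ℝ) ≤ |(round x : ℝ)| := by exact_mod_cast Int.one_le_abs h0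
    have h2 := abs_sub_abs_le_abs_sub (round x : ℝ) x
    rw [abs_sub_comm] at h2
    unfold nn
    linarith

lemma norm_ee_sub_one (x : ℝ) : 4 * nn x ≤ ‖ee x - 1‖ := by
  have h1 : ee x = ee (x - round x) := by
    have := ee_add (x - round x) (round x)
    rw [ee_int, mul_one] at this
    rw [← this]; congr 1; ring
  have hy := abs_sub_round x
  rw [h1, nn]
  set y := x - round x
  have : ‖ee y - 1‖ = ‖2 * Real.sin (2 * Real.pi * y / 2)‖ := by
    rw [← Complex.norm_exp_I_mul_ofReal_sub_one, ee, mul_comm]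
  rw [this, Real.norm_eq_abs, abs_mul, abs_two]
  have h3 : 2 * Real.pi * y / 2 = Real.pi * y := by ring
  rw [h3]
  have h4 : |Real.sin (Real.pi * y)| = Real.sin (Real.pi * |y|) := by
    rcases le_total 0 y with h | h
    · rw [abs_of_nonneg h, abs_of_nonneg]
      rw [abs_of_nonneg h] at hy
      exact Real.sin_nonneg_of_nonneg_of_le_pi (by positivity) (by nlinarith [Real.pi_pos])
    · rw [abs_of_nonpos h] at hy ⊢
      have := Real.sin_nonneg_of_nonneg_of_le_pi (x := Real.pi * (-y))
        (mul_nonneg Real.pi_pos.le (by linarith)) (by nlinarith [Real.pi_pos])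
      rw [← abs_of_nonneg this, mul_neg, Real.sin_neg, abs_neg]
  rw [h4]
  have := Real.mul_le_sin (x := Real.pi * |y|) (by positivity) (by nlinarith [Real.pi_pos])
  have h5 : 2 / Real.pi * (Real.pi * |y|) = 2 * |y| := by field_simp
  linarith

lemma norm_geom_sum_mul_nn_le (N : ℕ) (θ c : ℝ) :
    ‖∑ k ∈ Finset.range N, ee (k * θ + c)‖ * nn θ ≤ 1 := by
  have h1 : ∑ k ∈ Finset.range N, ee (k * θ + c) = (∑ k ∈ Finset.range N, ee θ ^ k) * ee c := by
    rw [Finset.sum_mul]; exact Finset.sum_congr rfl fun k _ => by rw [ee_add, ee_nsmul]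
  have h2 := congrArg norm (geom_sum_mul (ee θ) N)
  rw [norm_mul] at h2
  rw [h1, norm_mul, norm_ee, mul_one]
  have h3 : ‖ee θ ^ N - 1‖ ≤ 2 := by
    refine (norm_sub_le _ _).trans ?_
    rw [norm_pow, norm_ee]; norm_num
  have h4 := norm_ee_sub_one θ
  have h5 := mul_le_mul_of_nonneg_left h4 (norm_nonneg (∑ k ∈ Finset.range N, ee θ ^ k))
  nlinarith

lemma norm_sum_ee_le (N : ℕ) (p : ℕ → ℝ) : ‖∑ k ∈ Finset.range N, ee (p k)‖ ≤ N := by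
  refine (norm_sum_le _ _).trans ?_
  simp [norm_ee]

lemma sum_Ico_sum_range_sub {M : Type*} [AddCommMonoid M] (N : ℕ) (G : ℕ → ℕ → M) :
    ∑ h ∈ Finset.Ico 1 N, ∑ x ∈ Finset.range (N - h), G (x + h) x =
      ∑ y ∈ Finset.range N, ∑ x ∈ Finset.range y, G y x := by
  rw [Finset.sum_sigma', Finset.sum_sigma']
  refine Finset.sum_bij' (fun z _ => ⟨z.2 + z.1, z.2⟩) (fun z _ => ⟨z.1 - z.2, z.2⟩) ?_ ?_ ?_ ?_ ?_
  · rintro ⟨a, b⟩ h; simp at h ⊢; omega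
  · rintro ⟨a, b⟩ h; simp at h ⊢; omega
  · rintro ⟨a, b⟩ h; simp
  · rintro ⟨a, b⟩ h
    simp only [Finset.mem_sigma, Finset.mem_range] at h
    have : b + (a - b) = a := by omega
    simp [this]
  · rintro ⟨a, b⟩ h; rfl

lemma norm_sum_sq_eq (N : ℕ) (u : ℕ → ℂ) :
    ‖∑ x ∈ Finset.range N, u x‖ ^ 2 = ∑ x ∈ Finset.range N, ‖u x‖ ^ 2 +
      2 * (∑ y ∈ Finset.range N, ∑ x ∈ Finset.range y, u y * (starRingEnd ℂ) (u x)).re := by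
  induction N with
  | zero => simp
  | succ N ih =>
    rw [Finset.sum_range_succ, Finset.sum_range_succ, Finset.sum_range_succ, Complex.add_re,
      ← Finset.mul_sum, ← map_sum]
    simp only [← Complex.normSq_eq_norm_sq] at ih ⊢
    have h : (u N * (starRingEnd ℂ) (∑ x ∈ Finset.range N, u x)).re =
        ((∑ x ∈ Finset.range N, u x) * (starRingEnd ℂ) (u N)).re := by
      simp only [Complex.mul_re, Complex.conj_re, Complex.conj_im]; ring
    rw [Complex.normSq_add, ih, h]
    ring

/-- Weyl differencing. -/
lemma norm_sum_sq_le (N : ℕ) (u : ℕ → ℂ) (hu : ∀ x, ‖u x‖ = 1) :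
    ‖∑ x ∈ Finset.range N, u x‖ ^ 2 ≤ N + 2 * ∑ h ∈ Finset.Ico 1 N,
      ‖∑ x ∈ Finset.range (N - h), u (x + h) * (starRingEnd ℂ) (u x)‖ := by
  rw [norm_sum_sq_eq, ← sum_Ico_sum_range_sub N (fun y x => u y * (starRingEnd ℂ) (u x))]
  have h1 : ∑ x ∈ Finset.range N, ‖u x‖ ^ 2 = N := by simp [hu]
  rw [h1]
  gcongr
  exact (Complex.re_le_norm _).trans (norm_sum_le _ _)

lemma norm_cubic_sum_pow_four_le (N : ℕ) (α b c d : ℝ) :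
    ∃ U : ℕ → ℕ → ℝ, (∀ h k, 0 ≤ U h k) ∧ (∀ h k, U h k ≤ N) ∧
      (∀ h k, U h k * nn (6 * h * k * α) ≤ 1) ∧
      ‖∑ x ∈ Finset.range N, ee (α * x ^ 3 + b * x ^ 2 + c * x + d)‖ ^ 4 ≤
        10 * N ^ 3 + 16 * N * ∑ h ∈ Finset.Ico 1 N, ∑ k ∈ Finset.Ico 1 N, U h k := by
  set p : ℕ → ℝ := fun x => α * x ^ 3 + b * x ^ 2 + c * x + d with hp
  set T : ℕ → ℂ := fun h =>
    ∑ x ∈ Finset.range (N - h), ee (p (x + h)) * (starRingEnd ℂ) (ee (p x)) with hT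
  set v : ℕ → ℕ → ℂ := fun h x => ee (p (x + h)) * (starRingEnd ℂ) (ee (p x)) with hv
  set U : ℕ → ℕ → ℝ := fun h k =>
    ‖∑ x ∈ Finset.range (N - h - k), v h (x + k) * (starRingEnd ℂ) (v h x)‖ with hU
  have hvU : ∀ h k : ℕ, ∃ e : ℝ, ∀ x : ℕ,
      v h (x + k) * (starRingEnd ℂ) (v h x) = ee (x * (6 * h * k * α) + e) := by
    intro h k
    refine ⟨α * (3 * h * k ^ 2 + 3 * h ^ 2 * k) + 2 * b * h * k, fun x => ?_⟩
    simp only [hv, conj_ee, ← ee_add, hp]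
    congr 1; push_cast; ring
  have hle : ∀ h k, U h k ≤ N := by
    intro h k
    obtain ⟨e, he⟩ := hvU h k
    simp only [hU, he]
    refine (norm_sum_ee_le _ _).trans ?_
    exact_mod_cast (by omega : N - h - k ≤ N)
  refine ⟨U, fun _ _ => norm_nonneg _, hle, ?_, ?_⟩
  · intro h k
    obtain ⟨e, he⟩ := hvU h k
    simp only [hU, he]
    exact norm_geom_sum_mul_nn_le _ _ _
  have h1 : ‖∑ x ∈ Finset.range N, ee (p x)‖ ^ 2 ≤ N + 2 * ∑ h ∈ Finset.Ico 1 N, ‖T h‖ :=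
    norm_sum_sq_le N (fun x => ee (p x)) (fun x => norm_ee _)
  have h2 : ∀ h ∈ Finset.Ico 1 N, ‖T h‖ ^ 2 ≤ N + 2 * ∑ k ∈ Finset.Ico 1 N, U h k := by
    intro h hh
    have hvn : ∀ x, ‖v h x‖ = 1 := fun x => by simp [hv, norm_ee]
    have := norm_sum_sq_le (N - h) (v h) hvn
    refine this.trans ?_
    have hN : ((N - h : ℕ) : ℝ) ≤ N := by exact_mod_cast Nat.sub_le _ _
    refine add_le_add hN ?_
    gcongr
    exact Nat.sub_le _ _
  have hcard : ((Finset.Ico 1 N).card : ℝ) ≤ N := by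
    rw [Nat.card_Ico]; exact_mod_cast Nat.sub_le _ _
  have h3 : (∑ h ∈ Finset.Ico 1 N, ‖T h‖) ^ 2 ≤ N * ∑ h ∈ Finset.Ico 1 N, ‖T h‖ ^ 2 := by
    refine (sq_sum_le_card_mul_sum_sq).trans ?_
    gcongr
  have h4 : ∑ h ∈ Finset.Ico 1 N, ‖T h‖ ^ 2 ≤
      N * N + 2 * ∑ h ∈ Finset.Ico 1 N, ∑ k ∈ Finset.Ico 1 N, U h k := by
    refine (Finset.sum_le_sum h2).trans ?_
    rw [Finset.sum_add_distrib, ← Finset.mul_sum, Finset.sum_const, nsmul_eq_mul]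
    gcongr
  set W := ∑ h ∈ Finset.Ico 1 N, ∑ k ∈ Finset.Ico 1 N, U h k
  set t := ∑ h ∈ Finset.Ico 1 N, ‖T h‖
  have ht : 0 ≤ t := Finset.sum_nonneg fun _ _ => norm_nonneg _
  have hN0 : (0 : ℝ) ≤ N := Nat.cast_nonneg _
  have hN2 : (N : ℝ) ^ 2 ≤ N ^ 3 := by
    rcases Nat.eq_zero_or_pos N with h | h
    · simp [h]
    · exact pow_le_pow_right₀ (by exact_mod_cast h) (by norm_num)
  have h5 : ‖∑ x ∈ Finset.range N, ee (p x)‖ ^ 4 ≤ (N + 2 * t) ^ 2 := by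
    rw [show 4 = 2 * 2 from rfl, pow_mul]
    gcongr
  have h6 : t ^ 2 ≤ N * (N * N + 2 * W) := h3.trans (by gcongr)
  nlinarith [sq_nonneg (N - 2 * t)]

/-- The divisor bound. -/
lemma exists_card_divisors_le {ε : ℝ} (hε : 0 < ε) :
    ∃ C : ℝ, 1 ≤ C ∧ ∀ n : ℕ, n ≠ 0 → (n.divisors.card : ℝ) ≤ C * (n : ℝ) ^ ε := by
  set C₀ : ℝ := max 1 (1 / (ε * Real.log 2))
  set M : ℕ := ⌈(2 : ℝ) ^ (1 / ε)⌉₊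
  have hl2 : 0 < Real.log 2 := Real.log_pos (by norm_num)
  have hC₀ : 1 ≤ C₀ := le_max_left _ _
  refine ⟨C₀ ^ M, one_le_pow₀ hC₀, fun n hn => ?_⟩
  rw [Nat.card_divisors hn]
  have hn' : (n : ℝ) ^ ε = ∏ p ∈ n.primeFactors, ((p : ℝ) ^ (n.factorization p)) ^ ε := by
    rw [Real.finsetProd_rpow _ _ (fun p _ => by positivity)]
    congr 1
    conv_lhs => rw [← Nat.prod_factorization_pow_eq_self hn]
    rw [Finsupp.prod, Nat.support_factorization]; push_cast; rfl
  have key : ∀ p ∈ n.primeFactors, ((n.factorization p + 1 : ℕ) : ℝ) ≤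
      (if p < M then C₀ else 1) * ((p : ℝ) ^ (n.factorization p)) ^ ε := by
    intro p hp
    have hp2 : (2 : ℝ) ≤ p := by exact_mod_cast (Nat.prime_of_mem_primeFactors hp).two_le
    set a := n.factorization p
    have hcomm : ((p : ℝ) ^ a) ^ ε = ((p : ℝ) ^ ε) ^ a := by
      rw [← Real.rpow_natCast, ← Real.rpow_natCast, ← Real.rpow_mul (by positivity),
        ← Real.rpow_mul (by positivity), mul_comm]
    split_ifs with h
    · have h1 : 1 + a * (ε * Real.log 2) ≤ ((p : ℝ) ^ a) ^ ε := by
        calc 1 + a * (ε * Real.log 2) ≤ Real.exp (a * (ε * Real.log 2)) := by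
              rw [add_comm]; exact Real.add_one_le_exp _
          _ = ((2 : ℝ) ^ a) ^ ε := by
              rw [← Real.rpow_natCast, ← Real.rpow_mul (by positivity),
                Real.rpow_def_of_pos (by norm_num)]
              congr 1; ring
          _ ≤ _ := by gcongr
      have h2 : 1 ≤ C₀ * (ε * Real.log 2) := by
        have : 1 / (ε * Real.log 2) ≤ C₀ := le_max_right _ _
        rwa [div_le_iff₀ (by positivity)] at this
      have h3 : C₀ * (1 + a * (ε * Real.log 2)) ≤ C₀ * ((p : ℝ) ^ a) ^ ε := by gcongr
      push_cast
      nlinarith [(Nat.cast_nonneg a : (0 : ℝ) ≤ a)]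
    · have h1 : (2 : ℝ) ≤ (p : ℝ) ^ ε := by
        have h2 : (2 : ℝ) ^ (1 / ε) ≤ p :=
          (Nat.le_ceil _).trans (by exact_mod_cast not_lt.mp h)
        calc (2 : ℝ) = ((2 : ℝ) ^ (1 / ε)) ^ ε := by
              rw [← Real.rpow_mul (by norm_num), one_div_mul_cancel hε.ne', Real.rpow_one]
          _ ≤ _ := by gcongr
      rw [one_mul, hcomm]
      calc ((a + 1 : ℕ) : ℝ) ≤ (2 : ℝ) ^ a := by exact_mod_cast Nat.lt_two_pow_self
        _ ≤ _ := by gcongr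
  rw [hn']
  rw [Nat.cast_prod]
  refine (Finset.prod_le_prod (fun p _ => by positivity)
    (fun p hp => key p hp)).trans ?_
  rw [Finset.prod_mul_distrib]
  gcongr
  rw [Finset.prod_ite, Finset.prod_const, Finset.prod_const_one, mul_one]
  refine pow_le_pow_right₀ hC₀ ?_
  calc _ ≤ (Finset.range M).card :=
        Finset.card_le_card fun p hp => by simpa using (Finset.mem_filter.mp hp).2
    _ = M := Finset.card_range M

lemma nn_intCast_div (q : ℕ) [NeZero q] (m : ℤ) :
    nn ((m : ℝ) / q) = nn (((m : ZMod q).val : ℝ) / q) := by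
  have hq : (q : ℝ) ≠ 0 := by exact_mod_cast NeZero.ne q
  have h1 : (((m : ZMod q).val : ℤ)) = m % q := ZMod.val_intCast m
  have h2 : (m : ℝ) / q = ((m : ZMod q).val : ℝ) / q + ((m / q : ℤ) : ℝ) := by
    have h3 : (m : ℝ) = (((m % q : ℤ)) : ℝ) + q * ((m / q : ℤ) : ℝ) := by
      exact_mod_cast (Int.emod_add_mul_ediv m q).symm
    rw [← h1] at h3
    push_cast at h3
    rw [h3]; field_simp
  rw [h2, nn_add_int]

lemma sum_range_inv_nn_div_le (q : ℕ) (hq : 0 < q) :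
    ∑ r ∈ Finset.range q, (nn ((r : ℝ) / q))⁻¹ ≤ 2 * q * (1 + Real.log q) := by
  have hH : ∑ i ∈ Finset.range q, ((i + 1 : ℕ) : ℝ)⁻¹ ≤ 1 + Real.log q := by
    have := harmonic_le_one_add_log q
    rw [harmonic] at this
    push_cast at this ⊢
    exact this
  have h1 : ∀ r ∈ Finset.range q, (nn ((r : ℝ) / q))⁻¹ ≤ q * (r : ℝ)⁻¹ + q * ((q - r : ℕ) : ℝ)⁻¹ := by
    intro r hr
    rw [Finset.mem_range] at hr
    rw [nn, abs_sub_round_div_natCast_eq, Nat.mod_eq_of_lt hr, inv_div, div_eq_mul_inv, ← mul_add]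
    gcongr
    rcases min_choice r (q - r) with h | h <;> rw [h]
    · simp
    · simp
  refine (Finset.sum_le_sum h1).trans ?_
  rw [Finset.sum_add_distrib, ← Finset.mul_sum, ← Finset.mul_sum]
  have h2 : ∑ r ∈ Finset.range q, ((q - r : ℕ) : ℝ)⁻¹ = ∑ i ∈ Finset.range q, ((i + 1 : ℕ) : ℝ)⁻¹ := by
    rw [← Finset.sum_range_reflect]
    refine Finset.sum_congr rfl fun i hi => ?_
    rw [Finset.mem_range] at hi
    congr 2; omega
  have h3 : ∑ r ∈ Finset.range q, (r : ℝ)⁻¹ ≤ ∑ i ∈ Finset.range q, ((i + 1 : ℕ) : ℝ)⁻¹ := by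
    obtain ⟨n, rfl⟩ : ∃ n, q = n + 1 := ⟨q - 1, by omega⟩
    rw [Finset.sum_range_succ', Finset.sum_range_succ]
    simp
    positivity
  rw [h2]
  have hq0 : (0 : ℝ) ≤ q := Nat.cast_nonneg q
  nlinarith [mul_le_mul_of_nonneg_left hH hq0, mul_le_mul_of_nonneg_left h3 hq0]

lemma sum_range_natCast_zmod (q : ℕ) [NeZero q] (F : ZMod q → ℝ) :
    ∑ j ∈ Finset.range q, F (j : ZMod q) = ∑ z, F z :=
  Finset.sum_nbij' (fun j => (j : ZMod q)) ZMod.val (fun _ _ => Finset.mem_univ _)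
    (fun z _ => Finset.mem_range.mpr (ZMod.val_lt z))
    (fun _ hj => ZMod.val_cast_of_lt (Finset.mem_range.mp hj))
    (fun z _ => ZMod.natCast_zmod_val z) (fun _ _ => rfl)

lemma sum_inv_nn_le (q : ℕ) (hq : 0 < q) (a : ℤ) (ha : IsCoprime a (q : ℤ)) (M : ℕ) :
    ∑ n ∈ Finset.range M, (nn (n * (a / q : ℝ)))⁻¹ ≤
      ((M : ℝ) / q + 1) * (2 * q * (1 + Real.log q)) := by
  have : NeZero q := ⟨hq.ne'⟩
  set g : ZMod q → ℝ := fun z => (nn ((z.val : ℝ) / q))⁻¹ with hg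
  have hg0 : ∀ z, 0 ≤ g z := fun z => inv_nonneg.mpr (nn_nonneg _)
  have hgn : ∀ n : ℕ, (nn (n * (a / q : ℝ)))⁻¹ = g ((n : ZMod q) * (a : ZMod q)) := by
    intro n
    have : (n : ℝ) * (a / q : ℝ) = ((n * a : ℤ) : ℝ) / q := by push_cast; ring
    rw [this, nn_intCast_div, hg]
    push_cast; rfl
  have hu : IsUnit (a : ZMod q) := by
    have := (ZMod.isUnit_iff_coprime (a.natAbs) q)
    obtain ⟨x, y, hxy⟩ := ha
    refine IsUnit.of_mul_eq_one (x : ZMod q) ?_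
    have h := congrArg (Int.cast : ℤ → ZMod q) hxy
    push_cast at h
    rw [ZMod.natCast_self, mul_zero, add_zero] at h
    rw [mul_comm]; exact h
  have hsum : ∑ z, g (z * a) = ∑ z, g z := by
    obtain ⟨u, hu⟩ := hu
    rw [← hu]
    exact Fintype.sum_equiv (Units.mulRight u) _ _ (fun z => by simp)
  have hS : ∑ z, g z ≤ 2 * q * (1 + Real.log q) := by
    rw [← sum_range_natCast_zmod]
    refine le_trans (le_of_eq (Finset.sum_congr rfl fun _ hj => ?_)) (sum_range_inv_nn_div_le q hq)
    simp only [hg]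
    rw [ZMod.val_cast_of_lt (Finset.mem_range.mp hj)]
  have hblock : ∀ B : ℕ, ∑ n ∈ Finset.range (q * B), g ((n : ZMod q) * a) = B * ∑ z, g z := by
    intro B
    induction B with
    | zero => simp
    | succ B ih =>
      rw [Nat.mul_succ, Finset.sum_range_add, ih]
      have : ∑ x ∈ Finset.range q, g (((q * B + x : ℕ) : ZMod q) * a) = ∑ z, g z := by
        rw [← hsum, ← sum_range_natCast_zmod q (fun z => g (z * a))]
        refine Finset.sum_congr rfl fun x _ => ?_
        push_cast; simp
      rw [this]; push_cast; ring
  have hM : M ≤ q * (M / q + 1) := (Nat.lt_mul_div_succ M hq).le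
  simp_rw [hgn]
  calc _ ≤ ∑ n ∈ Finset.range (q * (M / q + 1)), g ((n : ZMod q) * a) :=
        Finset.sum_le_sum_of_subset_of_nonneg (Finset.range_mono hM) fun _ _ _ => hg0 _
    _ = ((M / q + 1 : ℕ) : ℝ) * ∑ z, g z := hblock _
    _ ≤ _ := by
      gcongr
      · exact Finset.sum_nonneg fun _ _ => hg0 _
      · push_cast
        gcongr
        exact Nat.cast_div_le

lemma sum_inv_sqrt_le (J : ℕ) : ∑ j ∈ Finset.range J, (√((j + 1 : ℕ) : ℝ))⁻¹ ≤ 2 * √J := by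
  induction J with
  | zero => simp
  | succ J ih =>
    rw [Finset.sum_range_succ]
    have h1 : (√((J + 1 : ℕ) : ℝ))⁻¹ ≤ 2 * √((J + 1 : ℕ) : ℝ) - 2 * √J := by
      have ha : 0 < √((J + 1 : ℕ) : ℝ) := by positivity
      have hb : 0 ≤ √(J : ℝ) := by positivity
      have ha2 : √((J + 1 : ℕ) : ℝ) ^ 2 = J + 1 := by rw [Real.sq_sqrt (by positivity)]; push_cast; ring
      have hb2 : √(J : ℝ) ^ 2 = J := Real.sq_sqrt (by positivity)
      rw [inv_le_iff_one_le_mul₀ ha]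
      nlinarith [sq_nonneg (√((J + 1 : ℕ) : ℝ) - √(J : ℝ))]
    linarith

lemma sum_dvd_inv_sqrt_le (L d : ℕ) (hd : 0 < d) :
    ∑ m ∈ (Finset.Ioc 0 L).filter (d ∣ ·), (√(m : ℝ))⁻¹ ≤ 2 * √L / d := by
  have h1 : ∑ m ∈ (Finset.Ioc 0 L).filter (d ∣ ·), (√(m : ℝ))⁻¹ =
      ∑ j ∈ Finset.range (L / d), (√d)⁻¹ * (√((j + 1 : ℕ) : ℝ))⁻¹ := by
    refine Finset.sum_nbij' (fun m => m / d - 1) (fun j => d * (j + 1)) ?_ ?_ ?_ ?_ ?_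
    · intro m hm
      simp only [Finset.mem_filter, Finset.mem_Ioc, Finset.mem_range] at hm ⊢
      obtain ⟨⟨h0, h1⟩, k, rfl⟩ := hm
      rw [Nat.mul_div_cancel_left _ hd]
      have : k ≤ L / d := (Nat.le_div_iff_mul_le hd).mpr (by linarith)
      have : 0 < k := Nat.pos_of_mul_pos_left h0
      omega
    · intro j hj
      simp only [Finset.mem_filter, Finset.mem_Ioc, Finset.mem_range] at hj ⊢
      refine ⟨⟨by positivity, ?_⟩, Dvd.intro _ rfl⟩
      have := (Nat.le_div_iff_mul_le hd).mp (Nat.succ_le_of_lt hj)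
      rw [mul_comm]; exact this
    · intro m hm
      simp only [Finset.mem_filter, Finset.mem_Ioc] at hm
      obtain ⟨⟨h0, h1⟩, k, rfl⟩ := hm
      have : 0 < k := Nat.pos_of_mul_pos_left h0
      simp only [Nat.mul_div_cancel_left _ hd, Nat.sub_add_cancel this]
    · intro j _
      simp [Nat.mul_div_cancel_left _ hd]
    · intro m hm
      simp only [Finset.mem_filter, Finset.mem_Ioc] at hm
      obtain ⟨⟨h0, h1⟩, k, rfl⟩ := hm
      have : 0 < k := Nat.pos_of_mul_pos_left h0
      simp only [Nat.mul_div_cancel_left _ hd, Nat.sub_add_cancel this]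
      rw [Nat.cast_mul, Real.sqrt_mul (by positivity), mul_inv]
  rw [h1, ← Finset.mul_sum]
  have hd' : (0 : ℝ) < d := by exact_mod_cast hd
  have h2 : √((L / d : ℕ) : ℝ) ≤ √L / √d := by
    rw [← Real.sqrt_div (by positivity)]
    exact Real.sqrt_le_sqrt Nat.cast_div_le
  calc _ ≤ (√d)⁻¹ * (2 * (√L / √d)) := by
        gcongr; exact (sum_inv_sqrt_le _).trans (by gcongr)
    _ = 2 * √L / (√d * √d) := by field_simp
    _ = _ := by rw [Real.mul_self_sqrt hd'.le]

lemma sum_dvd_mul_inv_sqrt_le (N q : ℕ) (hq : 0 < q) :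
    ∑ z ∈ (Finset.Ico 1 N ×ˢ Finset.Ico 1 N).filter (fun z => q ∣ 6 * z.1 * z.2),
      (√((6 * z.1 * z.2 : ℕ) : ℝ))⁻¹ ≤ 4 * √6 * N * (q.divisors.card / q) := by
  have h1 : ∀ z ∈ Finset.Ico 1 N ×ˢ Finset.Ico 1 N,
      (if q ∣ 6 * z.1 * z.2 then (√((6 * z.1 * z.2 : ℕ) : ℝ))⁻¹ else 0) ≤
      ∑ d ∈ q.divisors, (if d ∣ 6 * z.1 then (√((6 * z.1 : ℕ) : ℝ))⁻¹ else 0) *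
        (if q / d ∣ z.2 then (√(z.2 : ℝ))⁻¹ else 0) := by
    rintro ⟨h, k⟩ hz
    have hnn : ∀ d ∈ q.divisors, 0 ≤ (if d ∣ 6 * h then (√((6 * h : ℕ) : ℝ))⁻¹ else 0) *
        (if q / d ∣ k then (√(k : ℝ))⁻¹ else 0) := by
      intro d _; split_ifs <;> positivity
    split_ifs with hdiv
    · have hmem : q.gcd (6 * h) ∈ q.divisors :=
        Nat.mem_divisors.mpr ⟨Nat.gcd_dvd_left _ _, hq.ne'⟩
      refine le_trans (le_of_eq ?_) (Finset.single_le_sum hnn hmem)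
      have hd2 : q / q.gcd (6 * h) ∣ k := by
        have hg : 0 < q.gcd (6 * h) := Nat.gcd_pos_of_pos_left _ hq
        refine (Nat.coprime_div_gcd_div_gcd hg).dvd_of_dvd_mul_left ?_
        rw [Nat.div_mul_right_comm (Nat.gcd_dvd_right _ _)]
        exact Nat.div_dvd_div (Nat.gcd_dvd_left _ _) hdiv
      simp only [if_pos (Nat.gcd_dvd_right q (6 * h)), if_pos hd2]
      rw [Nat.cast_mul (6 * h) k, Real.sqrt_mul (by positivity), mul_inv]
    · exact Finset.sum_nonneg hnn
  rw [Finset.sum_filter]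
  refine (Finset.sum_le_sum h1).trans ?_
  rw [Finset.sum_comm]
  have h2 : ∀ d ∈ q.divisors, ∑ z ∈ Finset.Ico 1 N ×ˢ Finset.Ico 1 N,
      (if d ∣ 6 * z.1 then (√((6 * z.1 : ℕ) : ℝ))⁻¹ else 0) *
        (if q / d ∣ z.2 then (√(z.2 : ℝ))⁻¹ else 0) ≤ 4 * √6 * N / q := by
    intro d hd
    have hdq := Nat.dvd_of_mem_divisors hd
    have hd0 : 0 < d := Nat.pos_of_mem_divisors hd
    have hqd : 0 < q / d := Nat.div_pos (Nat.le_of_dvd hq hdq) hd0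
    rw [Finset.sum_product]
    simp only [← Finset.mul_sum]
    rw [← Finset.sum_mul]
    have ha : ∑ h ∈ Finset.Ico 1 N, (if d ∣ 6 * h then (√((6 * h : ℕ) : ℝ))⁻¹ else 0) ≤
        2 * √((6 * N : ℕ) : ℝ) / d := by
      refine le_trans ?_ (sum_dvd_inv_sqrt_le (6 * N) d hd0)
      rw [← Finset.sum_filter]
      refine le_trans (le_of_eq (Finset.sum_image (s := (Finset.Ico 1 N).filter (d ∣ 6 * ·))
        (g := fun h => 6 * h) (f := fun m : ℕ => (√(m : ℝ))⁻¹)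
        (fun x _ y _ hxy => by simpa using hxy)).symm) ?_
      refine Finset.sum_le_sum_of_subset_of_nonneg ?_ fun _ _ _ => by positivity
      intro m hm
      simp only [Finset.mem_image, Finset.mem_filter, Finset.mem_Ico, Finset.mem_Ioc] at hm ⊢
      obtain ⟨h, ⟨⟨h1, h2⟩, h3⟩, rfl⟩ := hm
      exact ⟨⟨by omega, by omega⟩, h3⟩
    have hb : ∑ k ∈ Finset.Ico 1 N, (if q / d ∣ k then (√(k : ℝ))⁻¹ else 0) ≤
        2 * √(N : ℝ) / (q / d : ℕ) := by
      refine le_trans ?_ (sum_dvd_inv_sqrt_le N (q / d) hqd)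
      rw [← Finset.sum_filter]
      refine Finset.sum_le_sum_of_subset_of_nonneg ?_ fun _ _ _ => by positivity
      refine Finset.filter_subset_filter _ fun m hm => ?_
      simp only [Finset.mem_Ico, Finset.mem_Ioc] at hm ⊢
      omega
    refine (mul_le_mul ha hb (Finset.sum_nonneg fun _ _ => by split_ifs <;> positivity)
      (by positivity)).trans (le_of_eq ?_)
    have hd' : (d : ℝ) ≠ 0 := by positivity
    rw [Nat.cast_div hdq hd', Nat.cast_mul, Real.sqrt_mul (by positivity)]
    have : √(N : ℝ) * √(N : ℝ) = N := Real.mul_self_sqrt (by positivity)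
    push_cast
    field_simp
    linear_combination 4 * this
  refine (Finset.sum_le_sum h2).trans (le_of_eq ?_)
  rw [Finset.sum_const, nsmul_eq_mul]; ring

lemma sum_le_of_not_dvd {C e : ℝ} (he : 0 ≤ e) (hC : 1 ≤ C)
    (hdiv : ∀ n : ℕ, n ≠ 0 → (n.divisors.card : ℝ) ≤ C * (n : ℝ) ^ e)
    (N q : ℕ) (hq : 0 < q) (a : ℤ) (ha : IsCoprime a (q : ℤ)) :
    ∑ z ∈ Finset.Ico 1 N ×ˢ Finset.Ico 1 N,
      (nn (((6 * z.1 * z.2 : ℕ) : ℝ) * (a / q : ℝ)))⁻¹ ≤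
      C * (6 * (N : ℝ) ^ 2) ^ e * ((6 * (N : ℝ) ^ 2 / q + 1) * (2 * q * (1 + Real.log q))) := by
  set S := Finset.Ico 1 N ×ˢ Finset.Ico 1 N
  have hmaps : ∀ z ∈ S, 6 * z.1 * z.2 ∈ Finset.range (6 * N ^ 2) := by
    rintro ⟨h, k⟩ hz
    simp only [S, Finset.mem_product, Finset.mem_Ico, Finset.mem_range] at hz ⊢
    have h1 : h * k < N * N := Nat.mul_lt_mul'' hz.1.2 hz.2.2
    nlinarith
  rw [← Finset.sum_fiberwise_of_maps_to hmaps]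
  have h1 : ∀ n ∈ Finset.range (6 * N ^ 2), ∑ z ∈ S with 6 * z.1 * z.2 = n,
      (nn (((6 * z.1 * z.2 : ℕ) : ℝ) * (a / q : ℝ)))⁻¹ ≤
      C * (6 * (N : ℝ) ^ 2) ^ e * (nn (n * (a / q : ℝ)))⁻¹ := by
    intro n hn
    rw [Finset.mem_range] at hn
    have h2 : ∑ z ∈ S with 6 * z.1 * z.2 = n, (nn (((6 * z.1 * z.2 : ℕ) : ℝ) * (a / q : ℝ)))⁻¹ =
        (S.filter (fun z => 6 * z.1 * z.2 = n)).card * (nn (n * (a / q : ℝ)))⁻¹ := by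
      rw [← nsmul_eq_mul, ← Finset.sum_const]
      refine Finset.sum_congr rfl fun z hz => ?_
      rw [(Finset.mem_filter.mp hz).2]
    rw [h2]
    gcongr
    · exact inv_nonneg.mpr (nn_nonneg _)
    rcases Nat.eq_zero_or_pos n with h0 | h0
    · have : S.filter (fun z => 6 * z.1 * z.2 = n) = ∅ := by
        refine Finset.filter_eq_empty_iff.mpr ?_
        rintro ⟨h, k⟩ hz
        simp only [S, Finset.mem_product, Finset.mem_Ico] at hz
        have : 0 < 6 * h * k := by have := hz.1.1; have := hz.2.1; positivity
        simp only; omega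
      rw [this]; simp only [Finset.card_empty, Nat.cast_zero]; positivity
    · calc ((S.filter (fun z => 6 * z.1 * z.2 = n)).card : ℝ) ≤ n.divisors.card := by
            norm_cast
            refine Finset.card_le_card_of_injOn Prod.fst ?_ ?_
            · rintro ⟨h, k⟩ hz
              simp only [Finset.coe_filter, Set.mem_ofPred_eq] at hz
              simp only [Finset.mem_coe, Nat.mem_divisors]
              exact ⟨⟨6 * k, by rw [← hz.2]; ring⟩, h0.ne'⟩
            · rintro ⟨h, k⟩ hz ⟨h', k'⟩ hz' heq
              simp only [Finset.coe_filter, Set.mem_ofPred_eq] at hz hz' heq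
              subst heq
              have hp : 0 < 6 * h := by
                have := (Finset.mem_Ico.mp (Finset.mem_product.mp hz.1).1).1
                simp only at this; omega
              have := Nat.eq_of_mul_eq_mul_left hp (hz.2.trans hz'.2.symm)
              rw [this]
        _ ≤ C * (n : ℝ) ^ e := hdiv n h0.ne'
        _ ≤ _ := by
          gcongr
          exact_mod_cast hn.le
  refine (Finset.sum_le_sum h1).trans ?_
  rw [← Finset.mul_sum]
  gcongr
  refine (sum_inv_nn_le q hq a ha _).trans (le_of_eq ?_)
  push_cast; ring

lemma inv_le_nn_intCast_div {q : ℕ} (hq : 0 < q) {m : ℤ} (hm : ¬ (q : ℤ) ∣ m) :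
    (q : ℝ)⁻¹ ≤ nn ((m : ℝ) / q) := by
  have : NeZero q := ⟨hq.ne'⟩
  rw [nn_intCast_div]
  set r := (m : ZMod q).val with hr
  have hr0 : r ≠ 0 := by
    rw [hr, Ne, ZMod.val_eq_zero, ZMod.intCast_zmod_eq_zero_iff_dvd]; exact hm
  have hrq : r < q := ZMod.val_lt _
  rw [nn, abs_sub_round_div_natCast_eq, Nat.mod_eq_of_lt hrq, inv_eq_one_div]
  gcongr
  have : 1 ≤ min r (q - r) := by omega
  exact_mod_cast this

lemma le_of_dvd {N q n : ℕ} (hq : 0 < q) (hn : n ≤ 6 * N ^ 2) {a : ℤ} {α u : ℝ}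
    (hβ : |α - a / q| ≤ 1 / (12 * N ^ 2 * q)) (hdvd : q ∣ n) (hn0 : 0 < n) (hN : 0 < N)
    (hu0 : 0 ≤ u) (huN : u ≤ N) (hu : u * nn (n * α) ≤ 1) :
    u ≤ √7 * N ^ 2 * (√(1 + N ^ 3 * |α - a / q|))⁻¹ * (√(n : ℝ))⁻¹ := by
  set β := |α - a / q| with hβd
  have hq' : (1 : ℝ) ≤ q := by exact_mod_cast hq
  have hN' : (1 : ℝ) ≤ N := by exact_mod_cast hN
  have hn' : (n : ℝ) ≤ 6 * N ^ 2 := by exact_mod_cast hn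
  have hβ0 : 0 ≤ β := abs_nonneg _
  have h1 : n * β ≤ 1 / 2 := by
    calc n * β ≤ (6 * N ^ 2) * (1 / (12 * N ^ 2 * q)) := by gcongr
      _ = 1 / 2 * (1 / q) := by field_simp; norm_num
      _ ≤ 1 / 2 * 1 := by gcongr; rw [div_le_one (by positivity)]; exact hq'
      _ = 1 / 2 := by norm_num
  have h2 : nn (n * α) = n * β := by
    obtain ⟨k, rfl⟩ := hdvd
    have h3 : ((q * k : ℕ) : ℝ) * α = ((q * k : ℕ) : ℝ) * (α - a / q) + ((k * a : ℤ) : ℝ) := by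
      push_cast; field_simp; ring
    have h4 : |((q * k : ℕ) : ℝ) * (α - a / q)| = ((q * k : ℕ) : ℝ) * β := by
      rw [abs_mul, Nat.abs_cast]
    rw [h3, nn_add_int, nn_of_abs_le (by rw [h4]; exact h1), h4]
  rw [h2] at hu
  have hB : 0 < 1 + N ^ 3 * β := by positivity
  have hn0' : (0 : ℝ) < n := by exact_mod_cast hn0
  rw [← div_eq_mul_inv, ← div_eq_mul_inv, div_div, le_div_iff₀ (by positivity)]
  refine le_of_sq_le_sq ?_ (by positivity)
  rw [mul_pow, mul_pow, mul_pow, Real.sq_sqrt hB.le, Real.sq_sqrt hn0'.le,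
    Real.sq_sqrt (by norm_num)]
  have h5 : u ^ 2 ≤ N ^ 2 := by gcongr
  have h6 : u ^ 2 * n ≤ N ^ 2 * (6 * N ^ 2) := by gcongr
  have h7 : u * (u * (n * β)) ≤ N * 1 := by gcongr
  have h8 : (N : ℝ) ^ 3 * (u * (u * (n * β))) ≤ N ^ 3 * (N * 1) := by gcongr
  nlinarith

lemma le_of_not_dvd {N q n : ℕ} (hq : 0 < q) (hn : n ≤ 6 * N ^ 2) {a : ℤ} {α u : ℝ}
    (ha : IsCoprime a (q : ℤ)) (hN : 0 < N)
    (hβ : |α - a / q| ≤ 1 / (12 * N ^ 2 * q)) (hdvd : ¬ q ∣ n)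
    (hu0 : 0 ≤ u) (hu : u * nn (n * α) ≤ 1) :
    u ≤ 2 * (nn (n * (a / q : ℝ)))⁻¹ := by
  have hq' : (0 : ℝ) < q := by exact_mod_cast hq
  have hN' : (0 : ℝ) < N := by exact_mod_cast hN
  have hn' : (n : ℝ) ≤ 6 * N ^ 2 := by exact_mod_cast hn
  have h1 : (q : ℝ)⁻¹ ≤ nn (n * (a / q : ℝ)) := by
    have h2 : (n : ℝ) * (a / q : ℝ) = ((n * a : ℤ) : ℝ) / q := by push_cast; ring
    rw [h2]
    refine inv_le_nn_intCast_div hq fun h => hdvd ?_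
    exact_mod_cast ha.symm.dvd_of_dvd_mul_right h
  have h2 : nn (n * (a / q : ℝ)) ≤ nn (n * α) + 1 / 2 * (q : ℝ)⁻¹ := by
    refine (nn_le_nn_add _ (n * α)).trans ?_
    gcongr
    rw [← mul_sub, abs_mul, Nat.abs_cast, abs_sub_comm]
    calc n * |α - a / q| ≤ (6 * N ^ 2) * (1 / (12 * N ^ 2 * q)) := by gcongr
      _ = 1 / 2 * (q : ℝ)⁻¹ := by field_simp; norm_num
  have h3 : 0 < nn (n * (a / q : ℝ)) := lt_of_lt_of_le (by positivity) h1
  rw [← div_eq_mul_inv, le_div_iff₀ h3]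
  nlinarith

/-- Weyl's inequality for cubic polynomials, with a sharp dependence on the rational
approximation to the leading coefficient. -/
theorem exists_weyl_bound : ∃ K : ℝ, 1 ≤ K ∧ ∀ (N : ℕ) (α b c d : ℝ) (a : ℤ) (q : ℕ), 0 < N →
    0 < q → q ≤ 12 * N ^ 2 → IsCoprime a (q : ℤ) → |α - a / q| ≤ 1 / (12 * N ^ 2 * q) →
    ‖∑ x ∈ Finset.range N, ee (α * x ^ 3 + b * x ^ 2 + c * x + d)‖ ^ 4 ≤
      K * ((N : ℝ) ^ (52 / 17 : ℝ) +
        N ^ 4 * (q : ℝ) ^ (-(4 / 5) : ℝ) * (√(1 + N ^ 3 * |α - a / q|))⁻¹) := by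
  set e : ℝ := 1 / 68 with he
  obtain ⟨C, hC, hdiv⟩ := exists_card_divisors_le (ε := e) (by norm_num [he])
  set A : ℝ := 36 * C * (12 : ℝ) ^ (1 / 34 : ℝ) * 69 with hA
  set D : ℝ := √7 * (4 * √6) * C with hD
  refine ⟨10 + 32 * A + 16 * D, by
    have : 0 ≤ A := by positivity
    have : 0 ≤ D := by positivity
    linarith, ?_⟩
  intro N α b c d a q hN hq hqN ha hβ
  obtain ⟨U, hU0, hUN, hUn, hS⟩ := norm_cubic_sum_pow_four_le N α b c d
  refine hS.trans ?_
  have hN1 : (1 : ℝ) ≤ N := by exact_mod_cast hN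
  have hq1 : (1 : ℝ) ≤ q := by exact_mod_cast hq
  set B : ℝ := (√(1 + N ^ 3 * |α - a / q|))⁻¹ with hB
  have hB0 : 0 ≤ B := by positivity
  set S := Finset.Ico 1 N ×ˢ Finset.Ico 1 N with hSd
  rw [← Finset.sum_product' (Finset.Ico 1 N) (Finset.Ico 1 N) U, ← hSd,
    ← Finset.sum_filter_add_sum_filter_not S (fun z => q ∣ 6 * z.1 * z.2)]
  have hmem : ∀ z ∈ S, 0 < 6 * z.1 * z.2 ∧ 6 * z.1 * z.2 ≤ 6 * N ^ 2 := by
    rintro ⟨h, k⟩ hz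
    simp only [hSd, Finset.mem_product, Finset.mem_Ico] at hz ⊢
    obtain ⟨⟨h1, h2⟩, h3, h4⟩ := hz
    refine ⟨by positivity, ?_⟩
    have h1 : h * k < N * N := Nat.mul_lt_mul'' h2 h4
    nlinarith
  have hUn' : ∀ h k : ℕ, U h k * nn (((6 * h * k : ℕ) : ℝ) * α) ≤ 1 := by
    intro h k; push_cast; exact hUn h k
  have h1 : ∑ z ∈ S with q ∣ 6 * z.1 * z.2, U z.1 z.2 ≤
      D * N ^ 3 * (q : ℝ) ^ (-(4 / 5) : ℝ) * B := by
    calc ∑ z ∈ S with q ∣ 6 * z.1 * z.2, U z.1 z.2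
        ≤ ∑ z ∈ S with q ∣ 6 * z.1 * z.2,
            √7 * N ^ 2 * B * (√((6 * z.1 * z.2 : ℕ) : ℝ))⁻¹ := by
          refine Finset.sum_le_sum fun z hz => ?_
          rw [Finset.mem_filter] at hz
          exact le_of_dvd hq (hmem z hz.1).2 hβ hz.2 (hmem z hz.1).1 hN (hU0 _ _) (hUN _ _)
            (hUn' _ _)
      _ ≤ √7 * N ^ 2 * B * (4 * √6 * N * (q.divisors.card / q)) := by
          rw [← Finset.mul_sum]
          gcongr
          exact sum_dvd_mul_inv_sqrt_le N q hq
      _ ≤ √7 * N ^ 2 * B * (4 * √6 * N * (C * (q : ℝ) ^ (-(4 / 5) : ℝ))) := by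
          gcongr
          rw [div_le_iff₀ (by positivity)]
          calc (q.divisors.card : ℝ) ≤ C * (q : ℝ) ^ e := hdiv q hq.ne'
            _ ≤ C * (q : ℝ) ^ (1 / 5 : ℝ) := by
              gcongr
              norm_num [he]
            _ = C * (q : ℝ) ^ (-(4 / 5) : ℝ) * q := by
              rw [mul_assoc, ← Real.rpow_add_one (by positivity)]; norm_num
      _ = _ := by rw [hD]; ring
  have h2 : ∑ z ∈ S with ¬ q ∣ 6 * z.1 * z.2, U z.1 z.2 ≤ 2 * (A * (N : ℝ) ^ (35 / 17 : ℝ)) := by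
    calc ∑ z ∈ S with ¬ q ∣ 6 * z.1 * z.2, U z.1 z.2
        ≤ ∑ z ∈ S with ¬ q ∣ 6 * z.1 * z.2,
            2 * (nn (((6 * z.1 * z.2 : ℕ) : ℝ) * (a / q : ℝ)))⁻¹ := by
          refine Finset.sum_le_sum fun z hz => ?_
          rw [Finset.mem_filter] at hz
          exact le_of_not_dvd hq (hmem z hz.1).2 ha hN hβ hz.2 (hU0 _ _) (hUn' _ _)
      _ ≤ ∑ z ∈ S, 2 * (nn (((6 * z.1 * z.2 : ℕ) : ℝ) * (a / q : ℝ)))⁻¹ :=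
          Finset.sum_le_sum_of_subset_of_nonneg (Finset.filter_subset _ _) fun _ _ _ =>
            mul_nonneg zero_le_two (inv_nonneg.mpr (nn_nonneg _))
      _ ≤ 2 * (C * (6 * (N : ℝ) ^ 2) ^ e *
            ((6 * (N : ℝ) ^ 2 / q + 1) * (2 * q * (1 + Real.log q)))) := by
          rw [← Finset.mul_sum]
          gcongr
          exact sum_le_of_not_dvd (by norm_num [he]) hC hdiv N q hq a ha
      _ ≤ _ := by
          refine mul_le_mul_of_nonneg_left ?_ zero_le_two
          have hqN' : (q : ℝ) ≤ 12 * N ^ 2 := by exact_mod_cast hqN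
          have h3 : (6 * (N : ℝ) ^ 2 / q + 1) * (2 * q * (1 + Real.log q)) =
              (12 * N ^ 2 + 2 * q) * (1 + Real.log q) := by field_simp; ring
          have hP : (1 : ℝ) ≤ (12 * (N : ℝ) ^ 2) ^ e :=
            Real.one_le_rpow (by nlinarith) (by norm_num [he])
          have hlog : Real.log q ≤ (12 * (N : ℝ) ^ 2) ^ e * 68 := by
            calc Real.log q ≤ (q : ℝ) ^ e / e :=
                  Real.log_le_rpow_div (by positivity) (by norm_num [he])
              _ ≤ (12 * (N : ℝ) ^ 2) ^ e / e := by gcongr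
              _ = _ := by rw [he]; ring
          have hl0 : 0 ≤ Real.log q := Real.log_nonneg hq1
          have hPP : (12 * (N : ℝ) ^ 2) ^ e * (12 * (N : ℝ) ^ 2) ^ e =
              (12 : ℝ) ^ (1 / 34 : ℝ) * (N : ℝ) ^ (1 / 17 : ℝ) := by
            rw [← Real.rpow_add (by positivity), Real.mul_rpow (by norm_num) (by positivity),
              ← Real.rpow_natCast, ← Real.rpow_mul (by positivity)]
            norm_num [he]
          rw [h3]
          calc C * (6 * (N : ℝ) ^ 2) ^ e * ((12 * N ^ 2 + 2 * q) * (1 + Real.log q))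
              ≤ C * (12 * (N : ℝ) ^ 2) ^ e *
                ((12 * N ^ 2 + 2 * (12 * N ^ 2)) * (69 * (12 * (N : ℝ) ^ 2) ^ e)) := by
                gcongr
                · norm_num
                · linarith
            _ = 36 * 69 * C * N ^ 2 * ((12 * (N : ℝ) ^ 2) ^ e * (12 * (N : ℝ) ^ 2) ^ e) := by
                ring
            _ = A * ((N : ℝ) ^ (1 / 17 : ℝ) * N ^ 2) := by rw [hPP, hA]; ring
            _ = A * (N : ℝ) ^ (35 / 17 : ℝ) := by
                rw [← Real.rpow_add_natCast (by positivity)]; norm_num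
  have h3 : (N : ℝ) ^ 3 ≤ (N : ℝ) ^ (52 / 17 : ℝ) := by
    rw [← Real.rpow_natCast]
    exact Real.rpow_le_rpow_of_exponent_le hN1 (by norm_num)
  have h4 : (N : ℝ) ^ (35 / 17 : ℝ) * N = (N : ℝ) ^ (52 / 17 : ℝ) := by
    rw [← Real.rpow_add_one (by positivity)]; norm_num
  set X := (N : ℝ) ^ (52 / 17 : ℝ)
  set Y := (q : ℝ) ^ (-(4 / 5) : ℝ)
  have hX : 0 ≤ X := by positivity
  have hY : 0 ≤ Y := by positivity
  have hA0 : 0 ≤ A := by positivity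
  have hD0 : 0 ≤ D := by positivity
  calc _ ≤ 10 * X + 16 * N * (D * N ^ 3 * Y * B + 2 * (A * (N : ℝ) ^ (35 / 17 : ℝ))) := by gcongr
    _ = (10 + 32 * A) * X + 16 * D * (N ^ 4 * Y * B) := by rw [← h4]; ring
    _ ≤ (10 + 32 * A + 16 * D) * X + (10 + 32 * A + 16 * D) * (N ^ 4 * Y * B) :=
      add_le_add (mul_le_mul_of_nonneg_right (by linarith) hX)
        (mul_le_mul_of_nonneg_right (by linarith) (by positivity))
    _ = _ := by ring

/-- The exponential sum over shifted cubes. -/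
noncomputable def cubeSum (N : ℕ) (ν α : ℝ) : ℂ := ∑ k ∈ Finset.range N, ee (α * (k + ν) ^ 3)

lemma continuous_cubeSum (N : ℕ) (ν : ℝ) : Continuous (cubeSum N ν) := by
  unfold cubeSum
  exact continuous_finsetSum _ fun k _ => continuous_ee.comp (by fun_prop)

lemma norm_cubeSum_le (N : ℕ) (ν α : ℝ) : ‖cubeSum N ν α‖ ≤ N := norm_sum_ee_le N _

lemma norm_integral_ee_le {L : ℝ} (hL : 0 < L) (a b : ℝ) :
    ‖∫ x in a..b, ee (x * L)‖ ≤ L⁻¹ := by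
  have hc : ((2 * Real.pi * L : ℝ) : ℂ) * Complex.I ≠ 0 := by
    simp [Real.pi_ne_zero, hL.ne']
  have h1 : ∀ x : ℝ, ee (x * L) = Complex.exp (((2 * Real.pi * L : ℝ) : ℂ) * Complex.I * x) := by
    intro x; rw [ee]; congr 1; push_cast; ring
  have h2 : ∀ x : ℝ, ‖Complex.exp (((2 * Real.pi * L : ℝ) : ℂ) * Complex.I * x)‖ = 1 := by
    intro x; rw [← h1, norm_ee]
  simp_rw [h1]
  rw [integral_exp_mul_complex hc, norm_div, norm_mul, Complex.norm_I, mul_one,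
    Complex.norm_real, Real.norm_of_nonneg (by positivity), inv_eq_one_div]
  have h3 := norm_sub_le (Complex.exp (((2 * Real.pi * L : ℝ) : ℂ) * Complex.I * b))
    (Complex.exp (((2 * Real.pi * L : ℝ) : ℂ) * Complex.I * a))
  rw [h2, h2] at h3
  rw [div_le_div_iff₀ (by positivity) hL]
  nlinarith [Real.pi_gt_three]

lemma integral_norm_cubeSum_sq_le (N : ℕ) {ν : ℝ} (hν : 0 ≤ ν) (a b : ℝ) :
    ∫ α in a..b, ‖cubeSum N ν α‖ ^ 2 ≤ (b - a + 2) * N := by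
  have h1 : ∀ α, ‖cubeSum N ν α‖ ^ 2 = N + 2 * (∑ y ∈ Finset.range N, ∑ x ∈ Finset.range y,
      ee (α * ((y + ν) ^ 3 - (x + ν) ^ 3))).re := by
    intro α
    rw [cubeSum, norm_sum_sq_eq]
    simp only [norm_ee, conj_ee, ← ee_add]
    simp [mul_add, sub_eq_add_neg]
  simp_rw [h1]
  have hcont : ∀ x y : ℕ, Continuous fun α : ℝ => ee (α * ((y + ν) ^ 3 - (x + ν) ^ 3)) :=
    fun x y => continuous_ee.comp (by fun_prop)
  have hcont2 : Continuous fun α : ℝ => ∑ y ∈ Finset.range N, ∑ x ∈ Finset.range y,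
      ee (α * ((y + ν) ^ 3 - (x + ν) ^ 3)) :=
    continuous_finsetSum _ fun y _ => continuous_finsetSum _ fun x _ => hcont x y
  rw [intervalIntegral.integral_add (by simp)
    ((show Continuous fun α : ℝ => 2 * (∑ y ∈ Finset.range N, ∑ x ∈ Finset.range y,
      ee (α * ((y + ν) ^ 3 - (x + ν) ^ 3))).re from
        continuous_const.mul (Complex.continuous_re.comp hcont2)).intervalIntegrable _ _),
    intervalIntegral.integral_const_mul]
  have h2 : ∫ α in a..b, (∑ y ∈ Finset.range N, ∑ x ∈ Finset.range y,
      ee (α * ((y + ν) ^ 3 - (x + ν) ^ 3))).re = (∑ y ∈ Finset.range N, ∑ x ∈ Finset.range y,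
      ∫ α in a..b, ee (α * ((y + ν) ^ 3 - (x + ν) ^ 3))).re := by
    have := Complex.reCLM.intervalIntegral_comp_comm (hcont2.intervalIntegrable (μ := MeasureTheory.volume) a b)
    simp only [Complex.reCLM_apply] at this
    rw [this, intervalIntegral.integral_finsetSum]
    · congr 1
      refine Finset.sum_congr rfl fun y _ => ?_
      rw [intervalIntegral.integral_finsetSum]
      exact fun x _ => (hcont x y).intervalIntegrable _ _
    · exact fun y _ => (continuous_finsetSum _ fun x _ => hcont x y).intervalIntegrable _ _
  have h3 : ‖∑ y ∈ Finset.range N, ∑ x ∈ Finset.range y,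
      ∫ α in a..b, ee (α * ((y + ν) ^ 3 - (x + ν) ^ 3))‖ ≤ ∑ y ∈ Finset.range N, (1 : ℝ) := by
    refine norm_sum_le_of_le _ fun y _ => ?_
    rcases Nat.eq_zero_or_pos y with rfl | hy
    · simp
    have hy1 : (1 : ℝ) ≤ y := by exact_mod_cast hy
    have h4 : ‖∑ x ∈ Finset.range y, ∫ α in a..b, ee (α * ((y + ν) ^ 3 - (x + ν) ^ 3))‖ ≤
        ∑ x ∈ Finset.range y, ((y : ℝ) ^ 2)⁻¹ := by
      refine norm_sum_le_of_le _ fun x hx => ?_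
      have hx1 : (x : ℝ) + 1 ≤ y := by exact_mod_cast Finset.mem_range.mp hx
      have hx0 : (0 : ℝ) ≤ x := Nat.cast_nonneg x
      have h5 : (y : ℝ) ^ 2 ≤ (y + ν) ^ 3 - (x + ν) ^ 3 := by
        have e : ((y : ℝ) + ν) ^ 3 - (x + ν) ^ 3 =
          ((y + ν) ^ 2 + (y + ν) * (x + ν) + (x + ν) ^ 2) * (y - x) := by ring
        rw [e]
        have h6 : (y : ℝ) ^ 2 ≤ (y + ν) ^ 2 + (y + ν) * (x + ν) + (x + ν) ^ 2 := by
          have : 0 ≤ ((y : ℝ) + ν) * (x + ν) := by positivity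
          nlinarith [sq_nonneg ((x : ℝ) + ν), mul_nonneg (Nat.cast_nonneg (α := ℝ) y) hν]
        nlinarith [sq_nonneg (y : ℝ)]
      have h7 : (0 : ℝ) < (y : ℝ) ^ 2 := by positivity
      exact (norm_integral_ee_le (h7.trans_le h5) a b).trans (inv_anti₀ h7 h5)
    refine h4.trans ?_
    rw [Finset.sum_const, Finset.card_range, nsmul_eq_mul, ← div_eq_mul_inv,
      div_le_one (by positivity)]
    nlinarith
  have h4 := (Complex.re_le_norm _).trans h3
  rw [h2, intervalIntegral.integral_const, smul_eq_mul]
  simp only [Finset.sum_const, Finset.card_range, nsmul_eq_mul, mul_one] at h4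
  linarith

/-- A pointwise bound for a high power of the cubic exponential sum. -/
lemma exists_norm_cubeSum_rpow_le : ∃ K : ℝ, 1 ≤ K ∧ ∀ (N : ℕ) (ν α : ℝ) (n : ℤ), 0 < N →
    α ∈ Set.Icc (n : ℝ) (n + 1) →
    ‖cubeSum N ν α‖ ^ (21 / 2 : ℝ) ≤ K * ((N : ℝ) ^ (13 / 2 : ℝ) * ‖cubeSum N ν α‖ ^ 2 +
      ∑ q ∈ Finset.Icc (1 : ℕ) (12 * N ^ 2), ∑ a ∈ Finset.Icc (n * (q : ℤ) - 1) (n * q + q + 1),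
        (N : ℝ) ^ (21 / 2 : ℝ) * (q : ℝ) ^ (-(21 / 10) : ℝ) *
          (1 + N ^ 3 * |α - a / q|) ^ (-(21 / 16) : ℝ)) := by
  obtain ⟨K, hK, hW⟩ := exists_weyl_bound
  refine ⟨(2 * K) ^ (21 / 8 : ℝ), Real.one_le_rpow (by linarith) (by norm_num), ?_⟩
  intro N ν α n hN hα
  have hN1 : (1 : ℝ) ≤ N := by exact_mod_cast hN
  obtain ⟨r, hr, hrd⟩ := Real.exists_rat_abs_sub_le_and_den_le α (n := 12 * N ^ 2) (by positivity)
  have hq1 : (1 : ℝ) ≤ r.den := by exact_mod_cast r.pos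
  have hr' : |α - (r.num : ℝ) / r.den| ≤ 1 / (((12 * N ^ 2 : ℕ) + 1) * r.den) := by
    rwa [Rat.cast_def] at hr
  have hr2 : |α - (r.num : ℝ) / r.den| ≤ 1 / (12 * N ^ 2 * r.den) := by
    refine hr'.trans ?_
    push_cast
    gcongr
    linarith
  have hcop : IsCoprime r.num (r.den : ℤ) := by
    rw [Int.isCoprime_iff_gcd_eq_one, Int.gcd_eq_natAbs, Int.natAbs_natCast]; exact r.reduced
  have h1 := hW N α (3 * α * ν) (3 * α * ν ^ 2) (α * ν ^ 3) r.num r.den hN r.pos hrd hcop hr2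
  have h2 : ∑ x ∈ Finset.range N,
      ee (α * x ^ 3 + 3 * α * ν * x ^ 2 + 3 * α * ν ^ 2 * x + α * ν ^ 3) = cubeSum N ν α :=
    Finset.sum_congr rfl fun x _ => by congr 1; ring
  rw [h2] at h1
  set f := ‖cubeSum N ν α‖ with hf
  have hf0 : 0 ≤ f := norm_nonneg _
  set q := r.den
  set a := r.num
  set B := 1 + (N : ℝ) ^ 3 * |α - a / q| with hB
  have hB1 : 1 ≤ B := by rw [hB]; have : 0 ≤ (N : ℝ) ^ 3 * |α - a / q| := by positivity
                         linarith
  have hterm : ∀ (q : ℕ) (a : ℤ), 0 ≤ (N : ℝ) ^ (21 / 2 : ℝ) * (q : ℝ) ^ (-(21 / 10) : ℝ) *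
      (1 + (N : ℝ) ^ 3 * |α - a / q|) ^ (-(21 / 16) : ℝ) := fun q a => by positivity
  have h2K : 1 ≤ 2 * K := by linarith
  rcases le_total ((N : ℝ) ^ (52 / 17 : ℝ)) (N ^ 4 * (q : ℝ) ^ (-(4 / 5) : ℝ) * (√B)⁻¹)
    with hc | hc
  · have h3 : f ^ 4 ≤ (2 * K) * (N ^ 4 * (q : ℝ) ^ (-(4 / 5) : ℝ) * (√B)⁻¹) := by
      have := mul_le_mul_of_nonneg_left hc (zero_le_one.trans hK)
      linarith
    have h4 : f ^ (21 / 2 : ℝ) ≤ ((2 * K) * (N ^ 4 * (q : ℝ) ^ (-(4 / 5) : ℝ) * (√B)⁻¹)) ^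
        (21 / 8 : ℝ) := by
      calc f ^ (21 / 2 : ℝ) = (f ^ 4) ^ (21 / 8 : ℝ) := by
            rw [← Real.rpow_natCast, ← Real.rpow_mul hf0]; norm_num
        _ ≤ _ := by gcongr
    refine h4.trans ?_
    rw [Real.mul_rpow (by positivity) (by positivity)]
    gcongr
    have h5 : (N ^ 4 * (q : ℝ) ^ (-(4 / 5) : ℝ) * (√B)⁻¹) ^ (21 / 8 : ℝ) =
        (N : ℝ) ^ (21 / 2 : ℝ) * (q : ℝ) ^ (-(21 / 10) : ℝ) * B ^ (-(21 / 16) : ℝ) := by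
      rw [Real.mul_rpow (by positivity) (by positivity),
        Real.mul_rpow (by positivity) (by positivity), Real.sqrt_eq_rpow,
        ← Real.rpow_neg (by positivity), ← Real.rpow_mul (by positivity),
        ← Real.rpow_mul (by positivity), ← Real.rpow_natCast, ← Real.rpow_mul (by positivity)]
      norm_num
    rw [h5]
    have h6 : q ∈ Finset.Icc 1 (12 * N ^ 2) := Finset.mem_Icc.mpr ⟨r.pos, hrd⟩
    have h7 : a ∈ Finset.Icc (n * q - 1) (n * q + q + 1) := by
      have hle : |q * α - a| ≤ 1 := by
        have e : (q : ℝ) * α - a = q * (α - a / q) := by field_simp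
        rw [e, abs_mul, Nat.abs_cast]
        calc (q : ℝ) * |α - a / q| ≤ q * (1 / (12 * N ^ 2 * q)) := by gcongr
          _ = 1 / (12 * N ^ 2) := by field_simp
          _ ≤ 1 := by rw [div_le_one (by positivity)]; nlinarith
      rw [abs_le] at hle
      have h8 : (n : ℝ) * q - 1 ≤ a := by nlinarith [hα.1, hα.2]
      have h9 : (a : ℝ) ≤ n * q + q + 1 := by nlinarith [hα.1, hα.2]
      rw [Finset.mem_Icc]
      exact ⟨by exact_mod_cast h8, by exact_mod_cast h9⟩
    have h10 := Finset.single_le_sum (f := fun a : ℤ => (N : ℝ) ^ (21 / 2 : ℝ) *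
      (q : ℝ) ^ (-(21 / 10) : ℝ) * (1 + (N : ℝ) ^ 3 * |α - a / q|) ^ (-(21 / 16) : ℝ))
      (fun i _ => hterm q i) h7
    have h11 := Finset.single_le_sum (f := fun q : ℕ =>
      ∑ a ∈ Finset.Icc (n * (q : ℤ) - 1) (n * q + q + 1), (N : ℝ) ^ (21 / 2 : ℝ) *
      (q : ℝ) ^ (-(21 / 10) : ℝ) * (1 + (N : ℝ) ^ 3 * |α - a / q|) ^ (-(21 / 16) : ℝ))
      (fun i _ => Finset.sum_nonneg fun j _ => hterm i j) h6
    have h12 : 0 ≤ (N : ℝ) ^ (13 / 2 : ℝ) * f ^ 2 := by positivity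
    linarith
  · have h3 : f ^ 4 ≤ (2 * K) * (N : ℝ) ^ (52 / 17 : ℝ) := by
      have := mul_le_mul_of_nonneg_left hc (zero_le_one.trans hK)
      linarith
    have h4 : f ^ (21 / 2 : ℝ) ≤ (2 * K) ^ (21 / 8 : ℝ) * ((N : ℝ) ^ (13 / 2 : ℝ) * f ^ 2) := by
      calc f ^ (21 / 2 : ℝ) = (f ^ 4) ^ (17 / 8 : ℝ) * f ^ 2 := by
            rw [← Real.rpow_natCast, ← Real.rpow_mul hf0, ← Real.rpow_natCast f 2,
              ← Real.rpow_add' hf0 (by norm_num)]; norm_num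
        _ ≤ ((2 * K) * (N : ℝ) ^ (52 / 17 : ℝ)) ^ (17 / 8 : ℝ) * f ^ 2 := by gcongr
        _ = (2 * K) ^ (17 / 8 : ℝ) * ((N : ℝ) ^ (13 / 2 : ℝ) * f ^ 2) := by
            rw [Real.mul_rpow (by positivity) (by positivity), ← Real.rpow_mul (by positivity)]
            norm_num; ring
        _ ≤ _ := by
            gcongr ?_ * _
            exact Real.rpow_le_rpow_of_exponent_le h2K (by norm_num)
    refine h4.trans ?_
    gcongr
    exact le_add_of_nonneg_right (Finset.sum_nonneg fun i _ => Finset.sum_nonneg fun j _ => hterm i j)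

lemma integral_one_add_mul_abs_sub_rpow_neg {c : ℝ} (hc : 0 < c) (y r : ℝ) :
    ∫ x, (1 + c * |x - y|) ^ r = c⁻¹ * ∫ x : ℝ, (1 + |x|) ^ r := by
  rw [integral_sub_right_eq_self (fun x : ℝ => (1 + c * |x|) ^ r)]
  have := Measure.integral_comp_mul_left (fun x : ℝ => (1 + |x|) ^ r) c
  simpa [abs_mul, abs_of_pos hc] using this

lemma integrable_one_add_mul_abs_sub_rpow_neg {c : ℝ} (hc : 0 < c) (y : ℝ) {r : ℝ} (hr : 1 < r) :
    Integrable fun x : ℝ => (1 + c * |x - y|) ^ (-r) := by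
  have h : Integrable fun x : ℝ => (1 + |x|) ^ (-r) := by
    simpa using integrable_one_add_norm (E := ℝ) (μ := volume) (r := r) (by simpa using hr)
  have := (h.comp_mul_left' hc.ne').comp_sub_right y
  simpa [abs_mul, abs_of_pos hc] using this

/-- The moment of order `21 / 2` over a unit interval. -/
lemma exists_integral_norm_cubeSum_rpow_le : ∃ C : ℝ, 1 ≤ C ∧ ∀ (N : ℕ) (ν : ℝ) (n : ℤ), 0 < N →
    0 ≤ ν → ∫ α in (n : ℝ)..(n + 1), ‖cubeSum N ν α‖ ^ (21 / 2 : ℝ) ≤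
      C * (N : ℝ) ^ (15 / 2 : ℝ) := by
  obtain ⟨K, hK, hf⟩ := exists_norm_cubeSum_rpow_le
  set J := ∫ x : ℝ, (1 + |x|) ^ (-(21 / 16) : ℝ) with hJ
  have hJ0 : 0 ≤ J := integral_nonneg fun x => by positivity
  have hsum : Summable fun q : ℕ => (q : ℝ) ^ (-(11 / 10) : ℝ) :=
    Real.summable_nat_rpow.mpr (by norm_num)
  set Z := ∑' q : ℕ, (q : ℝ) ^ (-(11 / 10) : ℝ) with hZ
  have hZ0 : 0 ≤ Z := tsum_nonneg fun q => by positivity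
  refine ⟨K * (3 + 4 * Z * J), ?_, ?_⟩
  · have : 0 ≤ 4 * Z * J := by positivity
    nlinarith
  intro N ν n hN hν
  have hN0 : (0 : ℝ) < N := by exact_mod_cast hN
  set g : ℕ → ℤ → ℝ → ℝ := fun q a α => (N : ℝ) ^ (21 / 2 : ℝ) * (q : ℝ) ^ (-(21 / 10) : ℝ) *
          (1 + N ^ 3 * |α - a / q|) ^ (-(21 / 16) : ℝ) with hg
  have hgi : ∀ q a, Integrable (g q a) := fun q a =>
    (integrable_one_add_mul_abs_sub_rpow_neg (c := (N : ℝ) ^ 3) (by positivity) _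
      (by norm_num)).const_mul _
  have hgI : ∀ q a, ∫ α in (n : ℝ)..(n + 1), g q a α ≤
      (N : ℝ) ^ (15 / 2 : ℝ) * (q : ℝ) ^ (-(21 / 10) : ℝ) * J := by
    intro q a
    rw [intervalIntegral.integral_of_le (by linarith)]
    refine (setIntegral_le_integral (hgi q a) (ae_of_all _ fun α => by
      simp only [Pi.zero_apply, hg]; positivity)).trans ?_
    simp only [hg]
    rw [integral_const_mul, integral_one_add_mul_abs_sub_rpow_neg (by positivity), ← hJ]
    apply le_of_eq
    have : (N : ℝ) ^ (21 / 2 : ℝ) = (N : ℝ) ^ (15 / 2 : ℝ) * N ^ 3 := by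
      rw [← Real.rpow_add_natCast hN0.ne']; norm_num
    rw [this]; field_simp
  have hfc : Continuous fun α => ‖cubeSum N ν α‖ := (continuous_cubeSum N ν).norm
  have hi1 : IntervalIntegrable (fun α => (N : ℝ) ^ (13 / 2 : ℝ) * ‖cubeSum N ν α‖ ^ 2) volume
      n (n + 1) := (continuous_const.mul (hfc.pow 2)).intervalIntegrable _ _
  have hi2 : ∀ q : ℕ, IntervalIntegrable (fun α =>
      ∑ a ∈ Finset.Icc (n * (q : ℤ) - 1) (n * q + q + 1), g q a α) volume n (n + 1) := fun q =>
    (integrable_finsetSum _ fun a _ => hgi q a).intervalIntegrable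
  have hi3 : IntervalIntegrable (fun α => ∑ q ∈ Finset.Icc (1 : ℕ) (12 * N ^ 2),
      ∑ a ∈ Finset.Icc (n * (q : ℤ) - 1) (n * q + q + 1), g q a α) volume n (n + 1) :=
    (integrable_finsetSum _ fun q _ => integrable_finsetSum _ fun a _ =>
      hgi q a).intervalIntegrable
  calc ∫ α in (n : ℝ)..(n + 1), ‖cubeSum N ν α‖ ^ (21 / 2 : ℝ)
      ≤ ∫ α in (n : ℝ)..(n + 1), K * ((N : ℝ) ^ (13 / 2 : ℝ) * ‖cubeSum N ν α‖ ^ 2 +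
        ∑ q ∈ Finset.Icc (1 : ℕ) (12 * N ^ 2),
          ∑ a ∈ Finset.Icc (n * (q : ℤ) - 1) (n * q + q + 1), g q a α) := by
        refine intervalIntegral.integral_mono_on (by linarith)
          ((hfc.rpow_const fun _ => Or.inr (by norm_num)).intervalIntegrable _ _)
          ((hi1.add hi3).const_mul _) fun α hα => hf N ν α n hN hα
    _ = K * ((N : ℝ) ^ (13 / 2 : ℝ) * (∫ α in (n : ℝ)..(n + 1), ‖cubeSum N ν α‖ ^ 2) +
        ∑ q ∈ Finset.Icc (1 : ℕ) (12 * N ^ 2),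
          ∑ a ∈ Finset.Icc (n * (q : ℤ) - 1) (n * q + q + 1),
            ∫ α in (n : ℝ)..(n + 1), g q a α) := by
        rw [intervalIntegral.integral_const_mul, intervalIntegral.integral_add hi1 hi3,
          intervalIntegral.integral_const_mul,
          intervalIntegral.integral_finsetSum fun q _ => hi2 q]
        congr 2
        exact Finset.sum_congr rfl fun q _ =>
          intervalIntegral.integral_finsetSum fun a _ => (hgi q a).intervalIntegrable
    _ ≤ K * ((N : ℝ) ^ (13 / 2 : ℝ) * (3 * N) +
        ∑ q ∈ Finset.Icc (1 : ℕ) (12 * N ^ 2),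
          4 * (N : ℝ) ^ (15 / 2 : ℝ) * J * (q : ℝ) ^ (-(11 / 10) : ℝ)) := by
        gcongr with q hq
        · refine (integral_norm_cubeSum_sq_le N hν _ _).trans ?_
          gcongr; linarith
        · have hq1 : 1 ≤ q := (Finset.mem_Icc.mp hq).1
          have hq1' : (1 : ℝ) ≤ q := by exact_mod_cast hq1
          have hq2 : (q : ℝ) ^ (-(11 / 10) : ℝ) = (q : ℝ) ^ (-(21 / 10) : ℝ) * q := by
            rw [← Real.rpow_add_one (by positivity)]; norm_num
          calc ∑ a ∈ Finset.Icc (n * (q : ℤ) - 1) (n * q + q + 1),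
                ∫ α in (n : ℝ)..(n + 1), g q a α
              ≤ ∑ a ∈ Finset.Icc (n * (q : ℤ) - 1) (n * q + q + 1),
                (N : ℝ) ^ (15 / 2 : ℝ) * (q : ℝ) ^ (-(21 / 10) : ℝ) * J :=
                Finset.sum_le_sum fun a _ => hgI q a
            _ = (q + 3) * ((N : ℝ) ^ (15 / 2 : ℝ) * (q : ℝ) ^ (-(21 / 10) : ℝ) * J) := by
                rw [Finset.sum_const, Int.card_Icc, nsmul_eq_mul]
                congr 1
                have : (n * (q : ℤ) + q + 1 + 1 - (n * q - 1)).toNat = q + 3 := by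
                  rw [show n * (q : ℤ) + q + 1 + 1 - (n * q - 1) = ((q + 3 : ℕ) : ℤ) by
                    push_cast; ring, Int.toNat_natCast]
                rw [this]; push_cast; ring
            _ ≤ (4 * q) * ((N : ℝ) ^ (15 / 2 : ℝ) * (q : ℝ) ^ (-(21 / 10) : ℝ) * J) := by
                gcongr; linarith
            _ = _ := by rw [hq2]; ring
    _ ≤ K * ((N : ℝ) ^ (13 / 2 : ℝ) * (3 * N) + 4 * (N : ℝ) ^ (15 / 2 : ℝ) * J * Z) := by
        rw [← Finset.mul_sum]
        gcongr
        exact hsum.sum_le_tsum _ fun q _ => by positivity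
    _ = _ := by
        have : (N : ℝ) ^ (15 / 2 : ℝ) = (N : ℝ) ^ (13 / 2 : ℝ) * N := by
          rw [← Real.rpow_add_one (by positivity)]; norm_num
        rw [this]; ring

/-- The weight used to make integrals over the real line converge. -/
noncomputable def wt (α : ℝ) : ℝ := (1 + α ^ 2)⁻¹

lemma wt_pos (α : ℝ) : 0 < wt α := by unfold wt; positivity

lemma continuous_wt : Continuous wt := by
  unfold wt; exact Continuous.inv₀ (by fun_prop) fun x => by positivity

lemma wt_le {α : ℝ} {n : ℤ} (hα : α ∈ Set.Ioc (n : ℝ) (n + 1)) : wt α ≤ 3 * wt n := by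
  unfold wt
  rw [← div_eq_mul_inv, le_div_iff₀ (by positivity), inv_mul_le_iff₀ (by positivity)]
  obtain ⟨h1, h2⟩ := hα
  nlinarith [sq_nonneg ((n : ℝ) + 2 * (α - n)), sq_nonneg (α - n)]

lemma summable_wt_intCast : Summable fun n : ℤ => wt n := by
  have h : Summable fun n : ℤ => |(n : ℝ)| ^ (-2 : ℝ) := Real.summable_abs_int_rpow (by norm_num)
  refine Summable.of_norm_bounded_eventually h ?_
  rw [Filter.eventually_cofinite]
  refine (Set.finite_singleton (0 : ℤ)).subset fun n hn => ?_
  by_contra h0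
  have h0' : (n : ℝ) ≠ 0 := by exact_mod_cast h0
  refine hn ?_
  rw [Real.norm_of_nonneg (wt_pos _).le, Real.rpow_neg (abs_nonneg _), wt,
    show |(n : ℝ)| ^ (2 : ℝ) = (n : ℝ) ^ 2 by rw [Real.rpow_two, sq_abs]]
  have : 0 < (n : ℝ) ^ 2 := by positivity
  gcongr
  linarith

lemma exists_lintegral_wt_mul_cubeSum_rpow_le : ∃ C : ℝ, 1 ≤ C ∧ ∀ (N : ℕ) (ν : ℝ), 0 < N →
    0 ≤ ν → ∫⁻ α, ENNReal.ofReal (wt α * ‖cubeSum N ν α‖ ^ (21 / 2 : ℝ)) ≤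
      ENNReal.ofReal (C * (N : ℝ) ^ (15 / 2 : ℝ)) := by
  obtain ⟨C, hC, hI⟩ := exists_integral_norm_cubeSum_rpow_le
  set W := ∑' n : ℤ, wt n with hW
  have hW1 : 1 ≤ W := by
    have := summable_wt_intCast.le_tsum 0 fun j _ => (wt_pos _).le
    rw [← hW] at this
    simpa [wt] using this
  refine ⟨3 * W * C, by nlinarith, fun N ν hN hν => ?_⟩
  have hcont : Continuous fun α => ‖cubeSum N ν α‖ ^ (21 / 2 : ℝ) :=
    (continuous_cubeSum N ν).norm.rpow_const fun _ => Or.inr (by norm_num)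
  have hn : ∀ n : ℤ, ∫⁻ α in Set.Ioc (n : ℝ) (n + 1),
      ENNReal.ofReal (wt α * ‖cubeSum N ν α‖ ^ (21 / 2 : ℝ)) ≤
      ENNReal.ofReal (wt n * (3 * (C * (N : ℝ) ^ (15 / 2 : ℝ)))) := by
    intro n
    calc ∫⁻ α in Set.Ioc (n : ℝ) (n + 1),
          ENNReal.ofReal (wt α * ‖cubeSum N ν α‖ ^ (21 / 2 : ℝ))
        ≤ ∫⁻ α in Set.Ioc (n : ℝ) (n + 1),
          ENNReal.ofReal (3 * wt n * ‖cubeSum N ν α‖ ^ (21 / 2 : ℝ)) := by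
          refine setLIntegral_mono (continuous_const.mul hcont).measurable.ennreal_ofReal fun α hα => ?_
          gcongr
          exact wt_le hα
      _ = ENNReal.ofReal (∫ α in Set.Ioc (n : ℝ) (n + 1),
          3 * wt n * ‖cubeSum N ν α‖ ^ (21 / 2 : ℝ)) := by
          rw [ofReal_integral_eq_lintegral_ofReal]
          · exact ((continuous_const.mul hcont).integrableOn_Icc).mono_set Set.Ioc_subset_Icc_self
          · exact ae_of_all _ fun α => by
              have := (wt_pos n).le
              simp only [Pi.zero_apply]
              positivity
      _ ≤ _ := by
          rw [integral_const_mul, ← intervalIntegral.integral_of_le (by linarith)]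
          have := (wt_pos n).le
          have h2 := hI N ν n hN hν
          apply ENNReal.ofReal_le_ofReal
          calc _ ≤ 3 * wt n * (C * (N : ℝ) ^ (15 / 2 : ℝ)) := by gcongr
            _ = _ := by ring
  rw [← setLIntegral_univ, ← iUnion_Ioc_intCast ℝ,
    lintegral_iUnion (fun _ => measurableSet_Ioc) (Set.pairwise_disjoint_Ioc_intCast ℝ)]
  refine (ENNReal.tsum_le_tsum hn).trans (le_of_eq ?_)
  rw [← ENNReal.ofReal_tsum_of_nonneg _ (summable_wt_intCast.mul_right _), tsum_mul_right]
  · congr 1; ring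
  · intro n
    have := (wt_pos n).le
    positivity

lemma exists_setLIntegral_wt_mul_prod_le {s : ℕ} (hs : 11 ≤ s) (i₀ : Fin s) : ∃ C : ℝ, 1 ≤ C ∧
    ∀ (N : ℕ) (ν : Fin s → ℝ) (ε : ℝ) (S : Set ℝ), 0 < N → (∀ i, 0 ≤ ν i) → 0 ≤ ε →
      MeasurableSet S → (∀ α ∈ S, ‖cubeSum N (ν i₀) α‖ ≤ ε * N) →
      ∫⁻ α in S, ENNReal.ofReal (wt α * ∏ i, ‖cubeSum N (ν i) α‖) ≤
        ENNReal.ofReal (C * ε ^ (((s : ℝ) - 21 / 2) / s) * (N : ℝ) ^ (s - 3)) := by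
  obtain ⟨C, hC, hI⟩ := exists_lintegral_wt_mul_cubeSum_rpow_le
  refine ⟨C, hC, fun N ν ε S hN hν hε hS hS0 => ?_⟩
  have hN0 : (0 : ℝ) < N := by exact_mod_cast hN
  have hs' : (11 : ℝ) ≤ s := by exact_mod_cast hs
  have hs0 : (s : ℝ) ≠ 0 := by positivity
  have hsum : ∑ i : Fin s, (1 / (s : ℝ)) = 1 := by simp [hs0]
  have hcont : ∀ i, Continuous fun α => wt α * ‖cubeSum N (ν i) α‖ ^ s := fun i =>
    continuous_wt.mul ((continuous_cubeSum N _).norm.pow s)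
  set B : ℝ := C * (N : ℝ) ^ (s - 3) with hB
  have hB0 : 0 ≤ B := by positivity
  set e : ℝ := ε ^ ((s : ℝ) - 21 / 2) with he
  have he0 : 0 ≤ e := by positivity
  have hpow : ∀ i (t : ℝ), 0 ≤ t → (∀ α ∈ S, ‖cubeSum N (ν i) α‖ ≤ t * N) →
      ∫⁻ α in S, ENNReal.ofReal (wt α * ‖cubeSum N (ν i) α‖ ^ s) ≤
        ENNReal.ofReal B * ENNReal.ofReal (t ^ ((s : ℝ) - 21 / 2)) := by
    intro i t ht hi
    calc ∫⁻ α in S, ENNReal.ofReal (wt α * ‖cubeSum N (ν i) α‖ ^ s)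
        ≤ ∫⁻ α in S, ENNReal.ofReal ((t * N) ^ ((s : ℝ) - 21 / 2)) *
            ENNReal.ofReal (wt α * ‖cubeSum N (ν i) α‖ ^ (21 / 2 : ℝ)) := by
          refine setLIntegral_mono' hS fun α hα => ?_
          rw [← ENNReal.ofReal_mul (by positivity)]
          apply ENNReal.ofReal_le_ofReal
          have h1 : ‖cubeSum N (ν i) α‖ ^ s = ‖cubeSum N (ν i) α‖ ^ ((s : ℝ) - 21 / 2) *
              ‖cubeSum N (ν i) α‖ ^ (21 / 2 : ℝ) := by
            rw [← Real.rpow_add' (norm_nonneg _) (by simpa using hs0), ← Real.rpow_natCast]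
            congr 1; ring
          have h2 : ‖cubeSum N (ν i) α‖ ^ ((s : ℝ) - 21 / 2) ≤ (t * N) ^ ((s : ℝ) - 21 / 2) :=
            Real.rpow_le_rpow (norm_nonneg _) (hi α hα) (by linarith)
          have := (wt_pos α).le
          calc _ ≤ wt α * ((t * N) ^ ((s : ℝ) - 21 / 2) *
                ‖cubeSum N (ν i) α‖ ^ (21 / 2 : ℝ)) := by rw [h1]; gcongr
            _ = _ := by ring
      _ ≤ ENNReal.ofReal ((t * N) ^ ((s : ℝ) - 21 / 2)) *
            ENNReal.ofReal (C * (N : ℝ) ^ (15 / 2 : ℝ)) := by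
          rw [lintegral_const_mul' _ _ ENNReal.ofReal_ne_top]
          gcongr
          exact (setLIntegral_le_lintegral _ _).trans (hI N (ν i) hN (hν i))
      _ = _ := by
          rw [← ENNReal.ofReal_mul (by positivity), ← ENNReal.ofReal_mul (by positivity),
            Real.mul_rpow ht hN0.le, hB]
          congr 1
          have : (N : ℝ) ^ ((s : ℝ) - 21 / 2) * (N : ℝ) ^ (15 / 2 : ℝ) = (N : ℝ) ^ (s - 3) := by
            rw [← Real.rpow_add hN0, ← Real.rpow_natCast, Nat.cast_sub (by omega)]
            congr 1; push_cast; ring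
          rw [← this]; ring
  have hi : ∀ i, ∫⁻ α in S, ENNReal.ofReal (wt α * ‖cubeSum N (ν i) α‖ ^ s) ≤
      ENNReal.ofReal B * (if i = i₀ then ENNReal.ofReal e else 1) := by
    intro i
    split_ifs with h
    · subst h; exact hpow i ε hε hS0
    · simpa using hpow i 1 zero_le_one fun α _ => by simpa using norm_cubeSum_le N (ν i) α
  calc ∫⁻ α in S, ENNReal.ofReal (wt α * ∏ i, ‖cubeSum N (ν i) α‖)
      = ∫⁻ α in S, ∏ i, ENNReal.ofReal (wt α * ‖cubeSum N (ν i) α‖ ^ s) ^ (1 / (s : ℝ)) := by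
        refine lintegral_congr fun α => ?_
        have hw := (wt_pos α).le
        have h1 : ∀ i, ENNReal.ofReal (wt α * ‖cubeSum N (ν i) α‖ ^ s) ^ (1 / (s : ℝ)) =
            ENNReal.ofReal ((wt α) ^ (1 / (s : ℝ)) * ‖cubeSum N (ν i) α‖) := by
          intro i
          rw [ENNReal.ofReal_rpow_of_nonneg (by positivity) (by positivity),
            Real.mul_rpow hw (by positivity), one_div,
            Real.pow_rpow_inv_natCast (norm_nonneg _) (by omega)]
        simp_rw [h1]
        rw [← ENNReal.ofReal_prod_of_nonneg fun i _ => by positivity, Finset.prod_mul_distrib,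
          Finset.prod_const, Finset.card_univ, Fintype.card_fin, one_div,
          Real.rpow_inv_natCast_pow hw (by omega)]
    _ ≤ ∏ i, (∫⁻ α in S, ENNReal.ofReal (wt α * ‖cubeSum N (ν i) α‖ ^ s)) ^ (1 / (s : ℝ)) :=
        ENNReal.lintegral_prod_norm_pow_le _
          (fun i _ => (hcont i).measurable.ennreal_ofReal.aemeasurable) hsum
          fun i _ => by positivity
    _ ≤ ∏ i, (ENNReal.ofReal B * (if i = i₀ then ENNReal.ofReal e else 1)) ^ (1 / (s : ℝ)) := by
        refine Finset.prod_le_prod' fun i _ => ?_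
        gcongr
        exact hi i
    _ = (ENNReal.ofReal B ^ s * ENNReal.ofReal e) ^ (1 / (s : ℝ)) := by
        rw [ENNReal.prod_rpow_of_nonneg (by positivity), Finset.prod_mul_distrib]
        simp
    _ = _ := by
        rw [← ENNReal.ofReal_pow hB0, ← ENNReal.ofReal_mul (by positivity),
          ENNReal.ofReal_rpow_of_nonneg (by positivity) (by positivity),
          Real.mul_rpow (by positivity) he0, one_div, Real.pow_rpow_inv_natCast hB0 (by omega), he,
          ← Real.rpow_mul hε, hB]
        congr 1
        rw [div_eq_mul_inv ((s : ℝ) - 21 / 2)]; ac_rfl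

lemma nn_pos_of_irrational {x : ℝ} (hx : Irrational x) : 0 < nn x := by
  rw [nn, abs_pos, sub_ne_zero]
  exact fun h => hx ⟨(round x : ℤ), by rw [Rat.cast_intCast]; exact h.symm⟩

lemma nn_sub_le (x y : ℝ) : nn (x - y) ≤ nn x + nn y := by
  calc nn (x - y) ≤ |x - y - ((round x - round y : ℤ) : ℝ)| := nn_le _ _
    _ = |(x - round x) - (y - round y)| := by congr 1; push_cast; ring
    _ ≤ nn x + nn y := abs_sub _ _

lemma exists_card_nn_lt_le {θ : ℝ} (hθ : Irrational θ) {M : ℕ} (hM : 0 < M) : ∃ δ > 0, ∀ Y : ℕ,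
    ({h ∈ Finset.Ico 1 Y | nn (h * θ) < δ} : Finset ℕ).card ≤ Y / M + 1 := by
  obtain ⟨δ, hδ, hδM⟩ : ∃ δ > 0, ∀ j ∈ Finset.Ico 1 M, 2 * δ ≤ nn (j * θ) := by
    have hpos : ∀ j ∈ Finset.Ico 1 M, 0 < nn (j * θ) := fun j hj =>
      nn_pos_of_irrational (hθ.natCast_mul (by have := (Finset.mem_Ico.mp hj).1; omega))
    rcases (Finset.Ico 1 M).eq_empty_or_nonempty with h | h
    · exact ⟨1, one_pos, by simp [h]⟩
    · obtain ⟨j, hj, hmin⟩ := Finset.exists_min_image _ (fun j : ℕ => nn (j * θ)) h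
      exact ⟨nn (j * θ) / 2, by have := hpos j hj; positivity, fun i hi => by
        have := hmin i hi; linarith⟩
  refine ⟨δ, hδ, fun Y => ?_⟩
  have key : ∀ h k : ℕ, h < k → nn (h * θ) < δ → nn (k * θ) < δ → h / M ≠ k / M := by
    intro h k hhk hh hk heq
    have h1 : k - h < M := by
      have e1 := Nat.div_add_mod h M
      have e2 := Nat.div_add_mod k M
      have := Nat.mod_lt k hM
      rw [heq] at e1
      omega
    have h2 := hδM (k - h) (Finset.mem_Ico.mpr ⟨by omega, h1⟩)
    have h3 := nn_sub_le (k * θ) (h * θ)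
    rw [← sub_mul, ← Nat.cast_sub hhk.le] at h3
    linarith
  rw [← Finset.card_range (Y / M + 1)]
  refine Finset.card_le_card_of_injOn (fun h => h / M) ?_ ?_
  · intro h hh
    simp only [Finset.coe_filter, Finset.mem_Ico, Set.mem_ofPred_eq, Finset.coe_range,
      Set.mem_Iio] at hh ⊢
    exact Nat.lt_succ_of_le (Nat.div_le_div_right hh.1.2.le)
  · intro h hh k hk heq
    simp only [Finset.coe_filter, Finset.mem_Ico, Set.mem_ofPred_eq] at hh hk
    by_contra hne
    rcases Nat.lt_or_gt_of_ne hne with hlt | hlt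
    · exact key h k hlt hh.2 hk.2 heq
    · exact key k h hlt hk.2 hh.2 heq.symm

lemma eventually_sum_le {θ : ℝ} (hθ : Irrational θ) {ε : ℝ} (hε : 0 < ε) :
    ∀ᶠ Y : ℕ in atTop, ∀ U : ℕ → ℝ, (∀ h, U h ≤ Y) → (∀ h, U h * nn (h * θ) ≤ 1) →
      ∑ h ∈ Finset.Ico 1 Y, U h ≤ ε * Y ^ 2 := by
  obtain ⟨M, hM⟩ := exists_nat_gt (2 / ε)
  have hM0 : 0 < M := by
    have : (0 : ℝ) < M := lt_trans (by positivity) hM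
    exact_mod_cast this
  obtain ⟨δ, hδ, hcard⟩ := exists_card_nn_lt_le hθ hM0
  filter_upwards [eventually_ge_atTop 1,
    tendsto_natCast_atTop_atTop.eventually_ge_atTop ((1 + δ⁻¹) * (2 / ε))] with Y hY1 hY U hU1 hU2
  have hMr : (0 : ℝ) < M := by exact_mod_cast hM0
  have hYr : (0 : ℝ) < Y := by exact_mod_cast hY1
  rw [← Finset.sum_filter_add_sum_filter_not _ (fun h : ℕ => nn (h * θ) < δ)]
  have h1 : ∑ h ∈ Finset.Ico 1 Y with nn ((h : ℕ) * θ) < δ, U h ≤ (Y / M + 1) * Y := by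
    refine (Finset.sum_le_card_nsmul _ _ (Y : ℝ) fun h _ => hU1 h).trans ?_
    rw [nsmul_eq_mul]
    gcongr
    calc _ ≤ ((Y / M + 1 : ℕ) : ℝ) := by exact_mod_cast hcard Y
      _ ≤ (Y : ℝ) / M + 1 := by push_cast; gcongr; exact Nat.cast_div_le
  have h2 : ∑ h ∈ Finset.Ico 1 Y with ¬ nn ((h : ℕ) * θ) < δ, U h ≤ Y * δ⁻¹ := by
    refine (Finset.sum_le_card_nsmul _ _ δ⁻¹ fun h hh => ?_).trans ?_
    · rw [Finset.mem_filter, not_lt] at hh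
      have h3 := hU2 h
      rw [inv_eq_one_div, le_div_iff₀ hδ]
      by_cases h4 : 0 ≤ U h
      · nlinarith [hh.2]
      · nlinarith
    · rw [nsmul_eq_mul]
      gcongr
      refine (Finset.card_filter_le _ _).trans ?_
      simp
  have h5 : (Y : ℝ) / M ≤ ε / 2 * Y := by
    rw [div_le_iff₀ hMr]
    rw [div_lt_iff₀ hε] at hM
    nlinarith
  have h6 : 1 + δ⁻¹ ≤ ε / 2 * Y := by
    have : (1 + δ⁻¹) = ε / 2 * ((1 + δ⁻¹) * (2 / ε)) := by field_simp
    rw [this]; gcongr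
  nlinarith

lemma eventually_norm_quadratic_sum_le {θ : ℝ} (hθ : Irrational θ) {ε : ℝ} (hε : 0 < ε) :
    ∀ᶠ Y : ℕ in atTop, ∀ b c : ℝ,
      ‖∑ y ∈ Finset.range Y, ee (θ * y ^ 2 + b * y + c)‖ ≤ ε * Y := by
  have h2θ : Irrational (2 * θ) := by exact_mod_cast hθ.natCast_mul (m := 2) (by norm_num)
  filter_upwards [eventually_sum_le h2θ (ε := ε ^ 2 / 4) (by positivity),
    eventually_ge_atTop 1,
    tendsto_natCast_atTop_atTop.eventually_ge_atTop (2 / ε ^ 2)] with Y hY hY1 hY2 b c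
  refine le_of_sq_le_sq ?_ (by positivity)
  refine (norm_sum_sq_le Y (fun y => ee (θ * y ^ 2 + b * y + c)) fun x => norm_ee _).trans ?_
  have h1 := hY (fun h => ‖∑ x ∈ Finset.range (Y - h), ee (θ * ((x + h : ℕ) : ℝ) ^ 2 +
      b * ((x + h : ℕ) : ℝ) + c) * (starRingEnd ℂ) (ee (θ * x ^ 2 + b * x + c))‖) ?_ ?_
  · have h2 : (Y : ℝ) ≤ ε ^ 2 / 2 * Y ^ 2 := by
      rw [div_le_iff₀ (by positivity)] at hY2
      have : (0 : ℝ) ≤ Y := Nat.cast_nonneg Y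
      nlinarith
    nlinarith
  · intro h
    simp only [conj_ee, ← ee_add]
    refine (norm_sum_ee_le _ _).trans ?_
    exact_mod_cast Nat.sub_le Y h
  · intro h
    simp only [conj_ee, ← ee_add]
    have := norm_geom_sum_mul_nn_le (Y - h) (h * (2 * θ)) (θ * h ^ 2 + b * h)
    convert this using 3
    refine Finset.sum_congr rfl fun x _ => ?_
    congr 1; push_cast; ring

lemma sum_range_mul_eq {M : Type*} [AddCommMonoid M] (q Y : ℕ) (f : ℕ → M) :
    ∑ x ∈ Finset.range (q * Y), f x =
      ∑ r ∈ Finset.range q, ∑ y ∈ Finset.range Y, f (q * y + r) := by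
  induction Y with
  | zero => simp
  | succ Y ih =>
    rw [Nat.mul_succ, Finset.sum_range_add, ih, ← Finset.sum_add_distrib]
    simp_rw [Finset.sum_range_succ]

lemma eventually_norm_cubeSum_div_le {ν : ℝ} (hν : Irrational ν) {a : ℤ} (ha : a ≠ 0) {q : ℕ}
    (hq : 0 < q) {ε : ℝ} (hε : 0 < ε) :
    ∀ᶠ X : ℕ in atTop, ‖cubeSum X ν (a / q)‖ ≤ ε * X := by
  have hq0 : (q : ℝ) ≠ 0 := by positivity
  have hirr : ∀ r : ℕ, Irrational (3 * a * q * (r + ν)) := by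
    intro r
    have := (hν.natCast_add r).intCast_mul (m := 3 * a * q) (by positivity)
    exact_mod_cast this
  have h1 : ∀ᶠ Y : ℕ in atTop, ∀ r ∈ Finset.range q, ∀ b c : ℝ,
      ‖∑ y ∈ Finset.range Y, ee ((3 * a * q * (r + ν)) * y ^ 2 + b * y + c)‖ ≤ ε / 2 * Y := by
    rw [Filter.eventually_all_finset]
    exact fun r _ => eventually_norm_quadratic_sum_le (hirr r) (by positivity)
  have h2 : Tendsto (fun X : ℕ => X / q) atTop atTop := Nat.tendsto_div_const_atTop hq.ne'
  filter_upwards [h2.eventually h1,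
    tendsto_natCast_atTop_atTop.eventually_ge_atTop (q / (ε / 2))] with X hX hX2
  set Y := X / q with hY
  have hXY : X = q * Y + X % q := (Nat.div_add_mod X q).symm
  have h3 : ‖∑ x ∈ Finset.range (q * Y), ee ((a / q : ℝ) * (x + ν) ^ 3)‖ ≤ ε / 2 * X := by
    rw [sum_range_mul_eq]
    calc _ ≤ ∑ r ∈ Finset.range q, ε / 2 * Y := by
          refine norm_sum_le_of_le _ fun r hr => ?_
          refine le_trans (le_of_eq ?_) (hX r hr (3 * a * (r + ν) ^ 2) (a / q * (r + ν) ^ 3))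
          congr 1
          refine Finset.sum_congr rfl fun y _ => ?_
          have e : (a / q : ℝ) * (((q * y + r : ℕ) : ℝ) + ν) ^ 3 =
              (3 * a * q * (r + ν) * y ^ 2 + 3 * a * (r + ν) ^ 2 * y + a / q * (r + ν) ^ 3) +
                ((a * q ^ 2 * y ^ 3 : ℤ) : ℝ) := by
            push_cast; field_simp; ring
          rw [e, ee_add, ee_int, mul_one]
      _ = ε / 2 * ((q * Y : ℕ) : ℝ) := by
          rw [Finset.sum_const, Finset.card_range, nsmul_eq_mul]; push_cast; ring
      _ ≤ ε / 2 * X := by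
          gcongr
          omega
  have h4 : ‖∑ x ∈ Finset.range (X % q), ee ((a / q : ℝ) * (((q * Y + x : ℕ) : ℝ) + ν) ^ 3)‖ ≤
      ε / 2 * X := by
    refine (norm_sum_ee_le _ _).trans ?_
    have : (X % q : ℕ) ≤ q := (Nat.mod_lt X hq).le
    rw [div_le_iff₀ (by positivity)] at hX2
    calc ((X % q : ℕ) : ℝ) ≤ q := by exact_mod_cast this
      _ ≤ ε / 2 * X := by linarith
  have h5 : cubeSum X ν (a / q) = ∑ x ∈ Finset.range (q * Y), ee ((a / q : ℝ) * (x + ν) ^ 3) +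
      ∑ x ∈ Finset.range (X % q), ee ((a / q : ℝ) * (((q * Y + x : ℕ) : ℝ) + ν) ^ 3) := by
    rw [cubeSum]
    conv_lhs => rw [hXY]
    rw [Finset.sum_range_add]
  rw [h5]
  refine (norm_add_le _ _).trans ?_
  linarith

lemma norm_ee_sub_ee_le (x y : ℝ) : ‖ee x - ee y‖ ≤ 2 * Real.pi * |x - y| := by
  have h1 : ee x - ee y = ee y * (ee (x - y) - 1) := by
    rw [mul_sub, ← ee_add, mul_one]; congr 2; ring
  rw [h1, norm_mul, norm_ee, one_mul, ee, mul_comm]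
  refine (Real.norm_exp_I_mul_ofReal_sub_one_le (x := 2 * Real.pi * (x - y))).trans (le_of_eq ?_)
  rw [Real.norm_eq_abs, abs_mul, abs_of_pos (by positivity)]

lemma norm_cubeSum_add_le {N : ℕ} {ν γ β E : ℝ} (hν : 0 ≤ ν)
    (h : ∀ X ≤ N, ‖cubeSum X ν γ‖ ≤ E) :
    ‖cubeSum N ν (γ + β)‖ ≤ E * (1 + 2 * Real.pi * |β| * (N + ν) ^ 3) := by
  have hE : 0 ≤ E := (norm_nonneg _).trans (h 0 (Nat.zero_le _))
  have h1 : cubeSum N ν (γ + β) =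
      ∑ x ∈ Finset.range N, ee (β * (x + ν) ^ 3) • ee (γ * (x + ν) ^ 3) := by
    rw [cubeSum]
    refine Finset.sum_congr rfl fun x _ => ?_
    rw [smul_eq_mul, ← ee_add]; congr 1; ring
  have hS : ∀ X, ∑ x ∈ Finset.range X, ee (γ * (x + ν) ^ 3) = cubeSum X ν γ := fun X => rfl
  rw [h1, Finset.sum_range_by_parts (fun x : ℕ => ee (β * (x + ν) ^ 3))]
  simp_rw [hS]
  refine (norm_sub_le _ _).trans ?_
  rw [norm_smul, norm_ee, one_mul]
  have h2 : ‖∑ i ∈ Finset.range (N - 1), (ee (β * (((i + 1 : ℕ) : ℝ) + ν) ^ 3) -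
      ee (β * (i + ν) ^ 3)) • cubeSum (i + 1) ν γ‖ ≤
      ∑ i ∈ Finset.range (N - 1), 2 * Real.pi * |β| * E *
        ((((i + 1 : ℕ) : ℝ) + ν) ^ 3 - (i + ν) ^ 3) := by
    refine norm_sum_le_of_le _ fun i hi => ?_
    rw [norm_smul]
    have h3 := norm_ee_sub_ee_le (β * (((i + 1 : ℕ) : ℝ) + ν) ^ 3) (β * (i + ν) ^ 3)
    have h4 : (0 : ℝ) ≤ (((i + 1 : ℕ) : ℝ) + ν) ^ 3 - (i + ν) ^ 3 := by
      rw [sub_nonneg]; gcongr; simp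
    rw [← mul_sub, abs_mul, abs_of_nonneg h4] at h3
    have h5 := h (i + 1) (by have := Finset.mem_range.mp hi; omega)
    calc _ ≤ (2 * Real.pi * (|β| * ((((i + 1 : ℕ) : ℝ) + ν) ^ 3 - (i + ν) ^ 3))) * E := by
          gcongr
      _ = _ := by ring
  rw [← Finset.mul_sum, Finset.sum_range_sub (fun i : ℕ => ((i : ℝ) + ν) ^ 3)] at h2
  have h6 : (((N - 1 : ℕ) : ℝ) + ν) ^ 3 - (((0 : ℕ) : ℝ) + ν) ^ 3 ≤ (N + ν) ^ 3 := by
    have : (((N - 1 : ℕ) : ℝ) + ν) ^ 3 ≤ (N + ν) ^ 3 := by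
      gcongr; exact Nat.sub_le N 1
    have h0 : (0 : ℝ) ≤ (((0 : ℕ) : ℝ) + ν) ^ 3 := by positivity
    linarith
  have h7 : 2 * Real.pi * |β| * E * ((((N - 1 : ℕ) : ℝ) + ν) ^ 3 - (((0 : ℕ) : ℝ) + ν) ^ 3) ≤
      2 * Real.pi * |β| * E * (N + ν) ^ 3 := by gcongr
  have h8 := h N le_rfl
  linarith

lemma eventually_norm_cubeSum_near_le {ν : ℝ} (hν : Irrational ν) (hν0 : 0 ≤ ν) {a : ℤ}
    (ha : a ≠ 0) {q : ℕ} (hq : 0 < q) {ε : ℝ} (hε : 0 < ε) {B : ℝ} (hB : 0 ≤ B) :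
    ∀ᶠ N : ℕ in atTop, ∀ α : ℝ, N ^ 3 * |α - a / q| ≤ B → ‖cubeSum N ν α‖ ≤ ε * N := by
  set ε' := ε / (1 + 2 * Real.pi * (B * 8)) with hε'
  have hε'0 : 0 < ε' := by positivity
  obtain ⟨X₀, hX₀⟩ := eventually_atTop.mp (eventually_norm_cubeSum_div_le hν ha hq hε'0)
  filter_upwards [tendsto_natCast_atTop_atTop.eventually_ge_atTop (X₀ / ε'),
    tendsto_natCast_atTop_atTop.eventually_ge_atTop ν] with N hN hNν α hα
  have h1 : ∀ X ≤ N, ‖cubeSum X ν (a / q)‖ ≤ ε' * N := by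
    intro X hX
    rcases le_total X₀ X with h | h
    · exact (hX₀ X h).trans (by gcongr)
    · rw [div_le_iff₀ hε'0] at hN
      refine (norm_cubeSum_le _ _ _).trans ?_
      have : (X : ℝ) ≤ X₀ := by exact_mod_cast h
      linarith
  have h2 := norm_cubeSum_add_le (β := α - a / q) hν0 h1
  rw [add_sub_cancel] at h2
  refine h2.trans ?_
  have h3 : |α - a / q| * (N + ν) ^ 3 ≤ B * 8 := by
    calc |α - a / q| * (N + ν) ^ 3 ≤ |α - a / q| * (N + N) ^ 3 := by gcongr
      _ = (N ^ 3 * |α - a / q|) * 8 := by ring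
      _ ≤ B * 8 := by gcongr
  calc ε' * N * (1 + 2 * Real.pi * |α - a / q| * (N + ν) ^ 3)
      = ε' * N * (1 + 2 * Real.pi * (|α - a / q| * (N + ν) ^ 3)) := by ring
    _ ≤ ε' * N * (1 + 2 * Real.pi * (B * 8)) := by gcongr
    _ = ε * N := by rw [hε']; field_simp

/-- The exponential sum over cubes with an irrational shift is small away from the origin. -/
theorem exists_eventually_norm_cubeSum_le {ν : ℝ} (hν : Irrational ν) (hν0 : 0 ≤ ν) {ε : ℝ}
    (hε : 0 < ε) : ∃ C : ℝ, 0 < C ∧ ∀ T : ℝ, ∀ᶠ N : ℕ in atTop, ∀ α : ℝ, C / N ^ 3 ≤ |α| →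
      |α| ≤ T → ‖cubeSum N ν α‖ ≤ ε * N := by
  obtain ⟨K, hK, hW⟩ := exists_weyl_bound
  set κ : ℝ := ε ^ 4 / (2 * K) with hκ
  have hκ0 : 0 < κ := by positivity
  set B : ℝ := κ⁻¹ ^ 2 with hB
  obtain ⟨Q, hQ⟩ := exists_nat_gt (κ⁻¹ ^ (5 / 4 : ℝ))
  refine ⟨B, by positivity, fun T => ?_⟩
  obtain ⟨R, hR⟩ := exists_nat_gt (Q * (|T| + 1))
  have hfin : ∀ᶠ N : ℕ in atTop, ∀ q ∈ Finset.Icc 1 Q, ∀ a ∈ Finset.Icc (-R : ℤ) R, a ≠ 0 →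
      ∀ α : ℝ, N ^ 3 * |α - a / q| ≤ B → ‖cubeSum N ν α‖ ≤ ε * N := by
    rw [Filter.eventually_all_finset]
    intro q hq
    rw [Filter.eventually_all_finset]
    intro a _
    rw [Filter.eventually_all]
    exact fun ha => eventually_norm_cubeSum_near_le hν hν0 ha (Finset.mem_Icc.mp hq).1 hε
      (by positivity)
  have hNK : ∀ᶠ N : ℕ in atTop, 2 * K / ε ^ 4 ≤ (N : ℝ) ^ (16 / 17 : ℝ) :=
    ((tendsto_rpow_atTop (by norm_num)).comp tendsto_natCast_atTop_atTop).eventually_ge_atTop _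
  filter_upwards [hfin, hNK, eventually_ge_atTop 1] with N hN hN2 hN1 α hα hαT
  by_contra! hcon
  have hN0 : (1 : ℝ) ≤ N := by exact_mod_cast hN1
  obtain ⟨r, hr, hrd⟩ := Real.exists_rat_abs_sub_le_and_den_le α (n := 12 * N ^ 2) (by positivity)
  have hq1 : (1 : ℝ) ≤ r.den := by exact_mod_cast r.pos
  have hr' : |α - (r.num : ℝ) / r.den| ≤ 1 / (((12 * N ^ 2 : ℕ) + 1) * r.den) := by
    rwa [Rat.cast_def] at hr
  have hr2 : |α - (r.num : ℝ) / r.den| ≤ 1 / (12 * N ^ 2 * r.den) := by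
    refine hr'.trans ?_
    push_cast
    gcongr
    linarith
  have hcop : IsCoprime r.num (r.den : ℤ) := by
    rw [Int.isCoprime_iff_gcd_eq_one, Int.gcd_eq_natAbs, Int.natAbs_natCast]; exact r.reduced
  have h1 := hW N α (3 * α * ν) (3 * α * ν ^ 2) (α * ν ^ 3) r.num r.den hN1 r.pos hrd hcop hr2
  have h2 : ∑ x ∈ Finset.range N,
      ee (α * x ^ 3 + 3 * α * ν * x ^ 2 + 3 * α * ν ^ 2 * x + α * ν ^ 3) = cubeSum N ν α :=
    Finset.sum_congr rfl fun x _ => by congr 1; ring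
  rw [h2] at h1
  set q := r.den
  set a := r.num
  set Z := (q : ℝ) ^ (-(4 / 5) : ℝ) with hZ
  set W := √(1 + (N : ℝ) ^ 3 * |α - a / q|) with hWd
  have hW1 : 1 ≤ W := by
    rw [hWd, Real.one_le_sqrt]
    have : 0 ≤ (N : ℝ) ^ 3 * |α - a / q| := by positivity
    linarith
  have hZ1 : Z ≤ 1 := Real.rpow_le_one_of_one_le_of_nonpos hq1 (by norm_num)
  have hZ0 : 0 < Z := by positivity
  have h3 : (ε * N) ^ 4 < ‖cubeSum N ν α‖ ^ 4 := by gcongr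
  have h4 : K * (N : ℝ) ^ (52 / 17 : ℝ) ≤ ε ^ 4 * N ^ 4 / 2 := by
    have : (N : ℝ) ^ 4 = (N : ℝ) ^ (52 / 17 : ℝ) * (N : ℝ) ^ (16 / 17 : ℝ) := by
      rw [← Real.rpow_add (by positivity), ← Real.rpow_natCast]; norm_num
    rw [this]
    rw [div_le_iff₀ (by positivity)] at hN2
    have h5 : 0 ≤ (N : ℝ) ^ (52 / 17 : ℝ) := by positivity
    nlinarith
  have h5 : κ < Z * W⁻¹ := by
    have h6 : ε ^ 4 * N ^ 4 / 2 < K * (N ^ 4 * (Z * W⁻¹)) := by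
      rw [mul_pow] at h3
      linarith
    rw [hκ, div_lt_iff₀ (by positivity)]
    have h7 : (0 : ℝ) < (N : ℝ) ^ 4 := by positivity
    by_contra! h8
    have := mul_le_mul_of_nonneg_left h8 h7.le
    linarith
  have hκZ : κ < Z := h5.trans_le (mul_le_of_le_one_right hZ0.le (inv_le_one_of_one_le₀ hW1))
  have hκW : κ < W⁻¹ := h5.trans_le (mul_le_of_le_one_left (by positivity) hZ1)
  have hqQ : q ≤ Q := by
    have h6 : (q : ℝ) ≤ κ⁻¹ ^ (5 / 4 : ℝ) := by
      have h7 : (q : ℝ) ^ (4 / 5 : ℝ) ≤ κ⁻¹ := by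
        have : (q : ℝ) ^ (4 / 5 : ℝ) = Z⁻¹ := by rw [hZ, Real.rpow_neg (by positivity), inv_inv]
        rw [this]
        exact inv_anti₀ hκ0 hκZ.le
      calc (q : ℝ) = ((q : ℝ) ^ (4 / 5 : ℝ)) ^ (5 / 4 : ℝ) := by
            rw [← Real.rpow_mul (by positivity)]; norm_num
        _ ≤ _ := by gcongr
    exact_mod_cast (h6.trans_lt hQ).le
  have hβB : N ^ 3 * |α - a / q| < B := by
    have h6 : W < κ⁻¹ := (lt_inv_comm₀ hκ0 (by positivity)).mp hκW
    have h7 : W ^ 2 < κ⁻¹ ^ 2 := by gcongr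
    rw [hWd, Real.sq_sqrt (by positivity)] at h7
    linarith
  have ha : a ≠ 0 := by
    intro h0
    rw [h0] at hβB
    simp only [Int.cast_zero, zero_div, sub_zero] at hβB
    rw [div_le_iff₀ (by positivity)] at hα
    linarith
  have haR : |(a : ℝ)| ≤ R := by
    have h6 : |α - a / q| ≤ 1 := by
      refine hr2.trans ?_
      rw [div_le_one (by positivity)]
      nlinarith [mul_le_mul hN0 hN0 zero_le_one (by positivity)]
    have h7 : |(a : ℝ) / q| ≤ |T| + 1 := by
      have h8 := abs_sub_abs_le_abs_sub ((a : ℝ) / q) α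
      rw [abs_sub_comm] at h8
      have := le_abs_self T
      linarith
    rw [abs_div, Nat.abs_cast, div_le_iff₀ (by positivity)] at h7
    have h9 : (|T| + 1) * q ≤ Q * (|T| + 1) := by
      rw [mul_comm]; gcongr
    linarith
  rw [abs_le] at haR
  have haR' : a ∈ Finset.Icc (-R : ℤ) R := by
    rw [Finset.mem_Icc]; exact ⟨by exact_mod_cast haR.1, by exact_mod_cast haR.2⟩
  exact absurd (hN q (Finset.mem_Icc.mpr ⟨r.pos, hqQ⟩) a haR' ha α hβB.le) (not_le.mpr hcon)

lemma wt_le_one (α : ℝ) : wt α ≤ 1 := inv_le_one_of_one_le₀ (by nlinarith [sq_nonneg α])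

lemma exists_dilate_comparison {s : ℕ} (hs : 11 ≤ s) (i₀ : Fin s) {ν : Fin s → ℝ}
    (hν : Irrational (ν i₀)) (hν0 : ∀ i, 0 ≤ ν i) {Φ Ψ : ℝ → ℂ} (hΦ : Continuous Φ)
    (hΨ : Continuous Ψ) {M : ℝ} (hM : 1 ≤ M) (hΦM : ∀ α, ‖Φ α‖ ≤ M * wt α ^ 2)
    (hΨM : ∀ α, ‖Ψ α‖ ≤ M * wt α ^ 2) {ε : ℝ} (hε : 0 < ε) :
    ∃ δ > 0, ∀ᶠ N : ℕ in atTop, ∀ A : ℝ, 1 ≤ A → A ≤ δ * N ^ 3 →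
      ∫⁻ α, ENNReal.ofReal (‖Ψ 0 * Φ α - Φ 0 * Ψ (A * α)‖ * ∏ i, ‖cubeSum N (ν i) α‖) ≤
        ENNReal.ofReal (ε * N ^ (s - 3)) := by
  obtain ⟨C, hC, hI⟩ := exists_setLIntegral_wt_mul_prod_le hs i₀
  set M' : ℝ := 2 * M ^ 2 with hM'
  have hM'0 : 0 < M' := by positivity
  have hs' : (11 : ℝ) ≤ s := by exact_mod_cast hs
  set e : ℝ := ((s : ℝ) - 21 / 2) / s with he
  have he0 : 0 < e := div_pos (by linarith) (by linarith)
  set ε₁ : ℝ := (ε / (2 * M' * C)) ^ e⁻¹ with hε₁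
  have hε₁0 : 0 < ε₁ := by positivity
  have hε₁e : M' * (C * ε₁ ^ e) = ε / 2 := by
    rw [hε₁, Real.rpow_inv_rpow (by positivity) he0.ne']
    field_simp
  set c : ℝ := ε / (2 * C) with hc
  have hc0 : 0 < c := by positivity
  set T : ℝ := 1 + M' / c with hT
  have hT1 : 1 ≤ T := by rw [hT]; have : 0 < M' / c := by positivity
                         linarith
  obtain ⟨C₀, hC₀, hf⟩ := exists_eventually_norm_cubeSum_le hν (hν0 i₀) hε₁0
  set ρ : ℝ := c / (4 * M) with hρ
  have hρ0 : 0 < ρ := by positivity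
  obtain ⟨κ₁, hκ₁, hΦκ⟩ := Metric.continuousAt_iff.mp (hΦ.continuousAt (x := 0)) ρ hρ0
  obtain ⟨κ₂, hκ₂, hΨκ⟩ := Metric.continuousAt_iff.mp (hΨ.continuousAt (x := 0)) ρ hρ0
  refine ⟨κ₂ / (2 * C₀), by positivity, ?_⟩
  have hN3 : Tendsto (fun N : ℕ => (N : ℝ) ^ 3) atTop atTop :=
    (tendsto_pow_atTop (by norm_num)).comp tendsto_natCast_atTop_atTop
  filter_upwards [hf T, eventually_ge_atTop 1, hN3.eventually_ge_atTop C₀,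
    hN3.eventually_gt_atTop (C₀ / κ₁)] with N hfN hN1 hNC hNκ A hA hAN
  have hN0 : (0 : ℝ) < N := by exact_mod_cast hN1
  set S : Set ℝ := {α | C₀ / N ^ 3 ≤ |α|} ∩ {α | |α| ≤ T} with hS
  have hSm : MeasurableSet S := ((isClosed_le continuous_const continuous_abs).inter
    (isClosed_le continuous_abs continuous_const)).measurableSet
  set P : ℝ → ℝ := fun α => wt α * ∏ i, ‖cubeSum N (ν i) α‖ with hP
  have hPc : Continuous P :=
    continuous_wt.mul (continuous_finsetProd _ fun i _ => (continuous_cubeSum N _).norm)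
  have hP0 : ∀ α, 0 ≤ P α := fun α => mul_nonneg (wt_pos α).le
    (Finset.prod_nonneg fun i _ => norm_nonneg _)
  have hΦ0 : ‖Φ 0‖ ≤ M := by simpa [wt] using hΦM 0
  have hΨ0 : ‖Ψ 0‖ ≤ M := by simpa [wt] using hΨM 0
  have hglob : ∀ α, ‖Ψ 0 * Φ α - Φ 0 * Ψ (A * α)‖ ≤ M' * wt α ^ 2 := by
    intro α
    have h1 : wt (A * α) ≤ wt α := by
      unfold wt
      refine inv_anti₀ (by positivity) ?_
      rw [mul_pow]
      have := le_mul_of_one_le_left (sq_nonneg α) (one_le_pow₀ hA (n := 2))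
      linarith
    have h2 : wt (A * α) ^ 2 ≤ wt α ^ 2 := by have := (wt_pos (A * α)).le; gcongr
    refine (norm_sub_le _ _).trans ?_
    rw [norm_mul, norm_mul]
    calc ‖Ψ 0‖ * ‖Φ α‖ + ‖Φ 0‖ * ‖Ψ (A * α)‖
        ≤ M * (M * wt α ^ 2) + M * (M * wt α ^ 2) := by
          gcongr
          · exact hΦM α
          · exact (hΨM _).trans (by gcongr)
      _ = _ := by rw [hM']; ring
  have hpt : ∀ α, ENNReal.ofReal (‖Ψ 0 * Φ α - Φ 0 * Ψ (A * α)‖ * ∏ i, ‖cubeSum N (ν i) α‖) ≤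
      ENNReal.ofReal c * ENNReal.ofReal (P α) +
        S.indicator (fun α => ENNReal.ofReal M' * ENNReal.ofReal (P α)) α := by
    intro α
    have hprod : 0 ≤ ∏ i, ‖cubeSum N (ν i) α‖ := Finset.prod_nonneg fun i _ => norm_nonneg _
    have hw := (wt_pos α).le
    by_cases hα : α ∈ S
    · rw [Set.indicator_of_mem hα]
      refine le_add_left ?_
      rw [← ENNReal.ofReal_mul hM'0.le, hP, ← mul_assoc]
      apply ENNReal.ofReal_le_ofReal
      gcongr
      refine (hglob α).trans ?_
      gcongr
      nlinarith [wt_le_one α]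
    · rw [Set.indicator_of_notMem hα, add_zero, ← ENNReal.ofReal_mul hc0.le, hP, ← mul_assoc]
      apply ENNReal.ofReal_le_ofReal
      gcongr
      rcases lt_or_ge T |α| with hαT | hαT
      · refine (hglob α).trans ?_
        have h1 : M' * wt α ≤ c := by
          unfold wt
          rw [← div_eq_mul_inv, div_le_iff₀ (by positivity), ← sq_abs]
          have h2 : M' / c ≤ |α| := by linarith
          rw [div_le_iff₀ hc0] at h2
          nlinarith [sq_nonneg (|α| - 1)]
        calc M' * wt α ^ 2 = M' * wt α * wt α := by ring
          _ ≤ c * wt α := by gcongr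
      · have hα1 : |α| < C₀ / N ^ 3 := by
          by_contra! h
          exact hα ⟨h, hαT⟩
        have hα2 : |α| ≤ 1 := hα1.le.trans (by rw [div_le_one (by positivity)]; exact hNC)
        have hwα : 1 / 2 ≤ wt α := by
          unfold wt
          rw [one_div]
          gcongr
          have := sq_abs α
          nlinarith [abs_nonneg α]
        have h1 : ‖Φ α - Φ 0‖ < ρ := by
          rw [← dist_eq_norm]
          apply hΦκ
          rw [Real.dist_eq, sub_zero]
          refine hα1.trans ?_
          rw [div_lt_iff₀ (by positivity)]
          rwa [div_lt_iff₀ hκ₁, mul_comm] at hNκ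
        have h2 : ‖Ψ (A * α) - Ψ 0‖ < ρ := by
          rw [← dist_eq_norm]
          apply hΨκ
          rw [Real.dist_eq, sub_zero, abs_mul, abs_of_pos (by linarith)]
          calc A * |α| ≤ κ₂ / (2 * C₀) * N ^ 3 * (C₀ / N ^ 3) := by gcongr
            _ = κ₂ / 2 := by field_simp
            _ < κ₂ := by linarith
        have h3 : Ψ 0 * Φ α - Φ 0 * Ψ (A * α) =
            Ψ 0 * (Φ α - Φ 0) - Φ 0 * (Ψ (A * α) - Ψ 0) := by ring
        rw [h3]
        refine (norm_sub_le _ _).trans ?_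
        rw [norm_mul, norm_mul]
        calc ‖Ψ 0‖ * ‖Φ α - Φ 0‖ + ‖Φ 0‖ * ‖Ψ (A * α) - Ψ 0‖ ≤ M * ρ + M * ρ := by gcongr
          _ = c * (1 / 2) := by rw [hρ]; field_simp; norm_num
          _ ≤ c * wt α := by gcongr
  calc _ ≤ ∫⁻ α, (ENNReal.ofReal c * ENNReal.ofReal (P α) +
        S.indicator (fun α => ENNReal.ofReal M' * ENNReal.ofReal (P α)) α) := lintegral_mono hpt
    _ = ENNReal.ofReal c * (∫⁻ α, ENNReal.ofReal (P α)) +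
        ENNReal.ofReal M' * ∫⁻ α in S, ENNReal.ofReal (P α) := by
        rw [lintegral_add_left (hPc.measurable.ennreal_ofReal.const_mul _),
          lintegral_indicator hSm, lintegral_const_mul' _ _ ENNReal.ofReal_ne_top,
          lintegral_const_mul' _ _ ENNReal.ofReal_ne_top]
    _ ≤ ENNReal.ofReal c * ENNReal.ofReal (C * N ^ (s - 3)) +
        ENNReal.ofReal M' * ENNReal.ofReal (C * ε₁ ^ e * N ^ (s - 3)) := by
        gcongr
        · have := hI N ν 1 Set.univ hN1 hν0 zero_le_one MeasurableSet.univ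
            fun α _ => by simpa using norm_cubeSum_le N (ν i₀) α
          simpa using this
        · exact hI N ν ε₁ S hN1 hν0 hε₁0.le hSm fun α hα => hfN α hα.1 hα.2
    _ = ENNReal.ofReal (ε * N ^ (s - 3)) := by
        rw [← ENNReal.ofReal_mul hc0.le, ← ENNReal.ofReal_mul hM'0.le,
          ← ENNReal.ofReal_add (by positivity) (by positivity)]
        congr 1
        have h1 : c * C = ε / 2 := by rw [hc]; field_simp
        calc _ = (c * C) * N ^ (s - 3) + (M' * (C * ε₁ ^ e)) * (N : ℝ) ^ (s - 3) := by ring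
          _ = _ := by rw [h1, hε₁e]; ring

lemma fourierChar_eq_ee (x : ℝ) : (𝐞 x : ℂ) = ee x := by
  rw [Real.fourierChar_apply, ee]

/-- A smooth compactly supported function is an absolutely convergent superposition of additive
characters, with rapidly decaying coefficients. -/
lemma exists_fourier_coeff {φ : ℝ → ℝ} (hφ : ContDiff ℝ ∞ φ) (hφs : HasCompactSupport φ) :
    ∃ Φ : ℝ → ℂ, Continuous Φ ∧ Integrable Φ ∧ (∃ M : ℝ, 1 ≤ M ∧ ∀ α, ‖Φ α‖ ≤ M * wt α ^ 2) ∧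
      (∀ x, ∫ α, ee (α * x) * Φ α = φ x) ∧ Φ 0 = ∫ x, φ x := by
  have hs : HasCompactSupport fun x => (φ x : ℂ) := hφs.comp_left Complex.ofReal_zero
  have hd : ContDiff ℝ ∞ fun x => (φ x : ℂ) := Complex.ofRealCLM.contDiff.comp hφ
  set f : SchwartzMap ℝ ℂ := hs.toSchwartzMap hd with hf
  have hfx : ∀ x, f x = φ x := fun x => rfl
  set g : SchwartzMap ℝ ℂ := 𝓕 f with hg
  refine ⟨g, g.continuous, g.integrable, ?_, ?_, ?_⟩
  · set M := 2 ^ 4 * ((Finset.Iic ((4, 0) : ℕ × ℕ)).sup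
      (fun m => SchwartzMap.seminorm ℝ m.1 m.2)) (𝓕 f) with hM
    refine ⟨max 1 M, le_max_left _ _, fun α => ?_⟩
    have h := SchwartzMap.one_add_le_sup_seminorm_apply (𝕜 := ℝ) (m := (4, 0)) (k := 4) (n := 0)
      le_rfl le_rfl (𝓕 f) α
    rw [norm_iteratedFDeriv_zero, ← hM, Real.norm_eq_abs] at h
    rw [wt, inv_pow, ← div_eq_mul_inv, le_div_iff₀ (by positivity), mul_comm]
    refine le_trans ?_ (h.trans (le_max_right _ _))
    gcongr
    rw [show (4 : ℕ) = 2 * 2 from rfl, pow_mul]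
    gcongr
    nlinarith [abs_nonneg α, sq_abs α]
  · intro x
    have h : (𝓕⁻ (𝓕 f)) x = f x := by rw [FourierTransform.fourierInv_fourier_eq]
    rw [SchwartzMap.fourierInv_coe, Real.fourierInv_eq, hfx] at h
    rw [← h]
    refine integral_congr_ae (ae_of_all _ fun α => ?_)
    simp only [RCLike.inner_apply, conj_trivial, Circle.smul_def, fourierChar_eq_ee, smul_eq_mul]
    rw [mul_comm x α]
  · rw [SchwartzMap.fourier_coe, Real.fourier_eq]
    simp [hfx, integral_complex_ofReal]

/-- The value of the sum of shifted cubes at a vector of natural numbers. -/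
noncomputable def cubeForm {s : ℕ} (ν : Fin s → ℝ) (k : Fin s → ℕ) : ℝ := ∑ i, ((k i : ℝ) + ν i) ^ 3

lemma prod_cubeSum {s : ℕ} (ν : Fin s → ℝ) (N : ℕ) (α : ℝ) :
    ∏ i, cubeSum N (ν i) α =
      ∑ k ∈ Fintype.piFinset (fun _ : Fin s => Finset.range N), ee (α * cubeForm ν k) := by
  unfold cubeSum
  rw [Finset.prod_univ_sum]
  refine Finset.sum_congr rfl fun k _ => ?_
  have : ∀ t : Finset (Fin s), ∏ i ∈ t, ee (α * (k i + ν i) ^ 3) =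
      ee (∑ i ∈ t, α * (k i + ν i) ^ 3) := by
    intro t
    classical
    induction t using Finset.induction with
    | empty => simp [ee_zero]
    | insert a t ha ih => rw [Finset.prod_insert ha, Finset.sum_insert ha, ee_add, ih]
  rw [this, cubeForm, Finset.mul_sum]

/-- Weighted counts of lattice points at the small scale and at the large scale agree. -/
theorem exists_comparison {s : ℕ} (hs : 11 ≤ s) (i₀ : Fin s) {ν : Fin s → ℝ}
    (hν : Irrational (ν i₀)) (hν0 : ∀ i, 0 ≤ ν i) {φ ψ : ℝ → ℝ} (hφ : ContDiff ℝ ∞ φ)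
    (hφs : HasCompactSupport φ) (hψ : ContDiff ℝ ∞ ψ) (hψs : HasCompactSupport ψ)
    {ε : ℝ} (hε : 0 < ε) :
    ∃ δ > 0, ∀ᶠ N : ℕ in atTop, ∀ A : ℝ, 1 ≤ A → A ≤ δ * N ^ 3 → ∀ τ : ℝ,
      |(∫ x, ψ x) * (∑ k ∈ Fintype.piFinset (fun _ : Fin s => Finset.range N),
          φ (cubeForm ν k - τ)) -
        (∫ x, φ x) * (A⁻¹ * ∑ k ∈ Fintype.piFinset (fun _ : Fin s => Finset.range N),
          ψ ((cubeForm ν k - τ) / A))| ≤ ε * N ^ (s - 3) := by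
  obtain ⟨Φ, hΦc, hΦi, ⟨M₁, hM₁, hΦM⟩, hΦx, hΦ0⟩ := exists_fourier_coeff hφ hφs
  obtain ⟨Ψ, hΨc, hΨi, ⟨M₂, hM₂, hΨM⟩, hΨx, hΨ0⟩ := exists_fourier_coeff hψ hψs
  obtain ⟨δ, hδ, h⟩ := exists_dilate_comparison hs i₀ hν hν0 hΦc hΨc (M := max M₁ M₂)
    (le_max_of_le_left hM₁)
    (fun α => (hΦM α).trans (mul_le_mul_of_nonneg_right (le_max_left _ _) (sq_nonneg _)))
    (fun α => (hΨM α).trans (mul_le_mul_of_nonneg_right (le_max_right _ _) (sq_nonneg _))) hε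
  refine ⟨δ, hδ, ?_⟩
  filter_upwards [h] with N hN A hA hAN τ
  have hA0 : 0 < A := by linarith
  set box := Fintype.piFinset (fun _ : Fin s => Finset.range N) with hbox
  have hint : ∀ {Θ : ℝ → ℂ}, Integrable Θ → ∀ y : ℝ, Integrable fun α => ee (α * y) * Θ α := by
    intro Θ hΘ y
    exact hΘ.bdd_mul (c := 1) (continuous_ee.comp (by fun_prop)).aestronglyMeasurable
      (ae_of_all _ fun α => (norm_ee _).le)
  have hΨA : Integrable fun α => Ψ (A * α) := hΨi.comp_mul_left' hA0.ne'
  have hψA : ∀ y : ℝ, ∫ α, ee (α * y) * Ψ (A * α) = ((A⁻¹ * ψ (y / A) : ℝ) : ℂ) := by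
    intro y
    have h1 := Measure.integral_comp_mul_left (fun β : ℝ => ee (β * (y / A)) * Ψ β) A
    rw [hΨx, abs_of_pos (by positivity)] at h1
    push_cast
    rw [Complex.real_smul] at h1
    push_cast at h1
    rw [← h1]
    refine integral_congr_ae (ae_of_all _ fun α => ?_)
    simp only
    congr 2
    field_simp
  set D : ℝ → ℂ := fun α => Ψ 0 * Φ α - Φ 0 * Ψ (A * α) with hD
  have hDi : Integrable D := (hΦi.const_mul _).sub (hΨA.const_mul _)
  have hDx : ∀ y : ℝ, ∫ α, ee (α * y) * D α =
      (((∫ x, ψ x) * φ y - (∫ x, φ x) * (A⁻¹ * ψ (y / A)) : ℝ) : ℂ) := by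
    intro y
    have h1 : ∀ α, ee (α * y) * D α =
        Ψ 0 * (ee (α * y) * Φ α) - Φ 0 * (ee (α * y) * Ψ (A * α)) := fun α => by
      simp only [hD]; ring
    simp_rw [h1]
    rw [integral_sub ((hint hΦi y).const_mul _) ((hint hΨA y).const_mul _), integral_const_mul,
      integral_const_mul, hΦx, hψA, hΦ0, hΨ0]
    push_cast; ring
  have hsum : ((((∫ x, ψ x) * (∑ k ∈ box, φ (cubeForm ν k - τ)) -
        (∫ x, φ x) * (A⁻¹ * ∑ k ∈ box, ψ ((cubeForm ν k - τ) / A)) : ℝ)) : ℂ) =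
      ∫ α, (ee (α * (-τ)) * ∏ i, cubeSum N (ν i) α) * D α := by
    simp_rw [prod_cubeSum, ← hbox, Finset.mul_sum, Finset.sum_mul]
    rw [integral_finsetSum]
    · rw [← Finset.sum_sub_distrib]
      push_cast
      refine Finset.sum_congr rfl fun k _ => ?_
      have h1 := hDx (cubeForm ν k - τ)
      push_cast at h1
      rw [← h1]
      refine integral_congr_ae (ae_of_all _ fun α => ?_)
      simp only
      rw [← ee_add]
      congr 2; ring
    · intro k _
      have := hint hDi (cubeForm ν k - τ)
      refine this.congr (ae_of_all _ fun α => ?_)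
      simp only
      rw [← ee_add]
      congr 2; ring
  rw [← Real.norm_eq_abs, ← Complex.norm_real, hsum]
  have h2 := enorm_integral_le_lintegral_enorm (μ := volume)
    fun α => (ee (α * (-τ)) * ∏ i, cubeSum N (ν i) α) * D α
  have h3 : ∫⁻ α, ‖(ee (α * (-τ)) * ∏ i, cubeSum N (ν i) α) * D α‖ₑ ≤
      ENNReal.ofReal (ε * N ^ (s - 3)) := by
    refine le_trans (le_of_eq ?_) (hN A hA hAN)
    refine lintegral_congr fun α => ?_
    rw [← ofReal_norm, norm_mul, norm_mul, norm_ee, one_mul, norm_prod, mul_comm]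
  have h4 := h2.trans h3
  rwa [← ofReal_norm, ENNReal.ofReal_le_ofReal_iff (by positivity)] at h4

lemma volume_floor_abs_eq (k : ℕ) : volume {x : ℝ | ⌊|x|⌋₊ = k} = 2 := by
  have h : {x : ℝ | ⌊|x|⌋₊ = k} = Set.Ioo (-((k : ℝ) + 1)) (k + 1) \ Set.Ioo (-(k : ℝ)) k := by
    ext x
    rw [Set.mem_ofPred_eq, Nat.floor_eq_iff (abs_nonneg x), Set.mem_sdiff, Set.mem_Ioo,
      Set.mem_Ioo, ← abs_lt, ← abs_lt, not_lt, and_comm]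
  rw [h, measure_sdiff _ measurableSet_Ioo.nullMeasurableSet (by simp), Real.volume_Ioo,
    Real.volume_Ioo, ← ENNReal.ofReal_sub _ (by linarith [Nat.cast_nonneg (α := ℝ) k])]
  · rw [show (k : ℝ) + 1 - -(k + 1) - (k - -k) = 2 by ring]; simp
  · exact Set.Ioo_subset_Ioo (by linarith) (by linarith)

lemma volume_cells {s : ℕ} (J : Finset (Fin s → ℕ)) :
    volume {x : Fin s → ℝ | (fun i => ⌊|x i|⌋₊) ∈ J} = 2 ^ s * J.card := by
  have hm : ∀ k : ℕ, MeasurableSet {x : ℝ | ⌊|x|⌋₊ = k} := fun k =>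
    measurableSet_eq_fun (Nat.measurable_floor.comp measurable_abs) measurable_const
  have h : {x : Fin s → ℝ | (fun i => ⌊|x i|⌋₊) ∈ J} =
      ⋃ k ∈ J, Set.univ.pi fun i => {x : ℝ | ⌊|x|⌋₊ = k i} := by
    ext x
    simp only [Set.mem_ofPred_eq, Set.mem_iUnion, Set.mem_univ_pi, exists_prop]
    refine ⟨fun hx => ⟨_, hx, fun i => rfl⟩, ?_⟩
    rintro ⟨k, hk, hx⟩
    rwa [show (fun i => ⌊|x i|⌋₊) = k from funext hx]
  rw [h, measure_biUnion_finset]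
  · simp_rw [volume_pi_pi, volume_floor_abs_eq]
    simp [mul_comm]
  · intro k _ l _ hkl
    refine Set.disjoint_left.2 fun x hx hy => hkl ?_
    rw [Set.mem_univ_pi] at hx hy
    exact funext fun i => (hx i).symm.trans (hy i)
  · exact fun k _ => MeasurableSet.univ_pi fun i => hm _

/-- The volume of the positive orthant of the unit ball of `ℓ³`. -/
noncomputable def orthantVol (s : ℕ) : ℝ := Real.Gamma (4 / 3) ^ s / Real.Gamma ((s : ℝ) / 3 + 1)

lemma orthantVol_pos (s : ℕ) : 0 < orthantVol s :=
  div_pos (pow_pos (Real.Gamma_pos_of_pos (by norm_num)) _)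
    (Real.Gamma_pos_of_pos (by positivity))

lemma volume_cubeBall {s : ℕ} (hs : 0 < s) {r : ℝ} (hr : 0 ≤ r) :
    volume {x : Fin s → ℝ | (∑ i, |x i| ^ (3 : ℝ)) ^ (1 / (3 : ℝ)) ≤ r} =
      2 ^ s * ENNReal.ofReal (orthantVol s * r ^ s) := by
  have : Nonempty (Fin s) := ⟨⟨0, hs⟩⟩
  rw [volume_sum_rpow_le (Fin s) (by norm_num), Fintype.card_fin,
    ← ENNReal.ofReal_pow hr, show (2 : ENNReal) = ENNReal.ofReal 2 by simp,
    ← ENNReal.ofReal_pow (by norm_num), ← ENNReal.ofReal_mul (by positivity), ← ENNReal.ofReal_mul (by positivity)]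
  congr 1
  rw [orthantVol, show (1 / 3 + 1 : ℝ) = 4 / 3 by norm_num, mul_pow]
  ring

lemma cubeForm_eq_rpow {s : ℕ} {ν : Fin s → ℝ} (hν0 : ∀ i, 0 ≤ ν i) (k : Fin s → ℕ) :
    cubeForm ν k = ∑ i, |(k i : ℝ) + ν i| ^ (3 : ℝ) := by
  refine Finset.sum_congr rfl fun i _ => ?_
  have := hν0 i
  rw [abs_of_nonneg (by positivity)]
  exact_mod_cast (Real.rpow_natCast _ 3).symm

lemma cubeForm_nonneg {s : ℕ} {ν : Fin s → ℝ} (hν0 : ∀ i, 0 ≤ ν i) (k : Fin s → ℕ) :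
    0 ≤ cubeForm ν k :=
  Finset.sum_nonneg fun i _ => by have := hν0 i; positivity

lemma cube_le_cubeForm {s : ℕ} {ν : Fin s → ℝ} (hν0 : ∀ i, 0 ≤ ν i) (k : Fin s → ℕ) (i : Fin s) :
    (k i : ℝ) ^ 3 ≤ cubeForm ν k := by
  refine le_trans ?_ (Finset.single_le_sum (f := fun i => ((k i : ℝ) + ν i) ^ 3)
    (fun j _ => by have := hν0 j; positivity) (Finset.mem_univ i))
  have := hν0 i
  gcongr
  linarith

lemma mem_box_of_cubeForm_lt {s : ℕ} {ν : Fin s → ℝ} (hν0 : ∀ i, 0 ≤ ν i) {k : Fin s → ℕ} {N : ℕ}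
    (h : cubeForm ν k < N ^ 3) : k ∈ Fintype.piFinset (fun _ : Fin s => Finset.range N) := by
  rw [Fintype.mem_piFinset]
  intro i
  rw [Finset.mem_range]
  have := (cube_le_cubeForm hν0 k i).trans_lt h
  exact_mod_cast lt_of_pow_lt_pow_left₀ 3 (Nat.cast_nonneg N) this

/-- Number of vectors in a box at which the form is at most `t`. -/
noncomputable def boxCount {s : ℕ} (ν : Fin s → ℝ) (N : ℕ) (t : ℝ) : ℕ :=
  ((Fintype.piFinset (fun _ : Fin s => Finset.range N)).filter fun k => cubeForm ν k ≤ t).card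

lemma boxCount_le {s : ℕ} (hs : 0 < s) {ν : Fin s → ℝ} (hν0 : ∀ i, 0 ≤ ν i) (N : ℕ) {t : ℝ}
    (ht : 0 ≤ t) :
    (boxCount ν N t : ℝ) ≤ orthantVol s * (t ^ (1 / 3 : ℝ) + (s : ℝ) ^ (1 / 3 : ℝ)) ^ s := by
  have h := measure_mono (μ := volume) (s := {x : Fin s → ℝ | (fun i => ⌊|x i|⌋₊) ∈
      (Fintype.piFinset (fun _ : Fin s => Finset.range N)).filter fun k => cubeForm ν k ≤ t})
    (t := {x : Fin s → ℝ | (∑ i, |x i| ^ (3 : ℝ)) ^ (1 / (3 : ℝ)) ≤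
      t ^ (1 / 3 : ℝ) + (s : ℝ) ^ (1 / 3 : ℝ)}) ?_
  · rw [volume_cells, volume_cubeBall hs (by positivity)] at h
    rw [ENNReal.mul_le_mul_iff_right (by simp) (by finiteness), ← ENNReal.ofReal_natCast,
      ENNReal.ofReal_le_ofReal_iff (mul_nonneg (orthantVol_pos s).le (by positivity))] at h
    exact h
  · intro x hx
    rw [Set.mem_ofPred_eq, Finset.mem_filter] at hx
    rw [Set.mem_ofPred_eq]
    have h1 := Real.Lp_add_le Finset.univ (fun i => (⌊|x i|⌋₊ : ℝ) + ν i) (fun _ : Fin s => (1 : ℝ))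
      (p := 3) (by norm_num)
    rw [← cubeForm_eq_rpow hν0 fun i => ⌊|x i|⌋₊] at h1
    have h2 : ∑ i, |x i| ^ (3 : ℝ) ≤ ∑ i, |(⌊|x i|⌋₊ : ℝ) + ν i + 1| ^ (3 : ℝ) := by
      refine Finset.sum_le_sum fun i _ => Real.rpow_le_rpow (abs_nonneg _) ?_ (by norm_num)
      have := hν0 i
      have h3 := (Nat.lt_floor_add_one |x i|).le
      exact h3.trans (le_trans (by linarith) (le_abs_self _))
    calc _ ≤ _ := Real.rpow_le_rpow (by positivity) h2 (by norm_num)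
      _ ≤ _ := h1
      _ ≤ _ := by
        gcongr
        · exact cubeForm_nonneg hν0 _
        · exact hx.2
        · simp

lemma le_boxCount {s : ℕ} (hs : 0 < s) {ν : Fin s → ℝ} (hν0 : ∀ i, 0 ≤ ν i) (hν1 : ∀ i, ν i ≤ 1)
    {N : ℕ} {t : ℝ} (ht : (s : ℝ) ≤ t) (hN : t < N ^ 3) :
    orthantVol s * (t ^ (1 / 3 : ℝ) - (s : ℝ) ^ (1 / 3 : ℝ)) ^ s ≤ boxCount ν N t := by
  have ht0 : 0 ≤ t := (Nat.cast_nonneg s).trans ht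
  have hr : 0 ≤ t ^ (1 / 3 : ℝ) - (s : ℝ) ^ (1 / 3 : ℝ) :=
    sub_nonneg.2 (Real.rpow_le_rpow (Nat.cast_nonneg s) ht (by norm_num))
  have h := measure_mono (μ := volume) (t := {x : Fin s → ℝ | (fun i => ⌊|x i|⌋₊) ∈
      (Fintype.piFinset (fun _ : Fin s => Finset.range N)).filter fun k => cubeForm ν k ≤ t})
    (s := {x : Fin s → ℝ | (∑ i, |x i| ^ (3 : ℝ)) ^ (1 / (3 : ℝ)) ≤
      t ^ (1 / 3 : ℝ) - (s : ℝ) ^ (1 / 3 : ℝ)}) ?_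
  · rw [volume_cells, volume_cubeBall hs hr] at h
    rw [ENNReal.mul_le_mul_iff_right (by simp) (by finiteness), ← ENNReal.ofReal_natCast,
      ENNReal.ofReal_le_ofReal_iff (by positivity)] at h
    exact h
  · intro x hx
    rw [Set.mem_ofPred_eq] at hx
    rw [Set.mem_ofPred_eq, Finset.mem_filter]
    suffices h : cubeForm ν (fun i => ⌊|x i|⌋₊) ≤ t from
      ⟨mem_box_of_cubeForm_lt hν0 (h.trans_lt hN), h⟩
    have h1 := Real.Lp_add_le Finset.univ (fun i => |x i|) (fun _ : Fin s => (1 : ℝ))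
      (p := 3) (by norm_num)
    simp only [abs_abs] at h1
    have h2 : cubeForm ν (fun i => ⌊|x i|⌋₊) ≤ ∑ i, |(|x i| + 1)| ^ (3 : ℝ) := by
      rw [cubeForm_eq_rpow hν0]
      refine Finset.sum_le_sum fun i _ => Real.rpow_le_rpow (abs_nonneg _) ?_ (by norm_num)
      have := hν0 i
      rw [abs_of_nonneg (a := (⌊|x i|⌋₊ : ℝ) + ν i) (by positivity),
        abs_of_nonneg (a := |x i| + 1) (by positivity)]
      have h3 := Nat.floor_le (abs_nonneg (x i))
      linarith [hν1 i]
    rw [← Real.rpow_le_rpow_iff (z := 1 / 3) (cubeForm_nonneg hν0 _) ht0 (by norm_num)]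
    calc _ ≤ _ := Real.rpow_le_rpow (cubeForm_nonneg hν0 _) h2 (by norm_num)
      _ ≤ _ := h1
      _ ≤ (t ^ (1 / 3 : ℝ) - (s : ℝ) ^ (1 / 3 : ℝ)) + (s : ℝ) ^ (1 / 3 : ℝ) := by
        gcongr
        simp
      _ = _ := by ring

/-- Asymptotics for the number of vectors at which the form is at most `a * τ`. -/
lemma tendsto_boxCount {s : ℕ} (hs : 0 < s) {ν : Fin s → ℝ} (hν0 : ∀ i, 0 ≤ ν i)
    (hν1 : ∀ i, ν i ≤ 1) {N : ℝ → ℕ} {a : ℝ} (ha : 0 < a)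
    (hN : ∀ᶠ τ in atTop, a * τ < N τ ^ 3) :
    Tendsto (fun τ : ℝ => (boxCount ν (N τ) (a * τ) : ℝ) / τ ^ ((s : ℝ) / 3)) atTop
      (nhds (orthantVol s * a ^ ((s : ℝ) / 3))) := by
  have key : ∀ c : ℝ, Tendsto (fun τ : ℝ => orthantVol s * ((a * τ) ^ (1 / 3 : ℝ) + c) ^ s /
      τ ^ ((s : ℝ) / 3)) atTop (nhds (orthantVol s * a ^ ((s : ℝ) / 3))) := by
    intro c
    have h1 : Tendsto (fun τ : ℝ => orthantVol s * (a ^ (1 / 3 : ℝ) + c * τ ^ (-(1 / 3) : ℝ)) ^ s)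
        atTop (nhds (orthantVol s * (a ^ (1 / 3 : ℝ) + c * 0) ^ s)) :=
      (((tendsto_rpow_neg_atTop (by norm_num)).const_mul c).const_add _ |>.pow s).const_mul _
    rw [mul_zero, add_zero, ← Real.rpow_natCast, ← Real.rpow_mul ha.le, one_div_mul_eq_div] at h1
    refine h1.congr' ?_
    filter_upwards [eventually_gt_atTop 0] with τ hτ
    have h2 : τ ^ ((s : ℝ) / 3) = (τ ^ (1 / 3 : ℝ)) ^ s := by
      rw [← Real.rpow_natCast, ← Real.rpow_mul hτ.le, one_div_mul_eq_div]
    have h3 : 0 < τ ^ (1 / 3 : ℝ) := by positivity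
    rw [h2, mul_div_assoc, ← div_pow, Real.mul_rpow ha.le hτ.le, Real.rpow_neg hτ.le]
    congr 2
    field_simp
  refine tendsto_of_tendsto_of_tendsto_of_le_of_le' (key (-(s : ℝ) ^ (1 / 3 : ℝ)))
    (key ((s : ℝ) ^ (1 / 3 : ℝ))) ?_ ?_
  · filter_upwards [hN, eventually_ge_atTop (s / a)] with τ h1 h2
    have hτ : 0 ≤ τ := le_trans (by positivity) h2
    rw [div_le_iff₀' ha] at h2
    have := le_boxCount hs hν0 hν1 h2 h1
    rw [← sub_eq_add_neg]
    gcongr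
  · filter_upwards [eventually_ge_atTop 0] with τ hτ
    have := boxCount_le hs hν0 (N τ) (t := a * τ) (by positivity)
    gcongr

/-- A function trapped between families of bounds converging to `l` tends to `l`. -/
lemma tendsto_of_eventually_bounds {X lo hi : ℝ → ℝ} {l : ℝ} (hlo : ContinuousAt lo 0)
    (hhi : ContinuousAt hi 0) (hlo0 : lo 0 = l) (hhi0 : hi 0 = l)
    (h : ∀ κ, 0 < κ → κ < 1 → ∀ᶠ τ in atTop, lo κ ≤ X τ ∧ X τ ≤ hi κ) :
    Tendsto X atTop (𝓝 l) := by
  have h1 : ∀ᶠ κ : ℝ in 𝓝[>] 0, 0 < κ ∧ κ < 1 :=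
    Ioo_mem_nhdsGT zero_lt_one
  refine tendsto_order.2 ⟨fun a ha => ?_, fun a ha => ?_⟩
  · have h2 : ∀ᶠ κ in 𝓝[>] 0, a < lo κ :=
      (hlo.tendsto.mono_left nhdsWithin_le_nhds).eventually_const_lt (hlo0 ▸ ha)
    obtain ⟨κ, ⟨h3, h4⟩, h5⟩ := (h1.and h2).exists
    filter_upwards [h κ h3 h4] with τ hτ using h5.trans_le hτ.1
  · have h2 : ∀ᶠ κ in 𝓝[>] 0, hi κ < a :=
      (hhi.tendsto.mono_left nhdsWithin_le_nhds).eventually_lt_const (hhi0 ▸ ha)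
    obtain ⟨κ, ⟨h3, h4⟩, h5⟩ := (h1.and h2).exists
    filter_upwards [h κ h3 h4] with τ hτ using hτ.2.trans_lt h5

/-- Side of a box containing every vector at which the form is at most `2 * τ`. -/
noncomputable def boxSize (τ : ℝ) : ℕ := ⌈2 * τ ^ (1 / 3 : ℝ)⌉₊

lemma le_boxSize_pow {τ : ℝ} (hτ : 0 ≤ τ) : 8 * τ ≤ (boxSize τ : ℝ) ^ 3 := by
  calc 8 * τ = (2 * τ ^ (1 / 3 : ℝ)) ^ 3 := by
        rw [mul_pow, ← Real.rpow_natCast (τ ^ (1 / 3 : ℝ)), ← Real.rpow_mul hτ]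
        norm_num
    _ ≤ _ := by gcongr; exact Nat.le_ceil _

lemma boxSize_le {τ : ℝ} (hτ : 1 ≤ τ) : (boxSize τ : ℝ) ≤ 3 * τ ^ (1 / 3 : ℝ) := by
  have h := Nat.ceil_lt_add_one (a := 2 * τ ^ (1 / 3 : ℝ)) (by positivity)
  have h1 := Real.one_le_rpow hτ (z := 1 / 3) (by norm_num)
  rw [boxSize]
  linarith

lemma boxSize_pow_le {s : ℕ} (hs : 3 ≤ s) {τ : ℝ} (hτ : 1 ≤ τ) :
    (boxSize τ : ℝ) ^ (s - 3) ≤ 3 ^ (s - 3) * τ ^ ((s : ℝ) / 3 - 1) := by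
  have hτ0 : 0 ≤ τ := by linarith
  calc (boxSize τ : ℝ) ^ (s - 3) ≤ (3 * τ ^ (1 / 3 : ℝ)) ^ (s - 3) := by
        gcongr; exact boxSize_le hτ
    _ = _ := by
        rw [mul_pow, ← Real.rpow_natCast (τ ^ (1 / 3 : ℝ)), ← Real.rpow_mul hτ0, Nat.cast_sub hs]
        congr 2
        push_cast
        ring

lemma tendsto_boxSize : Tendsto boxSize atTop atTop :=
  tendsto_nat_ceil_atTop.comp
    ((tendsto_rpow_atTop (by norm_num : (0 : ℝ) < 1 / 3)).const_mul_atTop zero_lt_two)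

lemma tendsto_shell_quotient (V σ b : ℝ) :
    Tendsto (fun δ : ℝ => (V * (1 + b * δ) ^ σ - V * (1 - b * δ) ^ σ) / δ) (𝓝[>] 0)
      (𝓝 (2 * b * (V * σ))) := by
  have h1 : HasDerivAt (fun δ : ℝ => V * (1 + b * δ) ^ σ - V * (1 - b * δ) ^ σ)
      (V * ((b * 1) * σ * (1 + b * 0) ^ (σ - 1)) - V * (-(b * 1) * σ * (1 - b * 0) ^ (σ - 1))) 0 :=
    ((((hasDerivAt_id (0 : ℝ)).const_mul b).const_add 1).rpow_const (by simp) |>.const_mul V).sub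
      ((((hasDerivAt_id (0 : ℝ)).const_mul b).const_sub 1).rpow_const (by simp) |>.const_mul V)
  have h2 := h1.tendsto_slope_zero_right
  simp only [mul_zero, add_zero, sub_zero, Real.one_rpow, mul_one, zero_add, sub_self,
    smul_eq_mul] at h2
  rw [show 2 * b * (V * σ) = V * (b * σ) - V * (-b * σ) by ring]
  exact h2.congr fun δ => inv_mul_eq_div _ _

/-- Number of vectors near a large shell. -/
lemma eventually_shell {s : ℕ} (hs : 0 < s) {ν : Fin s → ℝ} (hν0 : ∀ i, 0 ≤ ν i)
    (hν1 : ∀ i, ν i ≤ 1) {b : ℝ} (hb : 0 < b) {θ : ℝ} (hθ : 0 < θ) :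
    ∀ᶠ δ : ℝ in 𝓝[>] 0, ∀ᶠ τ : ℝ in atTop,
      |((boxCount ν (boxSize τ) ((1 + b * δ) * τ) : ℝ) -
        boxCount ν (boxSize τ) ((1 - b * δ) * τ)) / (δ * τ ^ ((s : ℝ) / 3)) -
        2 * b * (orthantVol s * ((s : ℝ) / 3))| < θ := by
  have h1 := Metric.tendsto_nhds.1 (tendsto_shell_quotient (orthantVol s) ((s : ℝ) / 3) b) θ hθ
  have h2 : ∀ᶠ δ : ℝ in 𝓝[>] 0, 0 < δ ∧ δ < 1 / b := Ioo_mem_nhdsGT (by positivity)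
  filter_upwards [h1, h2] with δ h3 h4
  have hbδ : b * δ < 1 := by have := h4.2; rwa [lt_div_iff₀ hb, mul_comm] at this
  have hbδ0 : 0 < b * δ := mul_pos hb h4.1
  have hN : ∀ a : ℝ, a < 2 → ∀ᶠ τ : ℝ in atTop, a * τ < boxSize τ ^ 3 := by
    intro a ha
    filter_upwards [eventually_gt_atTop 0] with τ hτ
    refine lt_of_lt_of_le ?_ (le_boxSize_pow hτ.le)
    gcongr
    linarith
  have h5 := ((tendsto_boxCount hs hν0 hν1 (a := 1 + b * δ) (by linarith)
    (hN _ (by linarith))).sub (tendsto_boxCount hs hν0 hν1 (a := 1 - b * δ) (by linarith)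
    (hN _ (by linarith)))).div_const δ
  have h6 := h5.sub_const (2 * b * (orthantVol s * ((s : ℝ) / 3)))
  filter_upwards [h6.abs.eventually_lt_const h3] with τ hτ
  rwa [← sub_div, div_div, mul_comm (_ ^ _) δ] at hτ

lemma boxCount_eq_sum {s : ℕ} (ν : Fin s → ℝ) (N : ℕ) (t : ℝ) :
    (boxCount ν N t : ℝ) = ∑ k ∈ Fintype.piFinset (fun _ : Fin s => Finset.range N),
      if cubeForm ν k ≤ t then 1 else 0 := by
  rw [boxCount, Finset.natCast_card_filter]

lemma sum_bump_le_shell {s : ℕ} (ν : Fin s → ℝ) (N : ℕ) (ψ : ContDiffBump (0 : ℝ)) {δ τ : ℝ}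
    (hδ : 0 < δ) (hτ : 0 < τ) :
    ∑ k ∈ Fintype.piFinset (fun _ : Fin s => Finset.range N), ψ ((cubeForm ν k - τ) / (δ * τ)) ≤
      (boxCount ν N ((1 + ψ.rOut * δ) * τ) : ℝ) - boxCount ν N ((1 - ψ.rOut * δ) * τ) := by
  rw [boxCount_eq_sum, boxCount_eq_sum, ← Finset.sum_sub_distrib]
  refine Finset.sum_le_sum fun k _ => ?_
  have hA : 0 < δ * τ := by positivity
  have hr : 0 < ψ.rOut * (δ * τ) := mul_pos ψ.rOut_pos hA
  by_cases h : |(cubeForm ν k - τ) / (δ * τ)| < ψ.rOut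
  · rw [abs_div, abs_of_pos hA, div_lt_iff₀ hA, abs_lt] at h
    rw [if_pos (by linarith [h.2]), if_neg (by linarith [h.1]), sub_zero]
    exact ψ.le_one
  · rw [ψ.zero_of_le_dist (by rw [Real.dist_eq, sub_zero]; exact not_lt.1 h)]
    split_ifs <;> first | (norm_num; done) | (exfalso; linarith)

lemma shell_le_sum_bump {s : ℕ} (ν : Fin s → ℝ) (N : ℕ) (ψ : ContDiffBump (0 : ℝ)) {δ τ : ℝ}
    (hδ : 0 < δ) (hτ : 0 < τ) :
    (boxCount ν N ((1 + ψ.rIn * δ) * τ) : ℝ) - boxCount ν N ((1 - ψ.rIn * δ) * τ) ≤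
    ∑ k ∈ Fintype.piFinset (fun _ : Fin s => Finset.range N), ψ ((cubeForm ν k - τ) / (δ * τ)) := by
  rw [boxCount_eq_sum, boxCount_eq_sum, ← Finset.sum_sub_distrib]
  refine Finset.sum_le_sum fun k _ => ?_
  have hA : 0 < δ * τ := by positivity
  have h0 : 0 ≤ ψ ((cubeForm ν k - τ) / (δ * τ)) := ψ.nonneg
  by_cases h : |(cubeForm ν k - τ) / (δ * τ)| ≤ ψ.rIn
  · rw [ψ.one_of_mem_closedBall (by rwa [Metric.mem_closedBall, Real.dist_eq, sub_zero])]
    split_ifs <;> norm_num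
  · rw [abs_div, abs_of_pos hA, div_le_iff₀ hA, abs_le, not_and_or, not_le, not_le] at h
    have hr : 0 < ψ.rIn * (δ * τ) := mul_pos ψ.rIn_pos hA
    split_ifs with h1 h2
    · simpa using h0
    · exfalso
      rcases h with h | h <;> linarith
    · linarith
    · simpa using h0

lemma two_mul_rIn_le_integral (φ : ContDiffBump (0 : ℝ)) : 2 * φ.rIn ≤ ∫ x, φ x := by
  have h := φ.measure_closedBall_le_integral volume
  rwa [Measure.real, Real.volume_closedBall,
    ENNReal.toReal_ofReal (by linarith [φ.rIn_pos])] at h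

lemma integral_le_two_mul_rOut (φ : ContDiffBump (0 : ℝ)) : ∫ x, φ x ≤ 2 * φ.rOut := by
  have h := φ.integral_le_measure_closedBall volume
  rwa [Measure.real, Real.volume_closedBall,
    ENNReal.toReal_ofReal (by linarith [φ.rOut_pos])] at h

/-- Smoothed form of the asymptotic formula. -/
theorem tendsto_smooth_count {s : ℕ} (hs : 11 ≤ s) (i₀ : Fin s) {ν : Fin s → ℝ}
    (hν : Irrational (ν i₀)) (hν0 : ∀ i, 0 ≤ ν i) (hν1 : ∀ i, ν i ≤ 1) (φ : ContDiffBump (0 : ℝ)) :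
    Tendsto (fun τ : ℝ => (∑ k ∈ Fintype.piFinset (fun _ : Fin s => Finset.range (boxSize τ)),
      φ (cubeForm ν k - τ)) / τ ^ ((s : ℝ) / 3 - 1)) atTop
      (𝓝 ((∫ x, φ x) * (orthantVol s * ((s : ℝ) / 3)))) := by
  set L : ℝ := orthantVol s * ((s : ℝ) / 3) with hL
  set I : ℝ := ∫ x, φ x with hI
  have hI0 : 0 ≤ I := by linarith [two_mul_rIn_le_integral φ, φ.rIn_pos]
  refine tendsto_of_eventually_bounds (lo := fun κ => (I * (2 * L - κ) - κ) / (2 * (1 + κ)))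
    (hi := fun κ => (I * (2 * (1 + κ) * L + κ) + κ) / 2) ?_ ?_ ?_ ?_ fun κ hκ hκ1 => ?_
  · exact ContinuousAt.div (by fun_prop) (by fun_prop) (by norm_num)
  · fun_prop
  · field_simp; ring
  · ring
  let ψ : ContDiffBump (0 : ℝ) := ⟨1, 1 + κ, one_pos, by linarith⟩
  obtain ⟨δ₁, hδ₁, hcomp⟩ := exists_comparison hs i₀ hν hν0 (φ := φ) (ψ := ψ) φ.contDiff
    φ.hasCompactSupport ψ.contDiff ψ.hasCompactSupport (ε := κ / 3 ^ (s - 3)) (by positivity)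
  have hs0 : 0 < s := by omega
  obtain ⟨δ, ⟨hsh1, hsh2⟩, hδ0, hδδ⟩ := ((eventually_shell hs0 hν0 hν1 ψ.rIn_pos hκ).and
    (eventually_shell hs0 hν0 hν1 ψ.rOut_pos hκ)).and
      (Ioo_mem_nhdsGT hδ₁ : ∀ᶠ δ in 𝓝[>] 0, 0 < δ ∧ δ < δ₁) |>.exists
  filter_upwards [hsh1, hsh2, tendsto_boxSize.eventually hcomp, eventually_ge_atTop 1,
    eventually_ge_atTop (1 / δ)] with τ h1 h2 h3 hτ1 hτδ
  have hτ : 0 < τ := by linarith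
  set T : ℝ := τ ^ ((s : ℝ) / 3 - 1) with hT
  have hT0 : 0 < T := by positivity
  have hTτ : τ ^ ((s : ℝ) / 3) = T * τ := by
    rw [hT, ← Real.rpow_add_one hτ.ne']; congr 1; ring
  set X := ∑ k ∈ Fintype.piFinset (fun _ : Fin s => Finset.range (boxSize τ)),
      φ (cubeForm ν k - τ) with hX
  set Y := ∑ k ∈ Fintype.piFinset (fun _ : Fin s => Finset.range (boxSize τ)),
      ψ ((cubeForm ν k - τ) / (δ * τ)) with hY
  have hX0 : 0 ≤ X := Finset.sum_nonneg fun k _ => φ.nonneg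
  rw [hTτ] at h1 h2
  have hD : 0 < δ * (T * τ) := by positivity
  have h4 : Y / (δ * (T * τ)) ≤ 2 * (1 + κ) * L + κ := by
    have h5 := (div_le_div_iff_of_pos_right hD).2 (sum_bump_le_shell ν (boxSize τ) ψ hδ0 hτ)
    have h6 := (abs_lt.1 h2).2
    change _ - 2 * (1 + κ) * L < κ at h6
    linarith
  have h5 : 2 * L - κ ≤ Y / (δ * (T * τ)) := by
    have h5 := (div_le_div_iff_of_pos_right hD).2 (shell_le_sum_bump ν (boxSize τ) ψ hδ0 hτ)
    have h6 := (abs_lt.1 h1).1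
    change -κ < _ - 2 * 1 * L at h6
    linarith
  have h6 := h3 (δ * τ) (by rwa [div_le_iff₀' hδ0] at hτδ) (by
    have := le_boxSize_pow hτ.le
    gcongr
    linarith) τ
  have h7 : |(∫ x, ψ x) * (X / T) - I * (Y / (δ * (T * τ)))| ≤ κ := by
    rw [show (∫ x, ψ x) * (X / T) - I * (Y / (δ * (T * τ))) =
      ((∫ x, ψ x) * X - I * ((δ * τ)⁻¹ * Y)) / T by field_simp, abs_div, abs_of_pos hT0,
      div_le_iff₀ hT0]
    refine h6.trans ?_
    have := boxSize_pow_le (s := s) (by omega) hτ1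
    calc _ ≤ κ / 3 ^ (s - 3) * (3 ^ (s - 3) * T) := by gcongr
      _ = _ := by field_simp
  have h8 : 2 * 1 ≤ ∫ x, ψ x := two_mul_rIn_le_integral ψ
  have h9 : ∫ x, ψ x ≤ 2 * (1 + κ) := integral_le_two_mul_rOut ψ
  obtain ⟨h10, h11⟩ := abs_le.1 h7
  have hXT : 0 ≤ X / T := by positivity
  constructor
  · rw [div_le_iff₀ (by positivity)]
    have := mul_le_mul_of_nonneg_left h5 hI0
    have := mul_le_mul_of_nonneg_right h9 hXT
    linarith
  · rw [le_div_iff₀ zero_lt_two]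
    have := mul_le_mul_of_nonneg_left h4 hI0
    have := mul_le_mul_of_nonneg_right h8 hXT
    linarith

/-- The asymptotic formula for vectors of natural numbers in a box. -/
theorem tendsto_box_count {s : ℕ} (hs : 11 ≤ s) (i₀ : Fin s) {ν : Fin s → ℝ}
    (hν : Irrational (ν i₀)) (hν0 : ∀ i, 0 ≤ ν i) (hν1 : ∀ i, ν i ≤ 1) {η : ℝ} (hη : 0 < η) :
    Tendsto (fun τ : ℝ => (((Fintype.piFinset (fun _ : Fin s => Finset.range (boxSize τ))).filter
      fun k => |cubeForm ν k - τ| < η).card : ℝ) / τ ^ ((s : ℝ) / 3 - 1)) atTop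
      (𝓝 (2 * η * (orthantVol s * ((s : ℝ) / 3)))) := by
  set L : ℝ := orthantVol s * ((s : ℝ) / 3) with hL
  have hL0 : 0 ≤ L := mul_nonneg (orthantVol_pos s).le (by positivity)
  refine tendsto_of_eventually_bounds (lo := fun κ => 2 * (η * (1 - κ)) * L - κ)
    (hi := fun κ => 2 * (η * (1 + κ)) * L + κ) (by fun_prop) (by fun_prop) (by simp) (by simp)
    fun κ hκ hκ1 => ?_
  let φ : ContDiffBump (0 : ℝ) := ⟨η * (1 - κ), η, mul_pos hη (by linarith), by nlinarith⟩
  let ψ : ContDiffBump (0 : ℝ) := ⟨η, η * (1 + κ), hη, by nlinarith⟩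
  have hφ : 2 * (η * (1 - κ)) ≤ ∫ x, φ x := two_mul_rIn_le_integral φ
  have hψ : ∫ x, ψ x ≤ 2 * (η * (1 + κ)) := integral_le_two_mul_rOut ψ
  have hφL := mul_le_mul_of_nonneg_right hφ hL0
  have hψL := mul_le_mul_of_nonneg_right hψ hL0
  filter_upwards [(tendsto_smooth_count hs i₀ hν hν0 hν1 φ).eventually_const_lt
      (show 2 * (η * (1 - κ)) * L - κ < (∫ x, φ x) * L by linarith),
    (tendsto_smooth_count hs i₀ hν hν0 hν1 ψ).eventually_lt_const
      (show (∫ x, ψ x) * L < 2 * (η * (1 + κ)) * L + κ by linarith),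
    eventually_gt_atTop 0] with τ h1 h2 hτ
  constructor
  · refine h1.le.trans ?_
    rw [Finset.natCast_card_filter]
    gcongr with k
    split_ifs with h
    · exact φ.le_one
    · exact (φ.zero_of_le_dist (by simpa [φ] using h)).le
  · refine le_trans ?_ h2.le
    rw [Finset.natCast_card_filter]
    gcongr with k
    split_ifs with h
    · exact (ψ.one_of_mem_closedBall (by simpa [ψ] using h.le)).ge
    · exact ψ.nonneg

/-- Integer vectors above `μ` correspond to vectors of natural numbers, up to a translation. -/
lemma card_int_eq_card_box {s : ℕ} (μ : Fin s → ℝ) {η τ : ℝ} (hη : η ≤ τ) (hτ : 0 < τ) :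
    Nat.card {x : Fin s → ℤ // (∀ i, μ i < (x i : ℝ)) ∧
      |(∑ i, ((x i : ℝ) - μ i) ^ 3) - τ| < η} =
    ((Fintype.piFinset (fun _ : Fin s => Finset.range (boxSize τ))).filter
      fun k => |cubeForm (fun i => ⌊μ i⌋ + 1 - μ i) k - τ| < η).card := by
  set ν : Fin s → ℝ := fun i => ⌊μ i⌋ + 1 - μ i with hν
  have hν0 : ∀ i, 0 < ν i := fun i => by linarith [Int.lt_floor_add_one (μ i)]
  have hform : ∀ k : Fin s → ℕ,
      ∑ i, ((((⌊μ i⌋ + 1 + k i : ℤ)) : ℝ) - μ i) ^ 3 = cubeForm ν k := by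
    intro k
    refine Finset.sum_congr rfl fun i _ => ?_
    rw [hν]
    push_cast
    ring
  rw [← Nat.card_eq_finsetCard]
  symm
  refine Nat.card_eq_of_bijective (fun k => ⟨fun i => ⌊μ i⌋ + 1 + (k.1 i : ℤ), fun i => ?_, ?_⟩)
    ⟨?_, ?_⟩
  · have := hν0 i
    simp only [hν] at this
    push_cast
    have := Nat.cast_nonneg (α := ℝ) (k.1 i)
    linarith
  · rw [hform]
    exact (Finset.mem_filter.1 k.2).2
  · rintro ⟨k, hk⟩ ⟨l, hl⟩ h
    simp only [Subtype.mk.injEq] at h ⊢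
    funext i
    simpa using congrFun h i
  · rintro ⟨x, hx, hxτ⟩
    have hx1 : ∀ i, ⌊μ i⌋ + 1 + ((x i - (⌊μ i⌋ + 1)).toNat : ℤ) = x i := by
      intro i
      have := Int.floor_lt.2 (hx i)
      omega
    have h1 : |cubeForm ν (fun i => (x i - (⌊μ i⌋ + 1)).toNat) - τ| < η := by
      rw [← hform]
      simpa only [hx1] using hxτ
    refine ⟨⟨fun i => (x i - (⌊μ i⌋ + 1)).toNat, Finset.mem_filter.2 ⟨?_, h1⟩⟩, ?_⟩
    · refine mem_box_of_cubeForm_lt (fun i => (hν0 i).le) (lt_of_lt_of_le ?_ (le_boxSize_pow hτ.le))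
      linarith [(abs_lt.1 h1).2]
    · exact Subtype.ext (funext hx1)

end ShiftedCubes

/-- **Asymptotic formula.**
If `s ≥ 11`, `μ₁` is irrational and `η > 0`, then the number `N(τ)` of
integral solutions `x` with `xᵢ > μᵢ` and `|F(x) - τ| < η` satisfies
`N(τ) ∼ 2η Γ(4/3)^s Γ(s/3)⁻¹ τ^{s/3 - 1}` as `τ → ∞`. -/
theorem sums_of_shifted_cubes_asymptotic
    (s : ℕ) (hs : 11 ≤ s) (μ : Fin s → ℝ)
    (hμ : Irrational (μ ⟨0, by omega⟩))
    (η : ℝ) (hη : 0 < η) :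
    Filter.Tendsto
      (fun τ : ℝ =>
        (Nat.card {x : Fin s → ℤ // (∀ i, μ i < (x i : ℝ)) ∧
            |(∑ i, ((x i : ℝ) - μ i) ^ 3) - τ| < η} : ℝ) /
          (2 * η * Real.Gamma (4/3) ^ s * (Real.Gamma ((s : ℝ)/3))⁻¹ *
            τ ^ ((s : ℝ)/3 - 1)))
      Filter.atTop (nhds 1) := by
  have hs0 : (0 : ℝ) < (s : ℝ) / 3 := by
    have : (11 : ℝ) ≤ s := by exact_mod_cast hs
    linarith
  have hG := Real.Gamma_pos_of_pos hs0
  have hG' : 0 < Real.Gamma (4 / 3) := Real.Gamma_pos_of_pos (by norm_num)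
  have hL : ShiftedCubes.orthantVol s * ((s : ℝ) / 3) =
      Real.Gamma (4 / 3) ^ s * (Real.Gamma ((s : ℝ) / 3))⁻¹ := by
    rw [ShiftedCubes.orthantVol, Real.Gamma_add_one hs0.ne']
    field_simp
  have hν : Irrational ((⌊μ ⟨0, by omega⟩⌋ : ℝ) + 1 - μ ⟨0, by omega⟩) := by
    have := hμ.intCast_sub (⌊μ ⟨0, by omega⟩⌋ + 1)
    push_cast at this
    exact this
  have h := ShiftedCubes.tendsto_box_count hs ⟨0, by omega⟩ (ν := fun i => ⌊μ i⌋ + 1 - μ i) hν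
    (fun i => by linarith [Int.lt_floor_add_one (μ i)])
    (fun i => by linarith [Int.floor_le (μ i)]) hη
  rw [hL] at h
  have hc : 2 * η * (Real.Gamma (4 / 3) ^ s * (Real.Gamma ((s : ℝ) / 3))⁻¹) ≠ 0 := by positivity
  have h1 := h.div_const (2 * η * (Real.Gamma (4 / 3) ^ s * (Real.Gamma ((s : ℝ) / 3))⁻¹))
  rw [div_self hc] at h1
  refine h1.congr' ?_
  filter_upwards [Filter.eventually_ge_atTop η] with τ hτ
  rw [ShiftedCubes.card_int_eq_card_box μ hτ (hη.trans_le hτ), div_div]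
  congr 1
  ring
end

section
/- Let η > 0, let μ₁ and μ₂ be real numbers, and let ε > 0. Then there exists a constant C > 0 such that for every real P ≥ 2, the number S₄ of integer quadruples (x₁, y₁, x₂, y₂) with P < x₁, y₁ ≤ 2P, P^{5/6} < x₂, y₂ ≤ 2P^{5/6}, and |(x₁ − μ₁)³ − (y₁ − μ₁)³ + (x₂ − μ₂)³ − (y₂ − μ₂)³| < η satisfies S₄ ≤ C P^{11/6 + ε}. -/
/-- The divisor bound: `d(n) = O(n ^ ε)`. -/
theorem Nat.exists_card_divisors_le_rpow (ε : ℝ) (hε : 0 < ε) :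
    ∃ C : ℝ, 0 < C ∧ ∀ n : ℕ, n ≠ 0 → (n.divisors.card : ℝ) ≤ C * (n : ℝ) ^ ε := by
  obtain ⟨N, hN⟩ := exists_nat_ge ((2 : ℝ) ^ (1 / ε))
  have hlog : 0 < ε * Real.log 2 := mul_pos hε (Real.log_pos one_lt_two)
  set K : ℝ := 1 + 1 / (ε * Real.log 2) with hKdef
  have hK : 1 ≤ K := by rw [hKdef]; have := one_div_pos.2 hlog; linarith
  have hprime (p a : ℕ) (hp : p.Prime) :
      ((a + 1 : ℕ) : ℝ) ≤ (if p < N then K else 1) * ((p ^ a : ℕ) : ℝ) ^ ε := by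
    have h2p : (2 : ℝ) ≤ p := by exact_mod_cast hp.two_le
    have hpow : ((p ^ a : ℕ) : ℝ) ^ ε = ((p : ℝ) ^ ε) ^ a := by
      rw [Nat.cast_pow, ← Real.rpow_natCast, ← Real.rpow_natCast, ← Real.rpow_mul (by positivity),
        ← Real.rpow_mul (by positivity), mul_comm]
    rw [hpow]
    split_ifs with h
    · have hexp : 1 + ε * Real.log 2 ≤ (2 : ℝ) ^ ε := by
        rw [Real.rpow_def_of_pos two_pos, mul_comm, add_comm]
        exact Real.add_one_le_exp _
      have hb : 1 + (a : ℝ) * (ε * Real.log 2) ≤ ((p : ℝ) ^ ε) ^ a := by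
        refine (one_add_mul_le_pow (by linarith) a).trans ?_
        gcongr
        exact hexp.trans (Real.rpow_le_rpow (by norm_num) h2p hε.le)
      calc ((a + 1 : ℕ) : ℝ) ≤ K * (1 + (a : ℝ) * (ε * Real.log 2)) := by
            have h1 : K * (1 + (a : ℝ) * (ε * Real.log 2)) =
                1 + a + (a * (ε * Real.log 2) + 1 / (ε * Real.log 2)) := by
              rw [hKdef]; field_simp; ring
            rw [h1]; push_cast
            have : 0 ≤ a * (ε * Real.log 2) + 1 / (ε * Real.log 2) := by positivity
            linarith
        _ ≤ _ := by gcongr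
    · have h2 : (2 : ℝ) ≤ (p : ℝ) ^ ε := by
        have hNp : (N : ℝ) ≤ p := by exact_mod_cast not_lt.1 h
        calc (2 : ℝ) = ((2 : ℝ) ^ (1 / ε)) ^ ε := by
              rw [← Real.rpow_mul (by norm_num), one_div_mul_cancel hε.ne', Real.rpow_one]
          _ ≤ _ := Real.rpow_le_rpow (by positivity) (hN.trans hNp) hε.le
      rw [one_mul]
      calc ((a + 1 : ℕ) : ℝ) ≤ (2 : ℝ) ^ a := by exact_mod_cast Nat.lt_two_pow_self
        _ ≤ _ := by gcongr
  refine ⟨K ^ N, by positivity, fun n hn ↦ ?_⟩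
  have hfac : ((n : ℝ)) ^ ε =
      ∏ p ∈ n.primeFactors, ((p ^ n.factorization p : ℕ) : ℝ) ^ ε := by
    rw [Real.finsetProd_rpow _ _ (fun _ _ ↦ by positivity)]
    congr 1
    exact_mod_cast (Nat.prod_factorization_pow_eq_self hn).symm
  rw [Nat.card_divisors hn, Nat.cast_prod]
  calc _ ≤ ∏ p ∈ n.primeFactors,
        ((if p < N then K else 1) * ((p ^ n.factorization p : ℕ) : ℝ) ^ ε) :=
        Finset.prod_le_prod (fun _ _ ↦ by positivity)
          fun p hp ↦ hprime p _ (Nat.prime_of_mem_primeFactors hp)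
    _ = (∏ p ∈ n.primeFactors, if p < N then K else 1) * (n : ℝ) ^ ε := by
        rw [Finset.prod_mul_distrib, hfac]
    _ ≤ _ := by
        gcongr
        rw [Finset.prod_ite, Finset.prod_const, Finset.prod_const_one, mul_one]
        refine pow_le_pow_right₀ hK ?_
        calc _ ≤ (Finset.range N).card := Finset.card_le_card fun p hp ↦ by
              simpa using (Finset.mem_filter.1 hp).2
          _ = N := Finset.card_range N

theorem Finset.card_le_of_sub_le (s : Finset ℤ) (D : ℝ) (hD : 0 ≤ D)
    (h : ∀ a ∈ s, ∀ b ∈ s, a ≤ b → ((b : ℝ) - a) ≤ D) : (s.card : ℝ) ≤ D + 1 := by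
  rcases s.eq_empty_or_nonempty with rfl | hs
  · simpa using by linarith
  have hsub : s ⊆ Finset.Icc (s.min' hs) (s.max' hs) := fun x hx ↦
    Finset.mem_Icc.2 ⟨s.min'_le x hx, s.le_max' x hx⟩
  have hle := s.min'_le_max' hs
  have hcard : ((s.card : ℕ) : ℤ) ≤ s.max' hs + 1 - s.min' hs := by
    have := Finset.card_le_card hsub
    rw [Int.card_Icc] at this
    omega
  have := h _ (s.min'_mem hs) _ (s.max'_mem hs) hle
  have hcard' : ((s.card : ℕ) : ℝ) ≤ s.max' hs + 1 - s.min' hs := by exact_mod_cast hcard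
  linarith

theorem card_filter_cube_le (Z : Finset ℤ) (μ κ L : ℝ) (hL : 0 ≤ L) :
    ((Z.filter fun z : ℤ ↦ |((z : ℝ) - μ) ^ 3 - κ| < L).card : ℝ) ≤ 8 * L + 2 := by
  refine (Finset.card_le_of_sub_le _ (8 * L + 1) (by linarith) fun a ha b hb hab ↦ ?_).trans
    (by linarith)
  have ha := abs_lt.1 (Finset.mem_filter.1 ha).2
  have hb := abs_lt.1 (Finset.mem_filter.1 hb).2
  have hab : (a : ℝ) ≤ b := by exact_mod_cast hab
  by_contra! hcon
  set t : ℝ := b - a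
  have hb' : (b : ℝ) - μ = (a - μ) + t := by simp only [t]; ring
  have ht : 0 < t := by linarith
  have h3 : t ≤ t ^ 3 := le_self_pow₀ (by linarith) (by norm_num)
  rw [hb'] at hb
  nlinarith [mul_nonneg ht.le (sq_nonneg (2 * ((a : ℝ) - μ) + t))]

theorem card_filter_linear_le (X : Finset ℤ) (a κ L : ℝ) (ha : 1 ≤ |a|) (hL : 0 ≤ L) :
    ((X.filter fun x : ℤ ↦ |a * x - κ| < L).card : ℝ) ≤ 2 * L + 1 := by
  refine Finset.card_le_of_sub_le _ (2 * L) (by linarith) fun x hx y hy hxy ↦ ?_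
  have hx := abs_lt.1 (Finset.mem_filter.1 hx).2
  have hy := abs_lt.1 (Finset.mem_filter.1 hy).2
  have hxy : (x : ℝ) ≤ y := by exact_mod_cast hxy
  calc (y : ℝ) - x ≤ |a| * (y - x) := le_mul_of_one_le_left (by linarith) ha
    _ = |a * (y - x)| := by rw [abs_mul, abs_of_nonneg (sub_nonneg.2 hxy)]
    _ ≤ 2 * L := abs_le.2 ⟨by linarith, by linarith⟩

theorem Finset.card_filter_dvd_le (A : Finset ℤ) (M : ℤ) (hM : M ≠ 0) :
    (A.filter (· ∣ M)).card ≤ 2 * M.natAbs.divisors.card := by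
  have hsub : A.filter (· ∣ M) ⊆ M.natAbs.divisors.image (fun d : ℕ ↦ (d : ℤ)) ∪
      M.natAbs.divisors.image (fun d : ℕ ↦ -(d : ℤ)) := by
    intro a ha
    have hd : a.natAbs ∈ M.natAbs.divisors :=
      Nat.mem_divisors.2 ⟨Int.natAbs_dvd_natAbs.2 (Finset.mem_filter.1 ha).2, by simpa using hM⟩
    rw [Finset.mem_union, Finset.mem_image, Finset.mem_image]
    rcases Int.natAbs_eq a with h | h
    · exact .inl ⟨_, hd, h.symm⟩
    · exact .inr ⟨_, hd, h.symm⟩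
  calc _ ≤ _ := Finset.card_le_card hsub
    _ ≤ _ := Finset.card_union_le _ _
    _ ≤ _ := by
      have h1 := Finset.card_image_le (s := M.natAbs.divisors) (f := fun d : ℕ ↦ (d : ℤ))
      have h2 := Finset.card_image_le (s := M.natAbs.divisors) (f := fun d : ℕ ↦ -(d : ℤ))
      omega

/-- The Cauchy-Schwarz inequality for counting related pairs. -/
theorem Finset.sq_card_filter_product_le {α β : Type*} (s : Finset α) (t : Finset β)
    (r : α → β → Prop) [∀ a, DecidablePred (r a)] :
    ((s ×ˢ t).filter fun p ↦ r p.1 p.2).card ^ 2 ≤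
      s.card * ((s ×ˢ t ×ˢ t).filter fun p ↦ r p.1 p.2.1 ∧ r p.1 p.2.2).card := by
  have h1 : ((s ×ˢ t).filter fun p ↦ r p.1 p.2).card = ∑ a ∈ s, (t.filter (r a)).card := by
    simp_rw [Finset.card_filter, Finset.sum_product]
  have h2 : ((s ×ˢ t ×ˢ t).filter fun p ↦ r p.1 p.2.1 ∧ r p.1 p.2.2).card =
      ∑ a ∈ s, (t.filter (r a)).card ^ 2 := by
    rw [Finset.card_filter, Finset.sum_product]
    refine Finset.sum_congr rfl fun a _ ↦ ?_
    rw [← Finset.card_filter, sq, ← Finset.card_product, ← Finset.filter_product]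
  rw [h1, h2]
  exact sq_sum_le_card_mul_sum_sq

/-- A relation has at most as many pairs as the average of the two collision relations it induces. -/
theorem Finset.two_mul_card_filter_product_le {α β : Type*} (s : Finset α) (t : Finset β)
    (r : α → β → Prop) (u : α → α → Prop) (v : β → β → Prop)
    [∀ a, DecidablePred (r a)] [∀ a, DecidablePred (u a)] [∀ b, DecidablePred (v b)]
    (hu : ∀ a a' b, r a b → r a' b → u a a') (hv : ∀ a b b', r a b → r a b' → v b b') :
    2 * ((s ×ˢ t).filter fun p ↦ r p.1 p.2).card ≤
      ((s ×ˢ s).filter fun p ↦ u p.1 p.2).card + ((t ×ˢ t).filter fun p ↦ v p.1 p.2).card := by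
  set d : α → ℝ := fun a ↦ ((t.filter (r a)).card : ℝ)
  set e : β → ℝ := fun b ↦ ((s.filter fun a ↦ r a b).card : ℝ)
  have hd {a b} (hb : b ∈ t) (h : r a b) : 0 < d a := by
    simp only [d, Nat.cast_pos, Finset.card_pos]
    exact ⟨b, Finset.mem_filter.2 ⟨hb, h⟩⟩
  have he {a b} (ha : a ∈ s) (h : r a b) : 0 < e b := by
    simp only [e, Nat.cast_pos, Finset.card_pos]
    exact ⟨a, Finset.mem_filter.2 ⟨ha, h⟩⟩
  have hdiv (x y : ℝ) (hy : 0 ≤ y) : x * (y / x) ≤ y := by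
    rcases eq_or_ne x 0 with rfl | hx
    · simpa using hy
    · exact (mul_div_cancel₀ y hx).le
  have hcount : (((s ×ˢ t).filter fun p ↦ r p.1 p.2).card : ℝ) =
      ∑ a ∈ s, ∑ b ∈ t, if r a b then (1 : ℝ) else 0 := by
    rw [Finset.card_filter, Finset.sum_product]; push_cast; rfl
  have h1 : ∑ a ∈ s, ∑ b ∈ t, (if r a b then e b / d a else 0) ≤
      (((s ×ˢ s).filter fun p ↦ u p.1 p.2).card : ℝ) := by
    rw [Finset.card_filter, Finset.sum_product]
    push_cast
    refine Finset.sum_le_sum fun a ha ↦ ?_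
    have hN : (∑ a' ∈ s, if u a a' then (1 : ℝ) else 0) = ((s.filter (u a)).card : ℝ) := by
      rw [Finset.card_filter]; push_cast; rfl
    rw [hN]
    calc ∑ b ∈ t, (if r a b then e b / d a else 0)
        ≤ ∑ b ∈ t, (if r a b then ((s.filter (u a)).card : ℝ) / d a else 0) := by
          refine Finset.sum_le_sum fun b _ ↦ ?_
          split_ifs with h
          · gcongr
            exact Nat.cast_le.2 (Finset.card_le_card
              (Finset.monotone_filter_right _ fun a' _ h' ↦ hu _ _ _ h h'))
          · rfl
      _ = d a * (((s.filter (u a)).card : ℝ) / d a) := by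
          rw [← Finset.sum_filter, Finset.sum_const, nsmul_eq_mul]
      _ ≤ _ := hdiv _ _ (by positivity)
  have h2 : ∑ a ∈ s, ∑ b ∈ t, (if r a b then d a / e b else 0) ≤
      (((t ×ˢ t).filter fun p ↦ v p.1 p.2).card : ℝ) := by
    rw [Finset.card_filter, Finset.sum_product, Finset.sum_comm]
    push_cast
    refine Finset.sum_le_sum fun b hb ↦ ?_
    have hN : (∑ b' ∈ t, if v b b' then (1 : ℝ) else 0) = ((t.filter (v b)).card : ℝ) := by
      rw [Finset.card_filter]; push_cast; rfl
    rw [hN]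
    calc ∑ a ∈ s, (if r a b then d a / e b else 0)
        ≤ ∑ a ∈ s, (if r a b then ((t.filter (v b)).card : ℝ) / e b else 0) := by
          refine Finset.sum_le_sum fun a _ ↦ ?_
          split_ifs with h
          · gcongr
            exact Nat.cast_le.2 (Finset.card_le_card
              (Finset.monotone_filter_right _ fun b' _ h' ↦ hv _ _ _ h h'))
          · rfl
      _ = e b * (((t.filter (v b)).card : ℝ) / e b) := by
          rw [← Finset.sum_filter, Finset.sum_const, nsmul_eq_mul]
      _ ≤ _ := hdiv _ _ (by positivity)
  have h3 : 2 * (((s ×ˢ t).filter fun p ↦ r p.1 p.2).card : ℝ) ≤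
      ∑ a ∈ s, ∑ b ∈ t, (if r a b then e b / d a else 0) +
        ∑ a ∈ s, ∑ b ∈ t, (if r a b then d a / e b else 0) := by
    rw [hcount, Finset.mul_sum, ← Finset.sum_add_distrib]
    refine Finset.sum_le_sum fun a ha ↦ ?_
    rw [Finset.mul_sum, ← Finset.sum_add_distrib]
    refine Finset.sum_le_sum fun b hb ↦ ?_
    split_ifs with h
    · have hda := hd hb h
      have heb := he ha h
      rw [div_add_div _ _ hda.ne' heb.ne', le_div_iff₀ (by positivity)]
      nlinarith [sq_nonneg (d a - e b)]
    · norm_num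
  exact_mod_cast h3.trans (add_le_add h1 h2)

theorem Finset.card_filter_product_le_mul {α β : Type*} (s : Finset α) (t : Finset β)
    (r : α → β → Prop) [∀ a, DecidablePred (r a)] (K : ℕ)
    (h : ∀ a ∈ s, (t.filter (r a)).card ≤ K) :
    ((s ×ˢ t).filter fun p ↦ r p.1 p.2).card ≤ s.card * K := by
  rw [Finset.card_filter, Finset.sum_product, ← smul_eq_mul]
  refine Finset.sum_le_card_nsmul _ _ _ fun a ha ↦ ?_
  simpa only [Finset.card_filter] using h a ha

open Classical in
/-- For `h j ≠ 0`, counts the pairs `(z, z')` with `c z - c z'` near a multiple of `3 h j`,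
on average over `h` and `j`. The nonzero multiples are handled by the divisor bound. -/
theorem card_near_multiple_le (A J Z : Finset ℤ) (c : ℤ → ℝ) (η : ℝ) (hη : 0 < η) (K D : ℕ)
    (hA : 0 ∉ A) (hJ : 0 ∉ J)
    (hK : ∀ κ, (Z.filter fun z ↦ |c z - κ| < 4 * η).card ≤ K) (hKη : 8 * η + 1 ≤ K)
    (hD : ∀ M : ℤ, M ≠ 0 → (∃ z ∈ Z, ∃ z' ∈ Z, |(M : ℝ) + (c z - c z')| < 4 * η) →
      M.natAbs.divisors.card ≤ D) :
    (((A ×ˢ J) ×ˢ (Z ×ˢ Z)).filter fun p ↦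
        ∃ m : ℤ, |3 * (p.1.1 : ℝ) * p.1.2 * m + (c p.2.1 - c p.2.2)| < 4 * η).card ≤
      (A.card * J.card) * (Z.card * K) + (Z.card * Z.card) * (K * ((2 * D) * (2 * D))) := by
  set S₀ := (A ×ˢ J) ×ˢ ((Z ×ˢ Z).filter fun p ↦ |c p.2 - c p.1| < 4 * η)
  set Q : ℤ × ℤ → ℤ × ℤ → Prop := fun q p ↦ ∃ M : ℤ, M ≠ 0 ∧ p.1 ∣ M ∧ p.2 ∣ M ∧
    |(M : ℝ) + (c q.1 - c q.2)| < 4 * η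
  set S₁ := ((Z ×ˢ Z) ×ˢ (A ×ˢ J)).filter fun p ↦ Q p.1 p.2
  have hS₀ : S₀.card ≤ (A.card * J.card) * (Z.card * K) := by
    rw [Finset.card_product, Finset.card_product]
    gcongr
    exact Finset.card_filter_product_le_mul Z Z (fun z z' ↦ |c z' - c z| < 4 * η) K fun z _ ↦ hK _
  have hS₁ : S₁.card ≤ (Z.card * Z.card) * (K * ((2 * D) * (2 * D))) := by
    rw [← Finset.card_product Z Z]
    refine Finset.card_filter_product_le_mul _ _ Q _ fun q hq ↦ ?_
    obtain ⟨hq1, hq2⟩ := Finset.mem_product.1 hq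
    set κ := c q.1 - c q.2
    set Ms : Finset ℤ := (Finset.Icc ⌈-κ - 4 * η⌉ ⌊-κ + 4 * η⌋).filter
      fun M ↦ |(1 : ℝ) * M - (-κ)| < 4 * η
    have hMs : Ms.card ≤ K := by
      have := card_filter_linear_le (Finset.Icc ⌈-κ - 4 * η⌉ ⌊-κ + 4 * η⌋) 1 (-κ) (4 * η)
        (by simp) (by positivity)
      exact Nat.cast_le.1 (this.trans (by linarith : 2 * (4 * η) + 1 ≤ (K : ℝ)))
    have hsub : (A ×ˢ J).filter (Q q) ⊆ (Ms.filter (· ≠ 0)).biUnion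
        fun M ↦ A.filter (· ∣ M) ×ˢ J.filter (· ∣ M) := by
      intro p hp
      obtain ⟨hp, M, hM, h1, h2, hlt⟩ := Finset.mem_filter.1 hp
      obtain ⟨hp1, hp2⟩ := Finset.mem_product.1 hp
      have habs := abs_lt.1 hlt
      refine Finset.mem_biUnion.2 ⟨M, ?_, ?_⟩
      · refine Finset.mem_filter.2 ⟨Finset.mem_filter.2 ⟨Finset.mem_Icc.2
          ⟨Int.ceil_le.2 (by linarith), Int.le_floor.2 (by linarith)⟩, ?_⟩, hM⟩
        rwa [one_mul, sub_neg_eq_add]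
      · simp [hp1, hp2, h1, h2]
    calc _ ≤ _ := Finset.card_le_card hsub
      _ ≤ (Ms.filter (· ≠ 0)).card * ((2 * D) * (2 * D)) := by
        refine Finset.card_biUnion_le_card_mul _ _ _ fun M hM ↦ ?_
        obtain ⟨hM, hM0⟩ := Finset.mem_filter.1 hM
        have hlt := (Finset.mem_filter.1 hM).2
        rw [one_mul, sub_neg_eq_add] at hlt
        have hDM := hD M hM0 ⟨_, hq1, _, hq2, hlt⟩
        rw [Finset.card_product]
        gcongr
        · exact (Finset.card_filter_dvd_le A M hM0).trans (by gcongr)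
        · exact (Finset.card_filter_dvd_le J M hM0).trans (by gcongr)
      _ ≤ _ := by
        gcongr
        exact (Finset.card_filter_le _ _).trans hMs
  refine le_trans (le_trans ?_ (Finset.card_union_le S₀ (S₁.image Prod.swap)))
    (add_le_add hS₀ (Finset.card_image_le.trans hS₁))
  refine Finset.card_le_card fun p hp ↦ ?_
  obtain ⟨hp, m, hm⟩ := Finset.mem_filter.1 hp
  obtain ⟨hp1, hp2⟩ := Finset.mem_product.1 hp
  have hp11 := (Finset.mem_product.1 hp1).1
  have hp12 := (Finset.mem_product.1 hp1).2
  rw [Finset.mem_union]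
  rcases eq_or_ne m 0 with rfl | hm0
  · left
    refine Finset.mem_product.2 ⟨hp1, Finset.mem_filter.2 ⟨hp2, ?_⟩⟩
    rw [abs_sub_comm]
    simpa using hm
  · right
    refine Finset.mem_image.2 ⟨p.swap, Finset.mem_filter.2 ⟨Finset.mem_product.2 ⟨hp2, hp1⟩,
      3 * p.1.1 * p.1.2 * m, ?_, ?_, ?_, ?_⟩, Prod.swap_swap p⟩
    · have h1 : p.1.1 ≠ 0 := fun h ↦ hA (h ▸ hp11)
      have h2 : p.1.2 ≠ 0 := fun h ↦ hJ (h ▸ hp12)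
      positivity
    · exact ⟨3 * p.1.2 * m, by simp only [Prod.snd_swap]; ring⟩
    · exact ⟨3 * p.1.1 * m, by simp only [Prod.snd_swap]; ring⟩
    · push_cast
      exact hm

open Classical in
/-- Differencing twice in the large variable: pairs `(z, z')` for which the second difference
`3 h j (2 y + j + h - 2 μ)` is near `c z' - c z`. -/
theorem card_second_difference_le (A J Z : Finset ℤ) (c : ℤ → ℝ) (μ η : ℝ) (hη : 0 < η)
    (K D : ℕ) (hA : 0 ∉ A) (hJ : 0 ∉ J)
    (hK : ∀ κ, (Z.filter fun z ↦ |c z - κ| < 4 * η).card ≤ K) (hKη : 8 * η + 1 ≤ K)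
    (hD : ∀ M : ℤ, M ≠ 0 → (∃ z ∈ Z, ∃ z' ∈ Z, |(M : ℝ) + (c z - c z')| < 4 * η) →
      M.natAbs.divisors.card ≤ D) :
    (((A ×ˢ J) ×ˢ (Z ×ˢ Z)).filter fun p ↦ ∃ y : ℤ,
        |3 * (p.1.1 : ℝ) * p.1.2 * (2 * y + p.1.2 + p.1.1 - 2 * μ) + (c p.2.1 - c p.2.2)|
          < 2 * η).card ≤
      (A.card * J.card) * (Z.card * K) + (Z.card * Z.card) * (K * ((2 * D) * (2 * D))) := by
  refine le_trans ?_ (card_near_multiple_le A J Z c η hη K D hA hJ hK hKη hD)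
  rw [Finset.card_filter, Finset.card_filter, Finset.sum_product (A ×ˢ J) (Z ×ˢ Z),
    Finset.sum_product (A ×ˢ J) (Z ×ˢ Z)]
  refine Finset.sum_le_sum fun q _ ↦ ?_
  rw [← Finset.card_filter, ← Finset.card_filter]
  set T : ℤ → ℤ → Prop := fun z z' ↦ ∃ m : ℤ, |3 * (q.1 : ℝ) * q.2 * m + (c z - c z')| < 4 * η
  have := Finset.two_mul_card_filter_product_le Z Z
    (fun z z' ↦ ∃ y : ℤ,
      |3 * (q.1 : ℝ) * q.2 * (2 * y + q.2 + q.1 - 2 * μ) + (c z - c z')| < 2 * η) T T ?_ ?_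
  · rw [← two_mul] at this
    exact Nat.le_of_mul_le_mul_left this two_pos
  · rintro a a' b ⟨y, hy⟩ ⟨y', hy'⟩
    refine ⟨2 * (y - y'), ?_⟩
    push_cast
    rw [abs_lt] at *
    constructor <;> linarith
  · rintro a b b' ⟨y, hy⟩ ⟨y', hy'⟩
    refine ⟨2 * (y' - y), ?_⟩
    push_cast
    rw [abs_lt] at *
    constructor <;> linarith

open Classical in
/-- Cauchy-Schwarz over the difference `h` of the large variables and one small variable `w`,
followed by a second differencing. -/
theorem sq_card_difference_le (A J X Z : Finset ℤ) (c : ℤ → ℝ) (μ η : ℝ) (hη : 0 < η)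
    (K D : ℕ) (hA : 0 ∉ A) (hJ : 0 ∉ J) (hXJ : ∀ y ∈ X, ∀ y' ∈ X, y ≠ y' → y - y' ∈ J)
    (hK : ∀ κ, (Z.filter fun z ↦ |c z - κ| < 4 * η).card ≤ K) (hKη : 8 * η + 1 ≤ K)
    (hD : ∀ M : ℤ, M ≠ 0 → (∃ z ∈ Z, ∃ z' ∈ Z, |(M : ℝ) + (c z - c z')| < 4 * η) →
      M.natAbs.divisors.card ≤ D) :
    (((A ×ˢ Z) ×ˢ (X ×ˢ Z)).filter fun p ↦
        |((p.2.1 + p.1.1 : ℤ) - μ) ^ 3 - (p.2.1 - μ) ^ 3 + c p.2.2 - c p.1.2| < η).card ^ 2 ≤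
      A.card * Z.card * (A.card * Z.card * X.card * (K * K) +
        ((A.card * J.card) * (Z.card * K) + (Z.card * Z.card) * (K * ((2 * D) * (2 * D)))) *
          (K * K)) := by
  set r : ℤ × ℤ → ℤ × ℤ → Prop := fun a b ↦
    |((b.1 + a.1 : ℤ) - μ) ^ 3 - (b.1 - μ) ^ 3 + c b.2 - c a.2| < η
  have hK' (κ) : (Z.filter fun z ↦ |c z - κ| < η).card ≤ K :=
    (Finset.card_le_card (Finset.monotone_filter_right _ fun z _ h ↦ h.trans (by linarith))).trans
      (hK κ)
  refine (Finset.sq_card_filter_product_le (A ×ˢ Z) (X ×ˢ Z) r).trans ?_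
  rw [Finset.card_product A Z]
  refine Nat.mul_le_mul_left _ ?_
  set E := ((A ×ˢ Z) ×ˢ (X ×ˢ Z) ×ˢ (X ×ˢ Z)).filter fun p ↦ r p.1 p.2.1 ∧ r p.1 p.2.2
  have hE {p} (hp : p ∈ E) : ((p.1.1 ∈ A ∧ p.1.2 ∈ Z) ∧ (p.2.1.1 ∈ X ∧ p.2.1.2 ∈ Z) ∧
      (p.2.2.1 ∈ X ∧ p.2.2.2 ∈ Z)) ∧ r p.1 p.2.1 ∧ r p.1 p.2.2 := by
    simpa only [E, Finset.mem_filter, Finset.mem_product] using hp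
  rw [← Finset.card_filter_add_card_filter_not (s := E) (fun p ↦ p.2.1.1 = p.2.2.1)]
  refine add_le_add ?_ ?_
  · -- the two large variables coincide
    rw [← Finset.card_product, ← Finset.card_product, mul_comm]
    refine Finset.card_le_mul_card_image_of_maps_to (f := fun p ↦ (p.1, p.2.1.1)) ?_ _ ?_
    · intro p hp
      have := (hE (Finset.mem_filter.1 hp).1).1
      simp [this]
    · rintro ⟨⟨h, w⟩, y⟩ -
      set F := Z.filter fun z ↦ |c z - (c w - (((y + h : ℤ) - μ) ^ 3 - (y - μ) ^ 3))| < η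
      calc _ ≤ (F ×ˢ F).card := by
            refine Finset.card_le_card_of_injOn (fun p ↦ (p.2.1.2, p.2.2.2)) ?_ ?_
            · rintro ⟨⟨h₁, w₁⟩, ⟨y₁, z⟩, ⟨y₂, z'⟩⟩ hp
              simp only [Finset.coe_filter, Finset.mem_filter, Set.mem_ofPred_eq,
                Prod.mk.injEq] at hp
              obtain ⟨⟨hp, hy⟩, ⟨rfl, rfl⟩, rfl⟩ := hp
              obtain ⟨h1, h2, h3⟩ := hE hp
              subst hy
              simp only [r] at h2 h3
              simp only [Finset.coe_product, F, Finset.coe_filter, Set.mem_prod, Set.mem_ofPred_eq]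
              refine ⟨⟨h1.2.1.2, ?_⟩, h1.2.2.2, ?_⟩
              · convert h2 using 2; ring
              · convert h3 using 2; ring
            · rintro ⟨⟨h₁, w₁⟩, ⟨y₁, z⟩, ⟨y₂, z'⟩⟩ hp ⟨⟨h₂, w₂⟩, ⟨y₃, z₂⟩, ⟨y₄, z₂'⟩⟩ hq hpq
              simp only [Finset.coe_filter, Finset.mem_filter, Set.mem_ofPred_eq,
                Prod.mk.injEq] at hp hq hpq ⊢
              grind
        _ ≤ K * K := by
            rw [Finset.card_product]
            exact Nat.mul_le_mul (hK' _) (hK' _)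
  · -- the two large variables differ
    set R : (ℤ × ℤ) × (ℤ × ℤ) → ℤ → Prop := fun p y ↦
      |3 * (p.1.1 : ℝ) * p.1.2 * (2 * y + p.1.2 + p.1.1 - 2 * μ) + (c p.2.1 - c p.2.2)| < 2 * η
    set G' := ((A ×ˢ J) ×ˢ (Z ×ˢ Z)).filter fun p ↦ ∃ y : ℤ, R p y
    have hG' : G'.card ≤ _ := card_second_difference_le A J Z c μ η hη K D hA hJ hK hKη hD
    set G := (G' ×ˢ X).filter fun p ↦ R p.1 p.2
    have hG : G.card ≤ G'.card * K := by
      refine Finset.card_filter_product_le_mul _ _ R K fun p hp ↦ ?_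
      have hp' := (Finset.mem_filter.1 hp).1
      simp only [Finset.mem_product] at hp'
      have hne : p.1.1 * p.1.2 ≠ 0 :=
        mul_ne_zero (fun h ↦ hA (h ▸ hp'.1.1)) fun h ↦ hJ (h ▸ hp'.1.2)
      have habs : (1 : ℝ) ≤ |6 * ((p.1.1 * p.1.2 : ℤ) : ℝ)| := by
        have : (1 : ℝ) ≤ |((p.1.1 * p.1.2 : ℤ) : ℝ)| := by exact_mod_cast Int.one_le_abs hne
        rw [abs_mul, abs_of_pos (by norm_num : (0 : ℝ) < 6)]
        linarith
      have := card_filter_linear_le X _ (-(3 * (p.1.1 : ℝ) * p.1.2 * (p.1.2 + p.1.1 - 2 * μ) +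
        (c p.2.1 - c p.2.2))) (2 * η) habs (by positivity)
      have hKX : ((X.filter (R p)).card : ℝ) ≤ K := by
        refine le_trans (le_of_eq ?_) (this.trans (by linarith))
        congr 2
        refine Finset.filter_congr fun y _ ↦ ?_
        simp only [R]
        push_cast
        ring_nf
      exact_mod_cast hKX
    refine le_trans ?_ ((Nat.mul_le_mul_right K (hG.trans (Nat.mul_le_mul_right K hG'))).trans
      (le_of_eq (by ring)))
    rw [mul_comm]
    refine Finset.card_le_mul_card_image_of_maps_to
      (f := fun p ↦ (((p.1.1, p.2.1.1 - p.2.2.1), (p.2.1.2, p.2.2.2)), p.2.2.1)) ?_ _ ?_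
    · intro p hp
      obtain ⟨hp, hy⟩ := Finset.mem_filter.1 hp
      obtain ⟨h1, h2, h3⟩ := hE hp
      have hR : R ((p.1.1, p.2.1.1 - p.2.2.1), (p.2.1.2, p.2.2.2)) p.2.2.1 := by
        simp only [R, r, abs_lt] at *
        push_cast at *
        constructor <;> linarith
      refine Finset.mem_filter.2 ⟨Finset.mem_product.2 ⟨Finset.mem_filter.2 ⟨?_, _, hR⟩,
        h1.2.2.1⟩, hR⟩
      simp only [Finset.mem_product]
      exact ⟨⟨h1.1.1, hXJ _ h1.2.1.1 _ h1.2.2.1 hy⟩, h1.2.1.2, h1.2.2.2⟩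
    · rintro ⟨⟨⟨h, j⟩, z, z'⟩, y⟩ -
      refine le_trans ?_ (hK' (((y + h : ℤ) - μ) ^ 3 - (y - μ) ^ 3 + c z'))
      refine Finset.card_le_card_of_injOn (fun p ↦ p.1.2) ?_ ?_
      · rintro ⟨⟨h₁, w₁⟩, ⟨y₁, z₁⟩, ⟨y₂, z₂⟩⟩ hp
        simp only [Finset.coe_filter, Finset.mem_filter, Set.mem_ofPred_eq, Prod.mk.injEq] at hp
        obtain ⟨⟨hp, hy⟩, ⟨⟨rfl, -⟩, -, rfl⟩, rfl⟩ := hp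
        obtain ⟨h1, h2, h3⟩ := hE hp
        simp only [Finset.coe_filter, Set.mem_ofPred_eq]
        refine ⟨h1.1.2, ?_⟩
        rw [abs_sub_comm]
        exact h3
      · rintro ⟨⟨h₁, w₁⟩, ⟨y₁, z₁⟩, ⟨y₂, z₂⟩⟩ hp ⟨⟨h₂, w₂⟩, ⟨y₃, z₃⟩, ⟨y₄, z₄⟩⟩ hq hpq
        simp only [Finset.coe_filter, Finset.mem_filter, Set.mem_ofPred_eq,
          Prod.mk.injEq] at hp hq hpq ⊢
        grind

theorem card_Ioc_floor_le (R : ℝ) (hR : 1 ≤ R) :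
    ((Finset.Ioc ⌊R⌋ ⌊2 * R⌋).card : ℝ) ≤ 2 * R := by
  have hle : ⌊R⌋ ≤ ⌊2 * R⌋ := Int.floor_le_floor (by linarith)
  have hcard : (((Finset.Ioc ⌊R⌋ ⌊2 * R⌋).card : ℤ) : ℝ) = ⌊2 * R⌋ - ⌊R⌋ := by
    rw [Int.card_Ioc_of_le _ _ hle]
    push_cast
    rfl
  have h1 := Int.floor_le (2 * R)
  have h2 := Int.lt_floor_add_one R
  rw [Int.cast_natCast] at hcard
  linarith

theorem mem_Ioc_floor {R : ℝ} {x : ℤ} :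
    x ∈ Finset.Ioc ⌊R⌋ ⌊2 * R⌋ ↔ R < x ∧ (x : ℝ) ≤ 2 * R := by
  rw [Finset.mem_Ioc, Int.floor_lt, Int.le_floor]

theorem card_Icc_floor_erase_zero_le (R : ℝ) (hR : 0 ≤ R) :
    (((Finset.Icc (-⌊R⌋) ⌊R⌋).erase 0).card : ℝ) ≤ 2 * R := by
  have h0 : 0 ≤ ⌊R⌋ := Int.floor_nonneg.2 hR
  have hcard : (((Finset.Icc (-⌊R⌋) ⌊R⌋).erase 0).card : ℤ) = 2 * ⌊R⌋ := by
    rw [Finset.card_erase_of_mem (Finset.mem_Icc.2 ⟨by omega, h0⟩), Int.card_Icc]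
    omega
  have hcard' : (((Finset.Icc (-⌊R⌋) ⌊R⌋).erase 0).card : ℝ) = 2 * ⌊R⌋ := by exact_mod_cast hcard
  have := Int.floor_le R
  linarith

theorem mem_Icc_floor_erase_zero {R : ℝ} {x : ℤ} :
    x ∈ (Finset.Icc (-⌊R⌋) ⌊R⌋).erase 0 ↔ x ≠ 0 ∧ |(x : ℝ)| ≤ R := by
  rw [Finset.mem_erase, Finset.mem_Icc, abs_le, neg_le, Int.le_floor, Int.le_floor, Int.cast_neg,
    neg_le]

theorem abs_cube_sub_le (μ p z : ℝ) (hp : 1 ≤ p) (hz : p ^ 5 < z) (hz' : z ≤ 2 * p ^ 5) :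
    |(z - μ) ^ 3| ≤ (2 + |μ|) ^ 3 * p ^ 15 := by
  have hp5 : 1 ≤ p ^ 5 := one_le_pow₀ hp
  have hb : |z - μ| ≤ (2 + |μ|) * p ^ 5 := by
    have h1 := abs_sub z μ
    rw [abs_of_pos (by linarith : 0 < z)] at h1
    nlinarith [abs_nonneg μ]
  calc |(z - μ) ^ 3| = |z - μ| ^ 3 := abs_pow _ _
    _ ≤ ((2 + |μ|) * p ^ 5) ^ 3 := by gcongr
    _ = _ := by ring

/-- The large variables differ by `O(P ^ (1/2))`; here `p = P ^ (1/6)`. -/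
theorem abs_sub_le_of_cubes_close (μ₁ μ₂ η p x y z w : ℝ) (hη : 0 < η) (hp : 1 ≤ p)
    (hx : p ^ 6 < x) (hx' : x ≤ 2 * p ^ 6) (hy : p ^ 6 < y) (hy' : y ≤ 2 * p ^ 6)
    (hz : p ^ 5 < z) (hz' : z ≤ 2 * p ^ 5) (hw : p ^ 5 < w) (hw' : w ≤ 2 * p ^ 5)
    (h : |(x - μ₁) ^ 3 - (y - μ₁) ^ 3 + (z - μ₂) ^ 3 - (w - μ₂) ^ 3| < η) :
    |x - y| ≤ (2 * (η + 2 * (2 + |μ₂|) ^ 3) + 2 * |μ₁|) * p ^ 3 := by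
  have hp3 : 1 ≤ p ^ 3 := one_le_pow₀ hp
  rcases lt_or_ge (p ^ 6) (2 * |μ₁|) with hP | hP
  · have h1 : |x - y| ≤ p ^ 6 := abs_le.2 ⟨by linarith, by linarith⟩
    have h2 : 0 ≤ 2 * (η + 2 * (2 + |μ₂|) ^ 3) := by positivity
    nlinarith [abs_nonneg μ₁]
  · have hcz := abs_cube_sub_le μ₂ p z hp hz hz'
    have hcw := abs_cube_sub_le μ₂ p w hp hw hw'
    set b := (2 + |μ₂|) ^ 3
    have hb : 0 ≤ b := by positivity
    have hp15 : 1 ≤ p ^ 15 := one_le_pow₀ hp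
    have hdiff : |(x - μ₁) ^ 3 - (y - μ₁) ^ 3| ≤ (η + 2 * b) * p ^ 15 := by
      rw [abs_lt] at h
      rw [abs_le] at *
      constructor <;> nlinarith
    have hfac : (x - μ₁) ^ 3 - (y - μ₁) ^ 3 =
        (x - y) * ((x - μ₁) ^ 2 + (x - μ₁) * (y - μ₁) + (y - μ₁) ^ 2) := by ring
    have hX : p ^ 6 / 2 ≤ x - μ₁ := by linarith [le_abs_self μ₁]
    have hY : p ^ 6 / 2 ≤ y - μ₁ := by linarith [le_abs_self μ₁]
    have hp6 : 0 < p ^ 6 := by positivity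
    have hq : p ^ 12 / 2 ≤ (x - μ₁) ^ 2 + (x - μ₁) * (y - μ₁) + (y - μ₁) ^ 2 := by
      have e : p ^ 12 = p ^ 6 * p ^ 6 := by ring
      rw [e]
      nlinarith
    have hp12 : 0 < p ^ 12 := by positivity
    rw [hfac, abs_mul, abs_of_pos (lt_of_lt_of_le (by positivity) hq)] at hdiff
    have h1 : |x - y| * (p ^ 12 / 2) ≤ (η + 2 * b) * p ^ 15 :=
      (mul_le_mul_of_nonneg_left hq (abs_nonneg _)).trans hdiff
    have h2 : |x - y| ≤ 2 * (η + 2 * b) * p ^ 3 := by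
      refine le_of_mul_le_mul_right ?_ hp12
      calc |x - y| * p ^ 12 = 2 * (|x - y| * (p ^ 12 / 2)) := by ring
        _ ≤ 2 * ((η + 2 * b) * p ^ 15) := by gcongr
        _ = _ := by ring
    have h3 : 0 ≤ 2 * |μ₁| * p ^ 3 := by positivity
    linarith

theorem le_of_sq_le_moment_bound (t a j x z K D H L p e : ℝ) (ha0 : 0 ≤ a)
    (hj0 : 0 ≤ j) (hx0 : 0 ≤ x) (hz0 : 0 ≤ z) (hK : 0 ≤ K) (hD0 : 0 ≤ D) (hH : 0 ≤ H)
    (hL : 0 ≤ L)    (hp : 1 ≤ p) (he : 1 ≤ e)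
    (ha : a ≤ 2 * (H * p ^ 3)) (hj : j ≤ 2 * p ^ 6) (hx : x ≤ 2 * p ^ 6) (hz : z ≤ 2 * p ^ 5)
    (hD : D ≤ L * e)
    (h : t ^ 2 ≤ a * z * (a * z * x * (K * K) +
      ((a * j) * (z * K) + (z * z) * (K * ((2 * D) * (2 * D)))) * (K * K))) :
    t ≤ (4 * H * (8 * H * K ^ 2 + 8 * H * K ^ 3 + 16 * L ^ 2 * K ^ 3) + 1) * (p ^ 11 * e) := by
  set C := 4 * H * (8 * H * K ^ 2 + 8 * H * K ^ 3 + 16 * L ^ 2 * K ^ 3)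
  have hC : 0 ≤ C := by positivity
  have he2 : 1 ≤ e ^ 2 := one_le_pow₀ he
  have hp4 : p ^ 10 ≤ p ^ 14 := pow_le_pow_right₀ hp (by norm_num)
  have h14 : p ^ 14 ≤ p ^ 14 * e ^ 2 := le_mul_of_one_le_right (by positivity) he2
  have h10 : p ^ 10 * e ^ 2 ≤ p ^ 14 * e ^ 2 := by gcongr
  have hsq : t ^ 2 ≤ C * (p ^ 11 * e) ^ 2 := by
    calc t ^ 2 ≤ _ := h
      _ ≤ (2 * (H * p ^ 3)) * (2 * p ^ 5) * ((2 * (H * p ^ 3)) * (2 * p ^ 5) * (2 * p ^ 6) * (K * K) +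
        (((2 * (H * p ^ 3)) * (2 * p ^ 6)) * ((2 * p ^ 5) * K) + ((2 * p ^ 5) * (2 * p ^ 5)) *
          (K * ((2 * (L * e)) * (2 * (L * e))))) * (K * K)) := by gcongr
      _ = 4 * H * p ^ 8 * ((8 * H * K ^ 2 + 8 * H * K ^ 3) * p ^ 14 +
          16 * L ^ 2 * K ^ 3 * (p ^ 10 * e ^ 2)) := by ring
      _ ≤ 4 * H * p ^ 8 * ((8 * H * K ^ 2 + 8 * H * K ^ 3) * (p ^ 14 * e ^ 2) +
          16 * L ^ 2 * K ^ 3 * (p ^ 14 * e ^ 2)) := by gcongr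
      _ = _ := by simp only [C]; ring
  have hu : 0 ≤ p ^ 11 * e := by positivity
  refine le_of_sq_le_sq ?_ (by positivity)
  calc t ^ 2 ≤ C * (p ^ 11 * e) ^ 2 := hsq
    _ ≤ (C + 1) ^ 2 * (p ^ 11 * e) ^ 2 := by gcongr; nlinarith
    _ = _ := by ring


/-- **Fourth moment estimate with diminishing ranges (Lemma 2.2).**
The number of integral solutions of
`|(x₁-μ₁)³ - (y₁-μ₁)³ + (x₂-μ₂)³ - (y₂-μ₂)³| < η` with `P < x₁, y₁ ≤ 2P`
and `P^{5/6} < x₂, y₂ ≤ 2P^{5/6}` is `O(P^{11/6+ε})`. -/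
theorem fourth_moment_shifted_cubes
    (η : ℝ) (hη : 0 < η) (μ₁ μ₂ : ℝ) (ε : ℝ) (hε : 0 < ε) :
    ∃ C : ℝ, 0 < C ∧ ∀ P : ℝ, 2 ≤ P →
      (Nat.card {v : ℤ × ℤ × ℤ × ℤ //
          P < (v.1 : ℝ) ∧ (v.1 : ℝ) ≤ 2 * P ∧
          P < (v.2.1 : ℝ) ∧ (v.2.1 : ℝ) ≤ 2 * P ∧
          P ^ ((5:ℝ)/6) < (v.2.2.1 : ℝ) ∧ (v.2.2.1 : ℝ) ≤ 2 * P ^ ((5:ℝ)/6) ∧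
          P ^ ((5:ℝ)/6) < (v.2.2.2 : ℝ) ∧ (v.2.2.2 : ℝ) ≤ 2 * P ^ ((5:ℝ)/6) ∧
          |((v.1 : ℝ) - μ₁) ^ 3 - ((v.2.1 : ℝ) - μ₁) ^ 3 +
            ((v.2.2.1 : ℝ) - μ₂) ^ 3 - ((v.2.2.2 : ℝ) - μ₂) ^ 3| < η} : ℝ)
        ≤ C * P ^ (11/6 + ε : ℝ) := by
  classical
  obtain ⟨Cd, hCd, hdiv⟩ := Nat.exists_card_divisors_le_rpow (2 * ε / 5) (by positivity)
  obtain ⟨K, hKη⟩ := exists_nat_ge (8 * (4 * η) + 2)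
  set H : ℝ := 2 * (η + 2 * (2 + |μ₂|) ^ 3) + 2 * |μ₁|
  set b : ℝ := 2 * (2 + |μ₂|) ^ 3 + 4 * η
  set L : ℝ := Cd * b ^ (2 * ε / 5)
  have hH : 0 ≤ H := by positivity
  have hb : 0 < b := by positivity
  have hL : 0 ≤ L := by positivity
  refine ⟨4 * K + (4 * H * (8 * H * K ^ 2 + 8 * H * K ^ 3 + 16 * L ^ 2 * K ^ 3) + 1),
    by positivity, fun P hP ↦ ?_⟩
  obtain ⟨p, hpdef⟩ : ∃ p, p = P ^ ((1 : ℝ) / 6) := ⟨_, rfl⟩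
  obtain ⟨e, hedef⟩ : ∃ e, e = P ^ ε := ⟨_, rfl⟩
  have hP0 : 0 < P := by linarith
  have hp : 1 ≤ p := hpdef ▸ Real.one_le_rpow (by linarith) (by norm_num)
  have he : 1 ≤ e := hedef ▸ Real.one_le_rpow (by linarith) hε.le
  have hpow (n : ℕ) : p ^ n = P ^ ((n : ℝ) / 6) := by
    rw [hpdef, ← Real.rpow_natCast, ← Real.rpow_mul hP0.le]
    congr 1
    ring
  have hP6 : P = p ^ 6 := by rw [hpow]; norm_num
  have hP5 : P ^ ((5 : ℝ) / 6) = p ^ 5 := by rw [hpow]; norm_num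
  have hfin : P ^ (11 / 6 + ε : ℝ) = p ^ 11 * e := by
    rw [Real.rpow_add hP0, hpow, hedef]; norm_num
  have hp15 : (p ^ 15) ^ (2 * ε / 5) = e := by
    rw [hpow, hedef, ← Real.rpow_mul hP0.le]
    congr 1
    push_cast
    ring
  rw [hfin, hP5]
  clear hfin hpow hedef hpdef hP5
  subst hP6
  have hp5 : 1 ≤ p ^ 5 := one_le_pow₀ hp
  set X := Finset.Ioc ⌊p ^ 6⌋ ⌊2 * p ^ 6⌋
  set Z := Finset.Ioc ⌊p ^ 5⌋ ⌊2 * p ^ 5⌋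
  set A := (Finset.Icc (-⌊H * p ^ 3⌋) ⌊H * p ^ 3⌋).erase 0
  set J := (Finset.Icc (-⌊p ^ 6⌋) ⌊p ^ 6⌋).erase 0
  set c : ℤ → ℝ := fun z ↦ ((z : ℝ) - μ₂) ^ 3
  set D : ℕ := ⌊L * e⌋₊
  have hc {z} (hz : z ∈ Z) : |c z| ≤ (2 + |μ₂|) ^ 3 * p ^ 15 :=
    abs_cube_sub_le μ₂ p z hp (mem_Ioc_floor.1 hz).1 (mem_Ioc_floor.1 hz).2
  have hK (κ) : (Z.filter fun z ↦ |c z - κ| < 4 * η).card ≤ K :=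
    Nat.cast_le.1 ((card_filter_cube_le Z μ₂ κ (4 * η) (by positivity)).trans hKη)
  have hD (M : ℤ) (hM : M ≠ 0) (h : ∃ z ∈ Z, ∃ z' ∈ Z, |(M : ℝ) + (c z - c z')| < 4 * η) :
      M.natAbs.divisors.card ≤ D := by
    obtain ⟨z, hz, z', hz', h⟩ := h
    have hMb : (M.natAbs : ℝ) ≤ b * p ^ 15 := by
      rw [Nat.cast_natAbs, Int.cast_abs]
      have h1 := hc hz
      have h2 := hc hz'
      have h3 : 1 ≤ p ^ 15 := one_le_pow₀ hp
      have h4 : b * p ^ 15 = 2 * ((2 + |μ₂|) ^ 3 * p ^ 15) + 4 * η * p ^ 15 := by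
        simp only [b]; ring
      have h5 : 4 * η ≤ 4 * η * p ^ 15 := le_mul_of_one_le_right (by positivity) h3
      rw [abs_lt] at h
      rw [abs_le] at *
      constructor <;> linarith
    refine Nat.le_floor ?_
    calc (M.natAbs.divisors.card : ℝ) ≤ Cd * (M.natAbs : ℝ) ^ (2 * ε / 5) :=
          hdiv _ (Int.natAbs_ne_zero.2 hM)
      _ ≤ Cd * (b * p ^ 15) ^ (2 * ε / 5) := by gcongr
      _ = L * e := by
          rw [Real.mul_rpow hb.le (by positivity), hp15]
          ring
  have hXJ : ∀ y ∈ X, ∀ y' ∈ X, y ≠ y' → y - y' ∈ J := by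
    intro y hy y' hy' hne
    have h1 := mem_Ioc_floor.1 hy
    have h2 := mem_Ioc_floor.1 hy'
    refine mem_Icc_floor_erase_zero.2 ⟨sub_ne_zero.2 hne, ?_⟩
    push_cast
    exact abs_le.2 ⟨by linarith, by linarith⟩
  have hT := sq_card_difference_le A J X Z c μ₁ η hη K D (by simp [A]) (by simp [J]) hXJ hK
    (by linarith) hD
  set T := ((A ×ˢ Z) ×ˢ (X ×ˢ Z)).filter fun p ↦
    |((p.2.1 + p.1.1 : ℤ) - μ₁) ^ 3 - (p.2.1 - μ₁) ^ 3 + c p.2.2 - c p.1.2| < η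
  have hX : (X.card : ℝ) ≤ 2 * p ^ 6 := card_Ioc_floor_le _ (one_le_pow₀ hp)
  have hZ : (Z.card : ℝ) ≤ 2 * p ^ 5 := card_Ioc_floor_le _ hp5
  have hTle := le_of_sq_le_moment_bound T.card A.card J.card X.card Z.card K D H L p e
    (by positivity) (by positivity) (by positivity) (by positivity) (by positivity) (by positivity)
    hH hL hp he (card_Icc_floor_erase_zero_le _ (by positivity))
    (card_Icc_floor_erase_zero_le _ (by positivity)) hX hZ
    (Nat.floor_le (by positivity)) (by exact_mod_cast hT)
  set S := (X ×ˢ X ×ˢ Z ×ˢ Z).filter fun v ↦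
    |((v.1 : ℝ) - μ₁) ^ 3 - (v.2.1 - μ₁) ^ 3 + c v.2.2.1 - c v.2.2.2| < η
  have hS {v} (hv : v ∈ S) : (v.1 ∈ X ∧ v.2.1 ∈ X ∧ v.2.2.1 ∈ Z ∧ v.2.2.2 ∈ Z) ∧
      |((v.1 : ℝ) - μ₁) ^ 3 - (v.2.1 - μ₁) ^ 3 + c v.2.2.1 - c v.2.2.2| < η := by
    simpa only [S, Finset.mem_filter, Finset.mem_product] using hv
  rw [Nat.subtype_card S fun v ↦ by
    simp only [S, Finset.mem_filter, Finset.mem_product, X, Z, mem_Ioc_floor, and_assoc, c],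
    ← Finset.card_filter_add_card_filter_not (s := S) (fun v ↦ v.1 = v.2.1), Nat.cast_add, add_mul]
  refine add_le_add ?_ (le_trans ?_ hTle)
  · have hdiag : (S.filter fun v ↦ v.1 = v.2.1).card ≤ X.card * (Z.card * K) := by
      calc _ ≤ (X ×ˢ ((Z ×ˢ Z).filter fun q ↦ |c q.2 - c q.1| < 4 * η)).card := by
            refine Finset.card_le_card_of_injOn Prod.snd ?_ ?_
            · rintro ⟨x, y, z, w⟩ hv
              obtain ⟨hv, h : x = y⟩ := Finset.mem_filter.1 hv
              subst h
              obtain ⟨h1, h2⟩ := hS hv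
              refine Finset.mem_product.2 ⟨h1.2.1, Finset.mem_filter.2
                ⟨Finset.mem_product.2 h1.2.2, ?_⟩⟩
              rw [sub_self, zero_add, abs_sub_comm] at h2
              exact h2.trans (by linarith)
            · rintro ⟨x, v⟩ hv ⟨x', v'⟩ hv' (rfl : v = v')
              have h1 := (Finset.mem_filter.1 hv).2
              have h2 := (Finset.mem_filter.1 hv').2
              exact Prod.ext (h1.trans h2.symm) rfl
        _ ≤ _ := by
            rw [Finset.card_product]
            exact Nat.mul_le_mul_left _ (Finset.card_filter_product_le_mul Z Z
              (fun z w ↦ |c w - c z| < 4 * η) K fun z _ ↦ hK _)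
    calc ((S.filter fun v ↦ v.1 = v.2.1).card : ℝ) ≤ X.card * (Z.card * K) := by
          exact_mod_cast hdiag
      _ ≤ (2 * p ^ 6) * ((2 * p ^ 5) * K) := by gcongr
      _ = 4 * K * (p ^ 11 * 1) := by ring
      _ ≤ 4 * K * (p ^ 11 * e) := by gcongr
  · refine Nat.cast_le.2 (Finset.card_le_card_of_injOn
      (fun v ↦ ((v.1 - v.2.1, v.2.2.2), (v.2.1, v.2.2.1))) ?_ ?_)
    · rintro ⟨x, y, z, w⟩ hv
      obtain ⟨hv, hne⟩ := Finset.mem_filter.1 hv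
      obtain ⟨⟨hx, hy, hz, hw⟩, h2⟩ := hS hv
      refine Finset.mem_filter.2 ⟨?_, ?_⟩
      · simp only [Finset.mem_product]
        refine ⟨⟨mem_Icc_floor_erase_zero.2 ⟨sub_ne_zero.2 hne, ?_⟩, hw⟩, hy, hz⟩
        push_cast
        rw [mem_Ioc_floor] at hx hy hz hw
        exact abs_sub_le_of_cubes_close μ₁ μ₂ η p x y z w hη hp hx.1 hx.2 hy.1 hy.2 hz.1 hz.2
          hw.1 hw.2 h2
      · simpa only [add_sub_cancel] using h2
    · rintro ⟨x, y, z, w⟩ _ ⟨x', y', z', w'⟩ _ h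
      simp only [Prod.mk.injEq] at h ⊢
      omega
end
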